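/- Let i ∈ Σ_{n+1} and let λ be a regular dominant integral weight. Then the following are equivalent: (1) the string polytope Δ_i(λ) is unimodularly equivalent to the Gelfand–Cetlin polytope GC(λ); (2) Δ_i(λ) has exactly n(n+1) facets; (3) the string cone C_i is simplicial, i.e. a full-dimensional cone in ℝ^N with exactly N facets; (4) there exists a sequence (σ_1, …, σ_n) ∈ {A, D}^n such that ind_{σ_k}(C_{σ_{k+1}} ∘ ⋯ ∘ C_{σ_n}(i)) = 0 for all k = n, n−1, …, 1. -/

import Mathlib

open scoped Classical

noncomputable section

namespace StringPolytope

/-! ### Words, reduced words, two-moves -/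

/-- the simple transposition `s_a = (a, a+1)` acting on `ℕ` (wires are `1, …, n+1`). -/
def sTrans (a : ℕ) : Equiv.Perm ℕ := Equiv.swap a (a + 1)

/-- product `s_{i₁} ⋯ s_{i_N}` of the simple transpositions of a word. -/
def wordProd (w : List ℕ) : Equiv.Perm ℕ := (w.map sTrans).prod

/-- the longest element `w₀` of the symmetric group on `{1, …, n+1}`,
sending `k ↦ n + 2 - k` there and fixing everything else. -/
def longestPerm (n : ℕ) : Equiv.Perm ℕ :=
  Function.Involutive.toPerm
    (fun k => if 1 ≤ k ∧ k ≤ n + 1 then n + 2 - k else k)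
    (by intro k; dsimp only; split_ifs <;> omega)

/-- `w ∈ Σ_{n+1}`: a reduced word of the longest element of `S_{n+1}`,
i.e. a word over `[n] = {1,…,n}` of length `N = n(n+1)/2` whose product is `w₀`. -/
def IsReduced (n : ℕ) (w : List ℕ) : Prop :=
  w.length = n * (n + 1) / 2 ∧ (∀ a ∈ w, 1 ≤ a ∧ a ≤ n) ∧ wordProd w = longestPerm n

/-- a single 2-move: exchange two adjacent letters `(a, b)` with `|a - b| > 1`. -/
def TwoMoveStep (w w' : List ℕ) : Prop :=
  ∃ u v a b, (a + 1 < b ∨ b + 1 < a) ∧ w = u ++ a :: b :: v ∧ w' = u ++ b :: a :: v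

/-- 2-move equivalence of words. -/
def TwoMoveEquiv : List ℕ → List ℕ → Prop := Relation.ReflTransGen TwoMoveStep

/-- `A_n = (1, 2, …, n)`. -/
def ascWord (n : ℕ) : List ℕ := (List.range n).map (· + 1)

/-- `D_n = (n, n-1, …, 1)`. -/
def descWord (n : ℕ) : List ℕ := (ascWord n).reverse

/-! ### The wiring diagram -/

/-- the letter `i_j` of `w` (1-based index `j`); the node `t_j` lies in column `i_j`. -/
def letterAt (w : List ℕ) (j : ℕ) : ℕ := w.getD (j - 1) 0

/-- `1 ≤ j ≤ N`: `t_j` is an actual node of the diagram. -/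
def ValidNode (w : List ℕ) (j : ℕ) : Prop := 1 ≤ j ∧ j ≤ w.length

/-- the column-to-wire assignment just above node `t_j`
(at the top of the diagram, wire `k` is in column `k`). -/
def stateAbove (w : List ℕ) (j : ℕ) : Equiv.Perm ℕ := wordProd (w.take (j - 1))

/-- the column-to-wire assignment just below node `t_j`. -/
def stateBelow (w : List ℕ) (j : ℕ) : Equiv.Perm ℕ := wordProd (w.take j)

/-- one of the two wires crossing at node `t_j` (the one leaving upward-left). -/
def wireX (w : List ℕ) (j : ℕ) : ℕ := stateAbove w j (letterAt w j)

/-- the other wire crossing at node `t_j` (the one leaving upward-right). -/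
def wireY (w : List ℕ) (j : ℕ) : ℕ := stateAbove w j (letterAt w j + 1)

/-- the node `t_j` lies on the wire `ℓ_r`. -/
def NodeOnWire (w : List ℕ) (j r : ℕ) : Prop := wireX w j = r ∨ wireY w j = r

/-- given one wire `r` at node `t_j`, the other wire crossing there. -/
def otherWire (w : List ℕ) (j r : ℕ) : ℕ := if wireX w j = r then wireY w j else wireX w j

/-- the column of wire `ℓ_r` at the height of node `t_j`. -/
def wireCol (w : List ℕ) (j r : ℕ) : ℕ := (stateBelow w j).symm r

/-- node `t_j` lies strictly below the wire `ℓ_{n+1}`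
(which runs from the bottom-left corner to the top-right corner). -/
def BelowWireLast (n : ℕ) (w : List ℕ) (j : ℕ) : Prop :=
  wireCol w j (n + 1) < letterAt w j

/-- node `t_j` lies strictly above the wire `ℓ_{n+1}`. -/
def AboveWireLast (n : ℕ) (w : List ℕ) (j : ℕ) : Prop :=
  letterAt w j + 1 < wireCol w j (n + 1)

/-- node `t_j` lies strictly below the wire `ℓ_1`
(which runs from the bottom-right corner to the top-left corner). -/
def BelowWireOne (w : List ℕ) (j : ℕ) : Prop :=
  letterAt w j + 1 < wireCol w j 1

/-- node `t_j` lies strictly above the wire `ℓ_1`. -/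
def AboveWireOne (w : List ℕ) (j : ℕ) : Prop :=
  wireCol w j 1 < letterAt w j

/-! ### Rigorous (Gleizer–Postnikov) paths

A path in `G(i, k)` is encoded by `k` together with the list of its switching
nodes, in order of travel.  Wires `ℓ_1, …, ℓ_k` are oriented upward
(decreasing node index) and the remaining wires downward. -/

/-- the (1-based indices of the) nodes lying on wire `ℓ_r`, in order of increasing index. -/
def nodesOn (w : List ℕ) (r : ℕ) : List ℕ :=
  ((List.range w.length).map (· + 1)).filter (fun j => decide (NodeOnWire w j r))

/-- nodes on wire `ℓ_r` strictly between the nodes `t_a` and `t_b`. -/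
def segList (w : List ℕ) (r a b : ℕ) : List ℕ :=
  (nodesOn w r).filter (fun j => decide (min a b < j ∧ j < max a b))

/-- nodes on wire `ℓ_r` strictly below the node `t_a`. -/
def tailList (w : List ℕ) (r a : ℕ) : List ℕ :=
  (nodesOn w r).filter (fun j => decide (a < j))

/-- a forbidden fragment of `G(i, k)`: the path passes straight through node `t_j`
travelling along the wire `ℓ_r`, where the other wire `ℓ_b` crossing there has the same
orientation as `ℓ_r` and (`r < b` if both upward, `r > b` if both downward). -/
def Forbidden (w : List ℕ) (k j r : ℕ) : Prop :=
  (r ≤ k ∧ otherWire w j r ≤ k ∧ r < otherWire w j r) ∨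
  (k < r ∧ k < otherWire w j r ∧ otherWire w j r < r)

/-- travelling in `G(i,k)`: currently on wire `ℓ_r` at node `t_a` (just switched there),
with future switching nodes `ms`; the travel is legal and ends at `L_{k+1}`. -/
def TravelOK (w : List ℕ) (k : ℕ) : ℕ → ℕ → List ℕ → Prop
  | r, a, [] => r = k + 1 ∧ ∀ j ∈ tailList w r a, ¬ Forbidden w k j r
  | r, a, m :: ms =>
      ValidNode w m ∧ NodeOnWire w m r ∧
      (if r ≤ k then m < a else a < m) ∧
      (∀ j ∈ segList w r a m, ¬ Forbidden w k j r) ∧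
      TravelOK w k (otherWire w m r) m ms

/-- all nodes visited after the switch at node `t_a` onto wire `ℓ_r`. -/
def visitTail (w : List ℕ) : ℕ → ℕ → List ℕ → List ℕ
  | r, a, [] => tailList w r a
  | r, a, m :: ms => segList w r a m ++ m :: visitTail w (otherWire w m r) m ms

/-- the list of all nodes visited by the path (switching nodes and straight passes). -/
def visitList (w : List ℕ) (k : ℕ) : List ℕ → List ℕ
  | [] => []
  | m :: ms => tailList w k m ++ m :: visitTail w (otherWire w m k) m ms

/-- `(k, ms)` encodes a rigorous (Gleizer–Postnikov) path in `G(i, k)`: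
it starts at `L_k` going up the wire `ℓ_k`, switches wires exactly at the nodes
listed in `ms`, respects the orientation, ends at `L_{k+1}`, contains no forbidden
fragment and passes through each node at most once. -/
def IsGPPath (n : ℕ) (w : List ℕ) (k : ℕ) (ms : List ℕ) : Prop :=
  1 ≤ k ∧ k ≤ n ∧
  (match ms with
   | [] => False
   | m :: rest =>
       ValidNode w m ∧ NodeOnWire w m k ∧
       (∀ j ∈ tailList w k m, ¬ Forbidden w k j k) ∧
       TravelOK w k (otherWire w m k) m rest) ∧
  (visitList w k ms).Nodup

/-- the set `GP(i)` of all rigorous paths of `G(i)`. -/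
def GP (n : ℕ) (w : List ℕ) : Set (ℕ × List ℕ) := {p | IsGPPath n w p.1 p.2}

/-- `|GP(i)|`, the number of rigorous paths. -/
def numGP (n : ℕ) (w : List ℕ) : ℕ := (GP n w).ncard

/-- the successive switches of a path: `(node, from-wire, to-wire)`. -/
def pathSwitches (w : List ℕ) : ℕ → List ℕ → List (ℕ × ℕ × ℕ)
  | _, [] => []
  | r, m :: ms => (m, r, otherWire w m r) :: pathSwitches w (otherWire w m r) ms

/-- the wire-expression of a path: the successive wires travelled. -/
def wireSeq (w : List ℕ) : ℕ → List ℕ → List ℕ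
  | r, [] => [r]
  | r, m :: ms => r :: wireSeq w (otherWire w m r) ms

/-- the peaks of a path: switching nodes where the path switches from an
upward wire to a downward wire. -/
def peaks (w : List ℕ) (k : ℕ) (ms : List ℕ) : List ℕ :=
  ((pathSwitches w k ms).filter (fun e => decide (e.2.1 ≤ k ∧ k < e.2.2))).map (·.1)

/-! ### String cone, `λ`-cone, string polytope -/

/-- `N = n(n+1)/2`, the number of nodes. -/
abbrev Dim (n : ℕ) : ℕ := n * (n + 1) / 2

/-- the coefficient `a_j` of `t_j` in the string inequality of the path `(k, ms)`:
`+1` if the path switches at `t_j` from `ℓ_r` to `ℓ_s` with `r < s`,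
`-1` if it switches with `r > s`, and `0` otherwise. -/
def coeff (w : List ℕ) (k : ℕ) (ms : List ℕ) (j : ℕ) : ℝ :=
  ((pathSwitches w k ms).map (fun e =>
    if e.1 = j then (if e.2.1 < e.2.2 then (1 : ℝ) else -1) else 0)).sum

/-- the (primitive inward normal) coefficient vector of the string inequality of a path. -/
def normalVec (n : ℕ) (w : List ℕ) (p : ℕ × List ℕ) : Fin (Dim n) → ℝ :=
  fun j => coeff w p.1 p.2 ((j : ℕ) + 1)

/-- the left-hand side `∑ a_j t_j` of the string inequality of the path `p`. -/
def stringIneq (n : ℕ) (w : List ℕ) (p : ℕ × List ℕ) (t : Fin (Dim n) → ℝ) : ℝ :=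
  ∑ j : Fin (Dim n), normalVec n w p j * t j

/-- the string cone `C_i ⊆ ℝ^N`. -/
def stringCone (n : ℕ) (w : List ℕ) : Set (Fin (Dim n) → ℝ) :=
  {t | ∀ p ∈ GP n w, 0 ≤ stringIneq n w p t}

/-- the polyhedron cut out by all string inequalities except the one of `p₀`. -/
def stringConeExcept (n : ℕ) (w : List ℕ) (p₀ : ℕ × List ℕ) : Set (Fin (Dim n) → ℝ) :=
  {t | ∀ p ∈ GP n w, p ≠ p₀ → 0 ≤ stringIneq n w p t}

/-- the coefficient `a_k` in the `λ`-inequality of node `t_j`: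
`1` if `t_k` is one column left or right of `t_j`, `-2` if in the same column. -/
def lamCoeff (w : List ℕ) (j k : ℕ) : ℝ :=
  if letterAt w k = letterAt w j then -2
  else if letterAt w k = letterAt w j + 1 ∨ letterAt w k + 1 = letterAt w j then 1
  else 0

/-- the `λ`-inequality of node `t_{j+1}`:
`t_j ≤ λ_{i_j} + ∑_{k > j} a_k t_k`. -/
def LamIneq (n : ℕ) (w : List ℕ) (lam : ℕ → ℤ) (j : Fin (Dim n)) (t : Fin (Dim n) → ℝ) : Prop :=
  t j ≤ (lam (letterAt w ((j : ℕ) + 1)) : ℝ) +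
    ∑ k : Fin (Dim n),
      (if (j : ℕ) < (k : ℕ) then lamCoeff w ((j : ℕ) + 1) ((k : ℕ) + 1) else 0) * t k

/-- the `λ`-cone `C_i^λ ⊆ ℝ^N`. -/
def lamCone (n : ℕ) (w : List ℕ) (lam : ℕ → ℤ) : Set (Fin (Dim n) → ℝ) :=
  {t | ∀ j, LamIneq n w lam j t}

/-- the polyhedron cut out by all `λ`-inequalities except the one of `j₀`. -/
def lamConeExcept (n : ℕ) (w : List ℕ) (lam : ℕ → ℤ) (j₀ : Fin (Dim n)) :
    Set (Fin (Dim n) → ℝ) :=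
  {t | ∀ j, j ≠ j₀ → LamIneq n w lam j t}

/-- the string polytope `Δ_i(λ) = C_i ∩ C_i^λ`. -/
def stringPolytope (n : ℕ) (w : List ℕ) (lam : ℕ → ℤ) : Set (Fin (Dim n) → ℝ) :=
  stringCone n w ∩ lamCone n w lam

/-- `λ = λ_1 ϖ_1 + ⋯ + λ_n ϖ_n` is a dominant integral weight: all `λ_j ≥ 0`. -/
def Dominant (n : ℕ) (lam : ℕ → ℤ) : Prop := ∀ j, 1 ≤ j → j ≤ n → 0 ≤ lam j

/-- `λ` is a regular dominant integral weight: all `λ_j > 0`. -/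
def RegularDominant (n : ℕ) (lam : ℕ → ℤ) : Prop := ∀ j, 1 ≤ j → j ≤ n → 0 < lam j

/-! ### Unimodular equivalence, Gelfand–Cetlin polytope, facets -/

/-- `P` and `Q` are unimodularly equivalent: `Q = M(P) + v` with `M ∈ GL(m, ℤ)`, `v ∈ ℤ^m`. -/
def UnimodEquiv {m : ℕ} (P Q : Set (Fin m → ℝ)) : Prop :=
  ∃ (M : Matrix (Fin m) (Fin m) ℤ) (v : Fin m → ℤ), IsUnit M.det ∧
    Q = (fun x i => (∑ j, (M i j : ℝ) * x j) + (v i : ℝ)) '' P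

/-- the entry `x_{k,j}` (`1 ≤ j ≤ k ≤ n+1`) of a Gelfand–Cetlin pattern, where the
top row is `x_{n+1,j} = λ_j + ⋯ + λ_n` and `x_{n+1,n+1} = 0`; the pair `(k, j)` is
encoded as the coordinate `k(k-1)/2 + (j-1)` of `ℝ^N`. -/
def gcX (n : ℕ) (lam : ℕ → ℤ) (x : Fin (Dim n) → ℝ) (k j : ℕ) : ℝ :=
  if k = n + 1 then (if j ≤ n then ∑ t ∈ Finset.Icc j n, (lam t : ℝ) else 0)
  else if h : k * (k - 1) / 2 + (j - 1) < Dim n then x ⟨k * (k - 1) / 2 + (j - 1), h⟩ else 0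

/-- the Gelfand–Cetlin polytope `GC(λ) ⊆ ℝ^N`. -/
def GCPolytope (n : ℕ) (lam : ℕ → ℤ) : Set (Fin (Dim n) → ℝ) :=
  {x | ∀ k j, 1 ≤ k → k ≤ n → 1 ≤ j → j ≤ k →
      gcX n lam x k j ≤ gcX n lam x (k + 1) j ∧
      gcX n lam x (k + 1) (j + 1) ≤ gcX n lam x k j}

/-- a face of a convex set: a convex extreme subset. -/
def IsFaceSet {m : ℕ} (S F : Set (Fin m → ℝ)) : Prop := IsExtreme ℝ S F ∧ Convex ℝ F

/-- a facet: a maximal proper face. -/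
def IsFacet {m : ℕ} (S F : Set (Fin m → ℝ)) : Prop :=
  IsFaceSet S F ∧ F ≠ S ∧ ∀ G, IsFaceSet S G → G ≠ S → F ⊆ G → F = G

/-- the number of facets. -/
def numFacets {m : ℕ} (S : Set (Fin m → ℝ)) : ℕ := {F | IsFacet S F}.ncard

/-- combinatorial equivalence: an inclusion-preserving bijection between face lattices. -/
def CombEquiv {m : ℕ} (S T : Set (Fin m → ℝ)) : Prop :=
  ∃ e : {F // IsFaceSet S F} ≃ {F // IsFaceSet T F},
    ∀ F G : {F // IsFaceSet S F}, F.1 ⊆ G.1 ↔ (e F).1 ⊆ (e G).1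

/-! ### Indices, contractions and extensions -/

/-- the `D`-index `ind_D(i) = |i_D^+|` for a decomposition `i ∼ i_D^- D_n i_D^+`
(independent of the decomposition). -/
def indD (n : ℕ) (w : List ℕ) : ℕ :=
  sInf {s | ∃ u v : List ℕ, v.length = s ∧ TwoMoveEquiv w (u ++ descWord n ++ v)}

/-- the `A`-index `ind_A(i) = |i_A^+|` for a decomposition `i ∼ i_A^- A_n i_A^+`. -/
def indA (n : ℕ) (w : List ℕ) : ℕ :=
  sInf {s | ∃ u v : List ℕ, v.length = s ∧ TwoMoveEquiv w (u ++ ascWord n ++ v)}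

/-- `w'` is a `D`-contraction `C_D(w) = i_D^- (i_D^+ - 1)` of `w ∈ Σ_{n+1}`. -/
def IsContractionD (n : ℕ) (w w' : List ℕ) : Prop :=
  ∃ u v : List ℕ, TwoMoveEquiv w (u ++ descWord n ++ v) ∧ w' = u ++ v.map (· - 1)

/-- `w'` is an `A`-contraction `C_A(w) = (i_A^- - 1) i_A^+` of `w ∈ Σ_{n+1}`. -/
def IsContractionA (n : ℕ) (w w' : List ℕ) : Prop :=
  ∃ u v : List ℕ, TwoMoveEquiv w (u ++ ascWord n ++ v) ∧ w' = u.map (· - 1) ++ v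

/-- the `D`-extension `E_D(s) : Σ_{n+1} → Σ_{n+2}`,
`i = i^-(s) i^+(s) ↦ i^-(s) D_{n+1} (i^+(s) + 1)` where `|i^+(s)| = s`. -/
def extD (n : ℕ) (s : ℕ) (w : List ℕ) : List ℕ :=
  w.take (w.length - s) ++ descWord (n + 1) ++ (w.drop (w.length - s)).map (· + 1)

/-- the `A`-extension `E_A(s) : Σ_{n+1} → Σ_{n+2}`,
`i = i^-(s) i^+(s) ↦ (i^-(s) + 1) A_{n+1} i^+(s)`. -/
def extA (n : ℕ) (s : ℕ) (w : List ℕ) : List ℕ :=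
  (w.take (w.length - s)).map (· + 1) ++ ascWord (n + 1) ++ w.drop (w.length - s)

/-- there exists `(σ_1, …, σ_n) ∈ {A, D}^n` (here `true = D`, `false = A`) such that
`ind_{σ_k}(C_{σ_{k+1}} ∘ ⋯ ∘ C_{σ_n}(i)) = 0` for all `k = n, …, 1`. -/
def SimplicialWord (n : ℕ) (w : List ℕ) : Prop :=
  ∃ (σ : ℕ → Bool) (c : ℕ → List ℕ), c n = w ∧
    ∀ k, 1 ≤ k → k ≤ n →
      (if σ k then IsContractionD k (c k) (c (k - 1)) ∧ indD k (c k) = 0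
       else IsContractionA k (c k) (c (k - 1)) ∧ indA k (c k) = 0)


/-- the `D`-coindex `coind_D(i) = |i_D^-|`. -/
def coindD (n : ℕ) (w : List ℕ) : ℕ :=
  sInf {s | ∃ u v : List ℕ, u.length = s ∧ TwoMoveEquiv w (u ++ descWord n ++ v)}

/-- the `A`-coindex `coind_A(i) = |i_A^-|`. -/
def coindA (n : ℕ) (w : List ℕ) : ℕ :=
  sInf {s | ∃ u v : List ℕ, u.length = s ∧ TwoMoveEquiv w (u ++ ascWord n ++ v)}

/-- the `a`-th (0-based) coordinate of a point of `ℝ^N`. -/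
def entry (n : ℕ) (t : Fin (Dim n) → ℝ) (a : ℕ) : ℝ :=
  if h : a < Dim n then t ⟨a, h⟩ else 0

/-- the product of cones
`t_1 ≥ 0`, `t_2 ≥ t_3 ≥ 0`, …, `t_{N-n+1} ≥ ⋯ ≥ t_N ≥ 0` (in `ℝ^N`, 1-based:
for `k = 1, …, n` the chain `t_{k(k-1)/2+1} ≥ ⋯ ≥ t_{k(k-1)/2+k} ≥ 0`). -/
def chainCone (n : ℕ) : Set (Fin (Dim n) → ℝ) :=
  {t | ∀ k j, 1 ≤ k → k ≤ n → 1 ≤ j → j ≤ k →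
    (if j = k then 0 else entry n t (k * (k - 1) / 2 + j)) ≤
      entry n t (k * (k - 1) / 2 + (j - 1))}


/-! ### Facets of polyhedra -/

def AffOn {m : ℕ} (f : (Fin m → ℝ) → ℝ) : Prop :=
  ∀ x y (a b : ℝ), a + b = 1 → f (a • x + b • y) = a * f x + b * f y

def polyH {m : ℕ} {ι : Type} (ell : ι → (Fin m → ℝ) → ℝ) : Set (Fin m → ℝ) :=
  {x | ∀ a, 0 ≤ ell a x}

def faceH {m : ℕ} {ι : Type} (ell : ι → (Fin m → ℝ) → ℝ) (a : ι) : Set (Fin m → ℝ) :=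
  {x | x ∈ polyH ell ∧ ell a x = 0}

theorem faceH_isFace {m : ℕ} {ι : Type} (ell : ι → (Fin m → ℝ) → ℝ)
    (haff : ∀ a, AffOn (ell a)) (a : ι) : IsFaceSet (polyH ell) (faceH ell a) := by
  refine ⟨⟨fun x hx => hx.1, ?_⟩, ?_⟩
  · rintro x hx y hy z hz ⟨c, d, hc, hd, hcd, rfl⟩
    refine ⟨hx, ?_⟩
    have h1 := hz.2
    rw [haff a x y c d hcd] at h1
    have h2 := hx a
    have h3 := hy a
    have h4 : 0 ≤ c * ell a x := by positivity
    have h5 : 0 ≤ d * ell a y := by positivity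
    have h6 : c * ell a x = 0 := by linarith
    rcases mul_eq_zero.1 h6 with h | h
    · exact absurd h hc.ne'
    · exact h
  · intro x hx y hy c d hc hd hcd
    refine ⟨fun b => ?_, ?_⟩
    · rw [haff b x y c d hcd]
      have := hx.1 b
      have := hy.1 b
      positivity
    · rw [haff a x y c d hcd, hx.2, hy.2]; simp

theorem face_subset_faceH {m : ℕ} {ι : Type} [Finite ι] [Nonempty ι]
    (ell : ι → (Fin m → ℝ) → ℝ)
    (haff : ∀ a, AffOn (ell a)) (G : Set (Fin m → ℝ)) (hG : IsFaceSet (polyH ell) G)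
    (hne : G ≠ polyH ell) : ∃ a, G ⊆ faceH ell a := by
  by_contra hcon
  push Not at hcon
  have hy : ∀ a, ∃ y ∈ G, 0 < ell a y := by
    intro a
    obtain ⟨y, hyG, hy⟩ := Set.not_subset.1 (hcon a)
    refine ⟨y, hyG, lt_of_le_of_ne (hG.1.1 hyG a) ?_⟩
    intro h
    exact hy ⟨hG.1.1 hyG, h.symm⟩
  haveI := Fintype.ofFinite ι
  have hz : ∀ T : Finset ι, ∃ z ∈ G, ∀ a ∈ T, 0 < ell a z := by
    intro T
    induction T using Finset.induction_on with
    | empty =>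
      obtain ⟨y, hy, _⟩ := hy (Classical.arbitrary ι)
      exact ⟨y, hy, by simp⟩
    | insert a T haT ih =>
      obtain ⟨z, hzG, hz⟩ := ih
      obtain ⟨y, hyG, hya⟩ := hy a
      refine ⟨(1/2 : ℝ) • z + (1/2 : ℝ) • y,
        hG.2 hzG hyG (by norm_num) (by norm_num) (by norm_num), ?_⟩
      intro b hb
      rw [haff b z y _ _ (by norm_num)]
      have h1 := hG.1.1 hzG b
      have h2 := hG.1.1 hyG b
      rcases Finset.mem_insert.1 hb with rfl | hb
      · linarith
      · have := hz b hb
        linarith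
  obtain ⟨z, hzG, hz⟩ := hz Finset.univ
  apply hne
  apply Set.Subset.antisymm hG.1.1
  intro x hx
  have hd : ∃ d : ℝ, 0 < d ∧ ∀ a, 0 ≤ (1 + d) * ell a z - d * ell a x := by
    have h1 : ∀ T : Finset ι, ∃ d : ℝ, 0 < d ∧ ∀ a ∈ T, d * ell a x ≤ ell a z := by
      intro T
      induction T using Finset.induction_on with
      | empty => exact ⟨1, one_pos, by simp⟩
      | insert a T haT ih =>
        obtain ⟨d, hd, hT⟩ := ih
        have hxa := hx a
        have hza := hz a (Finset.mem_univ _)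
        refine ⟨min d (ell a z / (1 + ell a x)), lt_min hd (by positivity), ?_⟩
        intro b hb
        rcases Finset.mem_insert.1 hb with rfl | hb
        · calc _ ≤ (ell b z / (1 + ell b x)) * ell b x := by gcongr; exact min_le_right _ _
            _ ≤ (ell b z / (1 + ell b x)) * (1 + ell b x) := by gcongr; linarith
            _ = ell b z := by field_simp
        · calc _ ≤ d * ell b x := by
                have := hx b
                gcongr; exact min_le_left _ _
            _ ≤ _ := hT b hb
    obtain ⟨d, hd, h⟩ := h1 Finset.univ
    refine ⟨d, hd, fun a => ?_⟩
    have := h a (Finset.mem_univ _)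
    have := hz a (Finset.mem_univ _)
    nlinarith
  obtain ⟨d, hd, hdd⟩ := hd
  have hy : (1 + d) • z + (-d) • x ∈ polyH ell := by
    intro a
    rw [haff a z x _ _ (by ring)]
    linarith [hdd a]
  refine hG.1.2 hx hy hzG ⟨d / (1 + d), 1 / (1 + d), by positivity, by positivity, by field_simp; ring, ?_⟩
  ext i
  simp only [Pi.add_apply, Pi.smul_apply, smul_eq_mul]
  field_simp
  ring

theorem numFacets_polyH {m : ℕ} {ι : Type} [Finite ι] [Nonempty ι]
    (ell : ι → (Fin m → ℝ) → ℝ) (haff : ∀ a, AffOn (ell a))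
    (h0 : ∃ x, ∀ a, 0 < ell a x)
    (hw : ∀ a, ∃ x, ell a x = 0 ∧ ∀ b, b ≠ a → 0 < ell b x) :
    numFacets (polyH ell) = Nat.card ι := by
  obtain ⟨x0, h0⟩ := h0
  have hproper : ∀ a, faceH ell a ≠ polyH ell := by
    intro a h
    have : x0 ∈ faceH ell a := by rw [h]; exact fun b => (h0 b).le
    exact (h0 a).ne' this.2
  have hwm : ∀ a b x, ell a x = 0 → (∀ b, b ≠ a → 0 < ell b x) → x ∈ faceH ell b → b = a := by
    intro a b x hx hxb hb
    by_contra hne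
    exact (hxb b hne).ne' hb.2
  have hwin : ∀ a x, ell a x = 0 → (∀ b, b ≠ a → 0 < ell b x) → x ∈ faceH ell a := by
    intro a x hx hxb
    refine ⟨fun b => ?_, hx⟩
    by_cases h : b = a
    · rw [h, hx]
    · exact (hxb b h).le
  have hset : {F | IsFacet (polyH ell) F} = Set.range (faceH ell) := by
    ext F
    constructor
    · rintro ⟨hF, hne, hmax⟩
      obtain ⟨a, ha⟩ := face_subset_faceH ell haff F hF hne
      exact ⟨a, (hmax _ (faceH_isFace ell haff a) (hproper a) ha).symm⟩
    · rintro ⟨a, rfl⟩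
      refine ⟨faceH_isFace ell haff a, hproper a, ?_⟩
      intro G hG hne hsub
      obtain ⟨b, hb⟩ := face_subset_faceH ell haff G hG hne
      obtain ⟨x, hx, hxb⟩ := hw a
      have := hwm a b x hx hxb (hb (hsub (hwin a x hx hxb)))
      subst this
      exact Set.Subset.antisymm hsub hb
  have hinj : Function.Injective (faceH ell) := by
    intro a b hab
    obtain ⟨x, hx, hxb⟩ := hw a
    exact (hwm a b x hx hxb (hab ▸ hwin a x hx hxb)).symm
  unfold numFacets
  rw [hset, ← Set.image_univ, Set.ncard_image_of_injective _ hinj, Set.ncard_univ]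

/-- facets are preserved by affine bijections. -/
theorem numFacets_image {m : ℕ} (f : (Fin m → ℝ) ≃ (Fin m → ℝ))
    (hf : ∀ x y (a b : ℝ), a + b = 1 → f (a • x + b • y) = a • f x + b • f y)
    (S : Set (Fin m → ℝ)) : numFacets (f '' S) = numFacets S := by
  have hg : ∀ x y (a b : ℝ), a + b = 1 →
      f.symm (a • x + b • y) = a • f.symm x + b • f.symm y := by
    intro x y a b hab
    apply f.injective
    rw [hf _ _ _ _ hab]; simp
  have face : ∀ (f : (Fin m → ℝ) ≃ (Fin m → ℝ)),
      (∀ x y (a b : ℝ), a + b = 1 → f (a • x + b • y) = a • f x + b • f y) →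
      (∀ x y (a b : ℝ), a + b = 1 →
      f.symm (a • x + b • y) = a • f.symm x + b • f.symm y) →
      ∀ S F, IsFaceSet S F → IsFaceSet (f '' S) (f '' F) := by
    intro f hf hg S F hF
    refine ⟨⟨Set.image_mono hF.1.1, ?_⟩, ?_⟩
    · rintro _ ⟨x, hx, rfl⟩ _ ⟨y, hy, rfl⟩ _ ⟨z, hz, rfl⟩ ⟨c, d, hc, hd, hcd, he⟩
      refine ⟨x, hF.1.2 hx hy hz ⟨c, d, hc, hd, hcd, ?_⟩, rfl⟩
      apply f.injective
      rw [hf _ _ _ _ hcd, he]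
    · rintro _ ⟨x, hx, rfl⟩ _ ⟨y, hy, rfl⟩ c d hc hd hcd
      exact ⟨c • x + d • y, hF.2 hx hy hc hd hcd, hf _ _ _ _ hcd⟩
  have facet : ∀ (f : (Fin m → ℝ) ≃ (Fin m → ℝ)),
      (∀ x y (a b : ℝ), a + b = 1 → f (a • x + b • y) = a • f x + b • f y) →
      (∀ x y (a b : ℝ), a + b = 1 →
      f.symm (a • x + b • y) = a • f.symm x + b • f.symm y) →
      ∀ S F, IsFacet S F → IsFacet (f '' S) (f '' F) := by
    intro f hf hg S F ⟨hF, hne, hmax⟩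
    refine ⟨face f hf hg S F hF, fun h => hne (f.injective.image_injective h), ?_⟩
    intro G hG hGne hsub
    have h1 := face f.symm hg (by simpa using hf) _ _ hG
    rw [Equiv.symm_image_image] at h1
    have h2 := hmax _ h1 (by
      intro h; apply hGne; rw [← h]; simp) (by
      intro x hx; exact ⟨f x, hsub ⟨x, hx, rfl⟩, by simp⟩)
    rw [h2]; simp
  unfold numFacets
  rw [← Set.ncard_image_of_injective {F | IsFacet S F} f.injective.image_injective]
  congr 1
  ext F
  constructor
  · intro hF
    refine ⟨f.symm '' F, ?_, by simp⟩
    have := facet f.symm hg (by simpa using hf) _ _ hF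
    rwa [Equiv.symm_image_image] at this
  · rintro ⟨G, hG, rfl⟩
    exact facet f hf hg S G hG


/-! ### Reduced words and crossings -/

def pos (w : List ℕ) (j x : ℕ) : ℕ := (wordProd (w.take j)).symm x

theorem wordProd_append (u v : List ℕ) : wordProd (u ++ v) = wordProd u * wordProd v := by
  simp [wordProd]

theorem wordProd_singleton (a : ℕ) : wordProd [a] = sTrans a := by
  simp [wordProd]

theorem take_succ_letter (w : List ℕ) (j : ℕ) (hj : j < w.length) :
    w.take (j + 1) = w.take j ++ [letterAt w (j + 1)] := by
  rw [List.take_add_one, List.getElem?_eq_getElem hj]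
  simp [letterAt, List.getD_eq_getElem?_getD, List.getElem?_eq_getElem hj]

theorem pos_zero (w : List ℕ) (x : ℕ) : pos w 0 x = x := by
  simp [pos, wordProd]
  rfl

theorem pos_succ (w : List ℕ) (j x : ℕ) (hj : j < w.length) :
    pos w (j + 1) x =
      Equiv.swap (letterAt w (j + 1)) (letterAt w (j + 1) + 1) (pos w j x) := by
  unfold pos
  rw [take_succ_letter w j hj, wordProd_append, wordProd_singleton, sTrans]
  rw [Equiv.Perm.mul_def, Equiv.symm_trans_apply]
  simp

theorem pos_inj (w : List ℕ) (j : ℕ) {x y : ℕ} (h : pos w j x = pos w j y) : x = y :=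
  (wordProd (w.take j)).symm.injective h

theorem wireX_iff (w : List ℕ) (j r : ℕ) :
    wireX w (j + 1) = r ↔ pos w j r = letterAt w (j + 1) := by
  unfold wireX stateAbove pos
  rw [Equiv.symm_apply_eq, eq_comm]; simp

theorem wireY_iff (w : List ℕ) (j r : ℕ) :
    wireY w (j + 1) = r ↔ pos w j r = letterAt w (j + 1) + 1 := by
  unfold wireY stateAbove pos
  rw [Equiv.symm_apply_eq, eq_comm]; simp

theorem longestPerm_apply (n k : ℕ) :
    longestPerm n k = if 1 ≤ k ∧ k ≤ n + 1 then n + 2 - k else k := rfl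

theorem pos_len {n : ℕ} {w : List ℕ} (hw : IsReduced n w) (x : ℕ) :
    pos w w.length x = longestPerm n x := by
  unfold pos
  rw [List.take_length, hw.2.2, Equiv.symm_apply_eq]
  simp only [longestPerm_apply]
  split_ifs <;> omega

/-- adjacent swap changes the order of two positions only if they are adjacent there. -/
theorem swap_lt_iff (c p q : ℕ) (hpq : p ≠ q) (h : ¬ (p = c ∧ q = c + 1)) (h' : ¬ (q = c ∧ p = c + 1)) :
    (Equiv.swap c (c + 1) p < Equiv.swap c (c + 1) q ↔ p < q) := by
  simp only [Equiv.swap_apply_def]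
  split_ifs <;> omega

theorem cross_exists {n : ℕ} {w : List ℕ} (hw : IsReduced n w) {r s : ℕ} (hr : 1 ≤ r) (hrs : r < s)
    (hs : s ≤ n + 1) : ∃ j < w.length, wireX w (j + 1) = r ∧ wireY w (j + 1) = s := by
  by_contra hcon
  push Not at hcon
  have key : ∀ j ≤ w.length, pos w j r < pos w j s := by
    intro j
    induction j with
    | zero => intro _; simpa [pos_zero] using hrs
    | succ j ih =>
      intro hj
      have h1 := ih (by omega)
      rw [pos_succ w j r (by omega), pos_succ w j s (by omega)]
      rw [swap_lt_iff]
      · exact h1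
      · omega
      · rintro ⟨ha, hb⟩
        exact hcon j (by omega) ((wireX_iff w j r).2 ha) ((wireY_iff w j s).2 hb)
      · omega
  have h := key w.length le_rfl
  rw [pos_len hw, pos_len hw] at h
  simp only [longestPerm_apply] at h
  split_ifs at h <;> omega

def pairSet (n : ℕ) : Finset (ℕ × ℕ) :=
  ((Finset.range (n + 1)).sigma (fun s => Finset.range s)).image (fun p => (p.2 + 1, p.1 + 1))

theorem mem_pairSet {n r s : ℕ} : (r, s) ∈ pairSet n ↔ 1 ≤ r ∧ r < s ∧ s ≤ n + 1 := by
  simp only [pairSet, Finset.mem_image, Finset.mem_sigma, Finset.mem_range, Prod.mk.injEq,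
    Sigma.exists]
  constructor
  · rintro ⟨a, b, h1, h2, h3⟩; omega
  · intro h; exact ⟨s - 1, r - 1, by omega, by omega, by omega⟩

theorem card_pairSet (n : ℕ) : (pairSet n).card = Dim n := by
  unfold pairSet
  rw [Finset.card_image_of_injective, Finset.card_sigma]
  · simp only [Finset.card_range]
    rw [Finset.sum_range_id, Dim, Nat.add_sub_cancel, Nat.mul_comm]
  · rintro ⟨a, b⟩ ⟨c, d⟩ h
    simp only [Prod.mk.injEq] at h
    obtain ⟨h1, h2⟩ := h
    obtain rfl : a = c := by omega
    obtain rfl : b = d := by omega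
    rfl

theorem cross_bij {n : ℕ} {w : List ℕ} (hw : IsReduced n w) :
    (∀ j < w.length, 1 ≤ wireX w (j + 1) ∧ wireX w (j + 1) < wireY w (j + 1) ∧
      wireY w (j + 1) ≤ n + 1) ∧
    (∀ j < w.length, ∀ k < w.length, wireX w (j + 1) = wireX w (k + 1) →
      wireY w (j + 1) = wireY w (k + 1) → j = k) := by
  have hlen : w.length = Dim n := hw.1
  let f : ℕ → ℕ × ℕ := fun j => (wireX w (j + 1), wireY w (j + 1))
  have hsub : pairSet n ⊆ (Finset.range w.length).image f := by
    rintro ⟨r, s⟩ h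
    rw [mem_pairSet] at h
    obtain ⟨j, hj, h1, h2⟩ := cross_exists hw h.1 h.2.1 h.2.2
    exact Finset.mem_image.2 ⟨j, Finset.mem_range.2 hj, by simp [f, h1, h2]⟩
  have hcard : ((Finset.range w.length).image f).card ≤ (pairSet n).card := by
    refine Finset.card_image_le.trans ?_
    rw [card_pairSet, Finset.card_range, hlen]
  have heq := Finset.eq_of_subset_of_card_le hsub hcard
  have hinj : Set.InjOn f (Finset.range w.length : Set ℕ) := by
    rw [← Finset.card_image_iff, ← heq, card_pairSet, Finset.card_range, hlen]
  constructor
  · intro j hj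
    have : f j ∈ pairSet n := by
      rw [heq]; exact Finset.mem_image_of_mem _ (Finset.mem_range.2 hj)
    exact mem_pairSet.1 this
  · intro j hj k hk h1 h2
    exact hinj (by simpa using hj) (by simpa using hk) (by simp [f, h1, h2])

/-- the node where wires `r`, `s` cross. -/
def nu (w : List ℕ) (r s : ℕ) : ℕ :=
  sInf {j | ValidNode w j ∧ NodeOnWire w j r ∧ NodeOnWire w j s}

theorem nu_symm (w : List ℕ) (r s : ℕ) : nu w r s = nu w s r := by
  unfold nu; congr 1; ext j; simp only [Set.mem_setOf_eq]; tauto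

theorem nu_eq {n : ℕ} {w : List ℕ} (hw : IsReduced n w) {j r s : ℕ} (hj : ValidNode w j)
    (hX : wireX w j = r) (hY : wireY w j = s) : nu w r s = j := by
  obtain ⟨h1, h2⟩ := cross_bij hw
  have hset : {j | ValidNode w j ∧ NodeOnWire w j r ∧ NodeOnWire w j s} = {j} := by
    ext k
    simp only [Set.mem_setOf_eq, Set.mem_singleton_iff]
    constructor
    · rintro ⟨hk, hkr, hks⟩
      obtain ⟨hk1, hk2⟩ := hk
      obtain ⟨hj1, hj2⟩ := hj
      obtain ⟨j, rfl⟩ := Nat.exists_eq_add_of_le' hj1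
      obtain ⟨k, rfl⟩ := Nat.exists_eq_add_of_le' hk1
      have a1 := h1 j (by omega)
      have a2 := h1 k (by omega)
      have a3 := h2 j (by omega) k (by omega)
      unfold NodeOnWire at hkr hks
      have : j = k := by
        apply a3
        · omega
        · omega
      omega
    · rintro rfl
      exact ⟨hj, Or.inl hX, Or.inr hY⟩
  unfold nu
  rw [hset]; simp

theorem nu_spec {n : ℕ} {w : List ℕ} (hw : IsReduced n w) {r s : ℕ} (hr : 1 ≤ r) (hrs : r < s)
    (hs : s ≤ n + 1) : ValidNode w (nu w r s) ∧ wireX w (nu w r s) = r ∧ wireY w (nu w r s) = s := by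
  obtain ⟨j, hj, h1, h2⟩ := cross_exists hw hr hrs hs
  have hv : ValidNode w (j + 1) := ⟨by omega, by omega⟩
  rw [nu_eq hw hv h1 h2]
  exact ⟨hv, h1, h2⟩

structure Arr (n : ℕ) (ν : ℕ → ℕ → ℕ) : Prop where
  symm : ∀ r s, ν r s = ν s r
  rng : ∀ r s, 1 ≤ r → r < s → s ≤ n + 1 → 1 ≤ ν r s ∧ ν r s ≤ Dim n
  inj : ∀ r s r' s', 1 ≤ r → r < s → s ≤ n + 1 → 1 ≤ r' → r' < s' → s' ≤ n + 1 →
    ν r s = ν r' s' → r = r' ∧ s = s'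
  betw : ∀ r q s, 1 ≤ r → r < q → q < s → s ≤ n + 1 →
    (ν r q < ν r s ∧ ν r s < ν q s) ∨ (ν q s < ν r s ∧ ν r s < ν r q)
  surj : ∀ j, 1 ≤ j → j ≤ Dim n → ∃ r s, 1 ≤ r ∧ r < s ∧ s ≤ n + 1 ∧ ν r s = j

theorem node_pair {n : ℕ} {w : List ℕ} (hw : IsReduced n w) {j : ℕ} (hj : ValidNode w j) :
    1 ≤ wireX w j ∧ wireX w j < wireY w j ∧ wireY w j ≤ n + 1 ∧
      nu w (wireX w j) (wireY w j) = j := by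
  obtain ⟨hj1, hj2⟩ := hj
  have h := (cross_bij hw).1 (j - 1) (by omega)
  rw [Nat.sub_add_cancel hj1] at h
  exact ⟨h.1, h.2.1, h.2.2, nu_eq hw ⟨hj1, hj2⟩ rfl rfl⟩

theorem pos_lt_iff {n : ℕ} {w : List ℕ} (hw : IsReduced n w) {r s : ℕ} (hr : 1 ≤ r) (hrs : r < s)
    (hs : s ≤ n + 1) (j : ℕ) (hj : j ≤ w.length) : pos w j r < pos w j s ↔ j < nu w r s := by
  obtain ⟨hv, hX, hY⟩ := nu_spec hw hr hrs hs
  induction j with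
  | zero =>
    rw [pos_zero, pos_zero]
    exact ⟨fun _ => hv.1, fun _ => hrs⟩
  | succ j ih =>
    have ih := ih (by omega)
    have hjv : ValidNode w (j + 1) := ⟨by omega, hj⟩
    have hne : pos w j r ≠ pos w j s := fun h => by have := pos_inj w j h; omega
    rw [pos_succ w j r (by omega), pos_succ w j s (by omega)]
    by_cases hc : pos w j r = letterAt w (j + 1) ∧ pos w j s = letterAt w (j + 1) + 1
    · have h1 := nu_eq hw hjv ((wireX_iff w j r).2 hc.1) ((wireY_iff w j s).2 hc.2)
      rw [hc.1, hc.2, h1]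
      simp
    · have hc' : ¬ (pos w j s = letterAt w (j + 1) ∧ pos w j r = letterAt w (j + 1) + 1) := by
        rintro ⟨ha, hb⟩
        have h1 := (wireX_iff w j s).2 ha
        have h2 := (wireY_iff w j r).2 hb
        have := node_pair hw hjv
        omega
      rw [swap_lt_iff _ _ _ hne hc hc', ih]
      constructor
      · intro h
        rcases Nat.lt_or_ge (j + 1) (nu w r s) with h' | h'
        · exact h'
        · exfalso
          have h2 : nu w r s = j + 1 := by omega
          rw [h2] at hX hY
          exact hc ⟨(wireX_iff w j r).1 hX, (wireY_iff w j s).1 hY⟩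
      · omega

theorem arr_nu {n : ℕ} {w : List ℕ} (hw : IsReduced n w) : Arr n (nu w) := by
  have hlen : w.length = Dim n := hw.1
  have hinj : ∀ r s r' s', 1 ≤ r → r < s → s ≤ n + 1 → 1 ≤ r' → r' < s' → s' ≤ n + 1 →
    nu w r s = nu w r' s' → r = r' ∧ s = s' := by
    intro r s r' s' h1 h2 h3 h4 h5 h6 h
    have a := nu_spec hw h1 h2 h3
    have b := nu_spec hw h4 h5 h6
    rw [h] at a
    exact ⟨a.2.1.symm.trans b.2.1, a.2.2.symm.trans b.2.2⟩
  refine ⟨nu_symm w, ?_, hinj, ?_, ?_⟩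
  · intro r s h1 h2 h3
    have := (nu_spec hw h1 h2 h3).1
    exact ⟨this.1, hlen ▸ this.2⟩
  · intro r q s h1 h2 h3 h4
    obtain ⟨hv, hX, hY⟩ := nu_spec hw h1 (h2.trans h3) h4
    have hv1 := hv.1
    have hv2 := hv.2
    have hm : nu w r s - 1 + 1 = nu w r s := by omega
    have hjl : nu w r s - 1 ≤ w.length := by omega
    have e1 := (wireX_iff w (nu w r s - 1) r).1 (by rw [hm]; exact hX)
    have e2 := (wireY_iff w (nu w r s - 1) s).1 (by rw [hm]; exact hY)
    have p1 := pos_lt_iff hw h1 h2 (by omega) (nu w r s - 1) hjl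
    have p2 := pos_lt_iff hw (by omega : 1 ≤ q) h3 h4 (nu w r s - 1) hjl
    have n1 : pos w (nu w r s - 1) q ≠ pos w (nu w r s - 1) r :=
      fun h => by have := pos_inj w _ h; omega
    have n2 : pos w (nu w r s - 1) q ≠ pos w (nu w r s - 1) s :=
      fun h => by have := pos_inj w _ h; omega
    have d1 : nu w r q ≠ nu w r s := fun h => by
      have := hinj r q r s h1 h2 (by omega) h1 (by omega) h4 h; omega
    have d2 : nu w q s ≠ nu w r s := fun h => by
      have := hinj q s r s (by omega) h3 h4 h1 (by omega) h4 h; omega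
    omega
  · intro j h1 h2
    have := node_pair hw (j := j) ⟨h1, hlen ▸ h2⟩
    exact ⟨_, _, this.1, this.2.1, this.2.2.1, this.2.2.2⟩


/-! ### Wire-paths -/

def Forb (k r x : ℕ) : Prop := (r ≤ k ∧ x ≤ k ∧ r < x) ∨ (k < r ∧ k < x ∧ x < r)

/-- `a` is strictly before `b` along wire `r` in type `k`. -/
def Bef (k r a b : ℕ) : Prop := if r ≤ k then b < a else a < b

def WT (n : ℕ) (ν : ℕ → ℕ → ℕ) (k : ℕ) : ℕ → ℕ → List ℕ → Prop
  | _, r, [] => r = k + 1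
  | p, r, q :: l => 1 ≤ q ∧ q ≤ n + 1 ∧ q ≠ r ∧ Bef k r (ν p r) (ν r q) ∧
      (∀ x, 1 ≤ x → x ≤ n + 1 → x ≠ r → Bef k r (ν p r) (ν r x) → Bef k r (ν r x) (ν r q) →
        ¬ Forb k r x) ∧ WT n ν k r q l

def WP (n : ℕ) (ν : ℕ → ℕ → ℕ) (k : ℕ) : List ℕ → Prop
  | [] => False
  | s :: l => 1 ≤ k ∧ k ≤ n ∧ 1 ≤ s ∧ s ≤ n + 1 ∧ s ≠ k ∧ WT n ν k k s l

def wsum (τ : ℕ → ℕ → ℝ) : ℕ → List ℕ → ℝ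
  | _, [] => 0
  | r, q :: l => (if r < q then τ r q else -τ q r) + wsum τ q l

theorem Arr.inj' {n : ℕ} {ν : ℕ → ℕ → ℕ} (hA : Arr n ν) {r x y : ℕ} (hr : 1 ≤ r) (hr' : r ≤ n + 1)
    (hx : 1 ≤ x) (hx' : x ≤ n + 1) (hy : 1 ≤ y) (hy' : y ≤ n + 1) (hxr : x ≠ r) (hyr : y ≠ r)
    (h : ν r x = ν r y) : x = y := by
  rcases Nat.lt_or_ge r x with h1 | h1
  · rcases Nat.lt_or_ge r y with h2 | h2
    · exact (hA.inj r x r y hr h1 hx' hr h2 hy' h).2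
    · rw [hA.symm r y] at h
      have := hA.inj r x y r hr h1 hx' hy (by omega) hr' h; omega
  · rcases Nat.lt_or_ge r y with h2 | h2
    · rw [hA.symm r x] at h
      have := hA.inj x r r y hx (by omega) hr' hr h2 hy' h; omega
    · rw [hA.symm r x, hA.symm r y] at h
      exact (hA.inj x r y r hx (by omega) hr' hy (by omega) hr' h).1

theorem Arr.rng' {n : ℕ} {ν : ℕ → ℕ → ℕ} (hA : Arr n ν) {r x : ℕ} (hr : 1 ≤ r) (hr' : r ≤ n + 1)
    (hx : 1 ≤ x) (hx' : x ≤ n + 1) (hxr : x ≠ r) : 1 ≤ ν r x ∧ ν r x ≤ Dim n := by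
  rcases Nat.lt_or_ge r x with h1 | h1
  · exact hA.rng r x hr h1 hx'
  · rw [hA.symm r x]; exact hA.rng x r hx (by omega) hr'

theorem Arr.pair_eq {n : ℕ} {ν : ℕ → ℕ → ℕ} (hA : Arr n ν) {r x s y : ℕ} (hr : 1 ≤ r)
    (hr' : r ≤ n + 1)
    (hx : 1 ≤ x) (hx' : x ≤ n + 1) (hxr : x ≠ r) (hs : 1 ≤ s) (hs' : s ≤ n + 1)
    (hy : 1 ≤ y) (hy' : y ≤ n + 1) (hys : y ≠ s) (h : ν r x = ν s y) :
    (r = s ∧ x = y) ∨ (r = y ∧ x = s) := by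
  rcases Nat.lt_or_ge r x with h1 | h1 <;> rcases Nat.lt_or_ge s y with h2 | h2
  · have := hA.inj r x s y hr h1 hx' hs h2 hy' h; omega
  · rw [hA.symm s y] at h
    have := hA.inj r x y s hr h1 hx' hy (by omega) hs' h; omega
  · rw [hA.symm r x] at h
    have := hA.inj x r s y hx (by omega) hr' hs h2 hy' h; omega
  · rw [hA.symm r x, hA.symm s y] at h
    have := hA.inj x r y s hx (by omega) hr' hy (by omega) hs' h; omega

/-- a potential increasing along all oriented wires of type `k`. -/
def IsPot (n : ℕ) (ν : ℕ → ℕ → ℕ) (k : ℕ) (h : ℕ → ℕ) : Prop :=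
  ∀ r x y, 1 ≤ r → r ≤ n + 1 → 1 ≤ x → x ≤ n + 1 → x ≠ r → 1 ≤ y → y ≤ n + 1 → y ≠ r →
    Bef k r (ν r x) (ν r y) → h (ν r x) < h (ν r y)

theorem side_consistent {n : ℕ} {ν : ℕ → ℕ → ℕ} (hA : Arr n ν) {k r s : ℕ} (hk : 1 ≤ k)
    (hk' : k ≤ n + 1) (hr : 1 ≤ r) (hr' : r ≤ n + 1) (hs : 1 ≤ s) (hs' : s ≤ n + 1)
    (hrs : r ≠ s) (hrk : r ≠ k) (hsk : s ≠ k) :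
    Bef k r (ν r k) (ν r s) ↔ Bef k s (ν s k) (ν r s) := by
  have aux : ∀ r s : ℕ, 1 ≤ r → r ≤ n + 1 → 1 ≤ s → s ≤ n + 1 → r < s → r ≠ k → s ≠ k →
      (Bef k r (ν r k) (ν r s) ↔ Bef k s (ν s k) (ν r s)) := by
    intro r s hr hr' hs hs' hrs hrk hsk
    unfold Bef
    have e1 := hA.symm r k
    have e2 := hA.symm s k
    rcases Nat.lt_or_ge s k with h1 | h1
    · have := hA.betw r s k hr hrs h1 hk'
      rw [if_pos (by omega), if_pos (by omega)]; omega
    · rcases Nat.lt_or_ge r k with h2 | h2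
      · have := hA.betw r k s hr h2 (by omega) hs'
        rw [if_pos (by omega), if_neg (by omega)]; omega
      · have := hA.betw k r s hk (by omega) hrs hs'
        rw [if_neg (by omega), if_neg (by omega)]; omega
  rcases Nat.lt_or_ge r s with h | h
  · exact aux r s hr hr' hs hs' h hrk hsk
  · rw [hA.symm r s]
    exact (aux s r hs hs' hr hr' (by omega) hsk hrk).symm

theorem exists_pot {n : ℕ} {ν : ℕ → ℕ → ℕ} (hA : Arr n ν) (k : ℕ) (hk : k ≤ n + 1) :
    ∃ h M, IsPot n ν k h ∧ ∀ j, j ≤ Dim n → h j < M := by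
  induction hk using Nat.decreasingInduction with
  | self =>
    refine ⟨fun j => Dim n - j, Dim n + 1, ?_, ?_⟩
    · intro r x y hr hr' hx hx' hxr hy hy' hyr hb
      unfold Bef at hb
      rw [if_pos hr'] at hb
      have := hA.rng' hr hr' hx hx' hxr
      dsimp only; omega
    · intro j _; dsimp only; omega
  | of_succ k hk ih =>
    obtain ⟨h, M, hp, hM⟩ := ih
    set K := k + 1 with hK
    have hK1 : 1 ≤ K := by omega
    let on : ℕ → Prop := fun j => ∃ x, 1 ≤ x ∧ x ≤ n + 1 ∧ x ≠ K ∧ j = ν K x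
    let aft : ℕ → Prop := fun j => ∃ r x, 1 ≤ r ∧ r ≤ n + 1 ∧ 1 ≤ x ∧ x ≤ n + 1 ∧ r ≠ x ∧ r ≠ K ∧
      x ≠ K ∧ j = ν r x ∧ Bef K r (ν r K) j
    have haft : ∀ r x, 1 ≤ r → r ≤ n + 1 → 1 ≤ x → x ≤ n + 1 → r ≠ x → r ≠ K →
      x ≠ K → (aft (ν r x) ↔ Bef K r (ν r K) (ν r x)) := by
      intro r x hr hr' hx hx' hrx hrK hxK
      constructor
      · rintro ⟨s, y, hs, hs', hy, hy', hsy, hsK, hyK, he, hb⟩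
        rcases hA.pair_eq hr hr' hx hx' (Ne.symm hrx) hs hs' hy hy' (Ne.symm hsy) he with ⟨h1, h2⟩ | ⟨h1, h2⟩
        · rw [h1] at hb ⊢; exact hb
        · rw [side_consistent hA hK1 (by omega) hr hr' hx hx' hrx hrK hxK, h2]
          rw [h2] at hb; exact hb
      · intro hb; exact ⟨r, x, hr, hr', hx, hx', hrx, hrK, hxK, rfl, hb⟩
    have hon : ∀ r x, 1 ≤ r → r ≤ n + 1 → 1 ≤ x → x ≤ n + 1 → r ≠ x → r ≠ K →
      (on (ν r x) ↔ x = K) := by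
      intro r x hr hr' hx hx' hrx hrK
      constructor
      · rintro ⟨y, hy, hy', hyK, he⟩
        rcases hA.pair_eq hr hr' hx hx' (Ne.symm hrx) hK1 (by omega) hy hy' hyK he with h1 | h1 <;> omega
      · rintro rfl; exact ⟨r, hr, hr', hrK, hA.symm _ _⟩
    refine ⟨fun j => if on j then M + j else if aft j then M + Dim n + 1 + h j else h j,
      2 * M + Dim n + 1, ?_, ?_⟩
    · intro r x y hr hr' hx hx' hxr hy hy' hyr hb
      have hMx := hM _ (hA.rng' hr hr' hx hx' hxr).2
      have hMy := hM _ (hA.rng' hr hr' hy hy' hyr).2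
      dsimp only
      by_cases hrK : r = K
      · subst hrK
        rw [if_pos ⟨x, hx, hx', hxr, rfl⟩, if_pos ⟨y, hy, hy', hyr, rfl⟩]
        unfold Bef at hb
        rw [if_neg (by omega)] at hb; omega
      · have hb' : Bef K r (ν r x) (ν r y) := by
          unfold Bef at hb ⊢
          by_cases hrk : r ≤ k
          · rw [if_pos hrk] at hb; rw [if_pos (by omega)]; exact hb
          · rw [if_neg hrk] at hb; rw [if_neg (by omega)]; exact hb
        have hlt := hp r x y hr hr' hx hx' hxr hy hy' hyr hb'
        have r1 := (hA.rng' hr hr' hx hx' hxr)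
        have r2 := (hA.rng' hr hr' hy hy' hyr)
        by_cases hxK : x = K
        · rw [if_pos ((hon r x hr hr' hx hx' (Ne.symm hxr) hrK).2 hxK)]
          rw [if_neg (fun h => by
            have := (hon r y hr hr' hy hy' (Ne.symm hyr) hrK).1 h
            rw [hxK, this] at hlt; omega)]
          rw [if_pos]
          · omega
          · by_cases hyK : y = K
            · rw [hxK, hyK] at hlt; omega
            rw [haft r y hr hr' hy hy' (Ne.symm hyr) hrK hyK]; rw [hxK] at hb'; exact hb'
        · rw [if_neg (fun h => hxK ((hon r x hr hr' hx hx' (Ne.symm hxr) hrK).1 h))]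
          rw [haft r x hr hr' hx hx' (Ne.symm hxr) hrK hxK]
          by_cases hyK : y = K
          · rw [if_pos ((hon r y hr hr' hy hy' (Ne.symm hyr) hrK).2 hyK)]
            rw [if_neg]
            · omega
            · rw [hyK] at hb'
              unfold Bef at hb' ⊢
              split_ifs at hb' ⊢ <;> omega
          · rw [if_neg (fun h => hyK ((hon r y hr hr' hy hy' (Ne.symm hyr) hrK).1 h))]
            rw [haft r y hr hr' hy hy' (Ne.symm hyr) hrK hyK]
            by_cases hc : Bef K r (ν r K) (ν r x)
            · rw [if_pos hc, if_pos]
              · omega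
              · unfold Bef at hb' hc ⊢
                split_ifs at hb' hc ⊢ <;> omega
            · rw [if_neg hc]
              split_ifs <;> omega
    · intro j hj
      have := hM j hj
      dsimp only
      split_ifs <;> omega


/-! ### Rigorous paths as wire-paths -/

theorem other_spec {n : ℕ} {w : List ℕ} (hw : IsReduced n w) {j r : ℕ} (hj : ValidNode w j)
    (hr : NodeOnWire w j r) : 1 ≤ otherWire w j r ∧ otherWire w j r ≤ n + 1 ∧ otherWire w j r ≠ r ∧
      nu w r (otherWire w j r) = j ∧ 1 ≤ r ∧ r ≤ n + 1 := by
  obtain ⟨h1, h2, h3, h4⟩ := node_pair hw hj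
  unfold otherWire
  split_ifs with h
  · rw [← h]
    exact ⟨by omega, by omega, by omega, h4, by omega, by omega⟩
  · have h' : wireY w j = r := by
      rcases hr with h5 | h5
      · exact absurd h5 h
      · exact h5
    rw [nu_symm, ← h']
    exact ⟨by omega, by omega, by omega, h4, by omega, by omega⟩

theorem nu_node {n : ℕ} {w : List ℕ} (hw : IsReduced n w) {r x : ℕ} (hr : 1 ≤ r) (hr' : r ≤ n + 1)
    (hx : 1 ≤ x) (hx' : x ≤ n + 1) (hxr : x ≠ r) :
    ValidNode w (nu w r x) ∧ NodeOnWire w (nu w r x) r ∧ otherWire w (nu w r x) r = x := by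
  unfold otherWire NodeOnWire
  rcases Nat.lt_or_ge r x with h | h
  · obtain ⟨h1, h2, h3⟩ := nu_spec hw hr h hx'
    exact ⟨h1, Or.inl h2, by rw [if_pos h2]; exact h3⟩
  · obtain ⟨h1, h2, h3⟩ := nu_spec hw hx (lt_of_le_of_ne h hxr) hr'
    rw [nu_symm w r x]
    exact ⟨h1, Or.inr h3, by rw [if_neg (by rw [h2]; exact hxr)]; exact h2⟩

theorem mem_nodesOn {w : List ℕ} {r j : ℕ} : j ∈ nodesOn w r ↔ ValidNode w j ∧ NodeOnWire w j r := by
  unfold nodesOn ValidNode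
  simp only [List.mem_filter, List.mem_map, List.mem_range, decide_eq_true_eq]
  constructor
  · rintro ⟨⟨a, h1, h2⟩, h3⟩; exact ⟨by omega, h3⟩
  · rintro ⟨h1, h3⟩; exact ⟨⟨j - 1, by omega, by omega⟩, h3⟩

theorem nodup_nodesOn (w : List ℕ) (r : ℕ) : (nodesOn w r).Nodup := by
  unfold nodesOn
  apply List.Nodup.filter
  exact List.Nodup.map (fun a b h => by simpa using h) List.nodup_range

theorem mem_segList {w : List ℕ} {r a b j : ℕ} :
    j ∈ segList w r a b ↔ (ValidNode w j ∧ NodeOnWire w j r) ∧ min a b < j ∧ j < max a b := by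
  unfold segList
  simp [List.mem_filter, mem_nodesOn]

theorem mem_tailList {w : List ℕ} {r a j : ℕ} :
    j ∈ tailList w r a ↔ (ValidNode w j ∧ NodeOnWire w j r) ∧ a < j := by
  unfold tailList
  simp [List.mem_filter, mem_nodesOn]

def ssum (n : ℕ) (w : List ℕ) (t : Fin (Dim n) → ℝ) : ℕ → List ℕ → ℝ
  | _, [] => 0
  | r, m :: ms => (if r < otherWire w m r then entry n t (m - 1) else - entry n t (m - 1)) +
      ssum n w t (otherWire w m r) ms

theorem sum_entry (n : ℕ) (t : Fin (Dim n) → ℝ) (m : ℕ) (hm : 1 ≤ m) (c : ℝ) :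
    ∑ j : Fin (Dim n), (if m = (j : ℕ) + 1 then c else 0) * t j = c * entry n t (m - 1) := by
  unfold entry
  split_ifs with h
  · rw [Finset.sum_eq_single ⟨m - 1, h⟩]
    · rw [if_pos]; dsimp only; omega
    · intro b _ hb
      rw [if_neg, zero_mul]
      intro h2; apply hb; ext; dsimp only; omega
    · simp
  · rw [mul_zero]
    apply Finset.sum_eq_zero
    intro j _
    rw [if_neg, zero_mul]
    have := j.2; omega

theorem ssum_eq (n : ℕ) (w : List ℕ) (t : Fin (Dim n) → ℝ) (ms : List ℕ) (hms : ∀ m ∈ ms, 1 ≤ m)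
    (r : ℕ) : stringIneq n w (r, ms) t = ssum n w t r ms := by
  induction ms generalizing r with
  | nil => simp [stringIneq, normalVec, coeff, pathSwitches, ssum]
  | cons m ms ih =>
    have ih' := ih (fun m' h => hms m' (List.mem_cons_of_mem _ h)) (otherWire w m r)
    unfold stringIneq normalVec coeff at ih' ⊢
    simp only [pathSwitches, List.map_cons, List.sum_cons, add_mul, Finset.sum_add_distrib, ssum]
    dsimp only at ih'
    rw [ih', sum_entry n t m (hms m (by simp))]
    split_ifs <;> ring

def tauOf (n : ℕ) (w : List ℕ) (t : Fin (Dim n) → ℝ) (r s : ℕ) : ℝ := entry n t (nu w r s - 1)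

theorem forb_iff {w : List ℕ} {k j r : ℕ} : Forbidden w k j r ↔ Forb k r (otherWire w j r) := by
  unfold Forbidden Forb; tauto

theorem seg_iff {n : ℕ} {w : List ℕ} (hw : IsReduced n w) {k r a b : ℕ} (hr : 1 ≤ r)
    (hr' : r ≤ n + 1)
    (hab : Bef k r a b) : (∀ j ∈ segList w r a b, ¬ Forbidden w k j r) ↔
      (∀ x, 1 ≤ x → x ≤ n + 1 → x ≠ r → Bef k r a (nu w r x) → Bef k r (nu w r x) b →
        ¬ Forb k r x) := by
  constructor
  · intro h x hx hx' hxr h1 h2 hf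
    obtain ⟨a1, a2, a3⟩ := nu_node hw hr hr' hx hx' hxr
    refine h (nu w r x) (mem_segList.2 ⟨⟨a1, a2⟩, ?_⟩) (forb_iff.2 (by rw [a3]; exact hf))
    unfold Bef at hab h1 h2
    split_ifs at hab h1 h2 <;> omega
  · intro h j hj hf
    obtain ⟨⟨h1, h2⟩, h3⟩ := mem_segList.1 hj
    obtain ⟨b1, b2, b3, b4, -⟩ := other_spec hw h1 h2
    refine h _ b1 b2 b3 ?_ ?_ (forb_iff.1 hf)
    · rw [b4]; unfold Bef at hab ⊢; split_ifs at hab ⊢ <;> omega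
    · rw [b4]; unfold Bef at hab ⊢; split_ifs at hab ⊢ <;> omega

theorem travel_to_wt {n : ℕ} {w : List ℕ} (hw : IsReduced n w) (t : Fin (Dim n) → ℝ) (k : ℕ)
    (ms : List ℕ) : ∀ p r, 1 ≤ r → r ≤ n + 1 → TravelOK w k r (nu w p r) ms →
      (∀ m ∈ ms, 1 ≤ m) ∧
      ∃ l, WT n (nu w) k p r l ∧ wsum (tauOf n w t) r l = ssum n w t r ms := by
  induction ms with
  | nil =>
    intro p r hr hr' h
    exact ⟨by simp, [], h.1, rfl⟩
  | cons m ms ih =>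
    intro p r hr hr' h
    obtain ⟨h1, h2, h3, h4, h5⟩ := h
    obtain ⟨b1, b2, b3, b4, -⟩ := other_spec hw h1 h2
    set q := otherWire w m r with hq
    obtain ⟨i1, l, i2, i3⟩ := ih r q b1 b2 (by rw [b4]; exact h5)
    have hb : Bef k r (nu w p r) m := h3
    refine ⟨?_, q :: l, ⟨b1, b2, b3, by rw [b4]; exact hb, ?_, i2⟩, ?_⟩
    · intro m' hm'
      rcases List.mem_cons.1 hm' with rfl | h6
      · exact h1.1
      · exact i1 m' h6
    · rw [b4]
      exact (seg_iff hw hr hr' hb).1 h4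
    · simp only [wsum, ssum, ← hq, i3, tauOf]
      rw [nu_symm w q r, b4]

theorem wt_to_travel {n : ℕ} {w : List ℕ} (hw : IsReduced n w) (t : Fin (Dim n) → ℝ) (k : ℕ)
    (l : List ℕ) : ∀ p r, 1 ≤ r → r ≤ n + 1 → WT n (nu w) k p r l →
      ∃ ms, (∀ m ∈ ms, 1 ≤ m) ∧ TravelOK w k r (nu w p r) ms ∧
        wsum (tauOf n w t) r l = ssum n w t r ms := by
  induction l with
  | nil =>
    intro p r hr hr' h
    refine ⟨[], by simp, ⟨h, ?_⟩, rfl⟩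
    intro j _ hf
    have h' : r = k + 1 := h
    rw [forb_iff] at hf
    unfold Forb at hf; omega
  | cons q l ih =>
    intro p r hr hr' h
    obtain ⟨h1, h2, h3, h4, h5, h6⟩ := h
    obtain ⟨b1, b2, b3⟩ := nu_node hw hr hr' h1 h2 h3
    obtain ⟨ms, i1, i2, i3⟩ := ih r q h1 h2 h6
    refine ⟨nu w r q :: ms, ?_, ⟨b1, b2, h4, (seg_iff hw hr hr' h4).2 h5, ?_⟩, ?_⟩
    · intro m' hm'
      rcases List.mem_cons.1 hm' with rfl | h6
      · exact b1.1
      · exact i1 m' h6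
    · rw [b3]; exact i2
    · simp only [wsum, ssum, b3, i3, tauOf]
      rw [nu_symm w q r]

theorem pot_node {n : ℕ} {w : List ℕ} (hw : IsReduced n w) {k : ℕ} {h : ℕ → ℕ}
    (hp : IsPot n (nu w) k h) {r a b : ℕ} (ha : ValidNode w a) (ha' : NodeOnWire w a r)
    (hb : ValidNode w b) (hb' : NodeOnWire w b r) (hab : Bef k r a b) : h a < h b := by
  obtain ⟨a1, a2, a3, a4, a5, a6⟩ := other_spec hw ha ha'
  obtain ⟨b1, b2, b3, b4, -⟩ := other_spec hw hb hb'
  have := hp r _ _ a5 a6 a1 a2 a3 b1 b2 b3 (by rw [a4, b4]; exact hab)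
  rwa [a4, b4] at this

theorem onWire_other {w : List ℕ} {m r : ℕ} (h : NodeOnWire w m r) :
    NodeOnWire w m (otherWire w m r) := by
  unfold NodeOnWire otherWire at *
  split_ifs <;> tauto

theorem visitTail_nodup {n : ℕ} {w : List ℕ} (hw : IsReduced n w) {k : ℕ} {h : ℕ → ℕ}
    (hp : IsPot n (nu w) k h) (ms : List ℕ) : ∀ r a, ValidNode w a → NodeOnWire w a r →
      TravelOK w k r a ms → (visitTail w r a ms).Nodup ∧ ∀ j ∈ visitTail w r a ms, h a < h j := by
  induction ms with
  | nil =>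
    intro r a ha ha' ht
    refine ⟨(nodup_nodesOn w r).filter _, ?_⟩
    intro j hj
    obtain ⟨⟨h1, h2⟩, h3⟩ := mem_tailList.1 hj
    refine pot_node hw hp ha ha' h1 h2 ?_
    have := ht.1
    unfold Bef
    rw [if_neg (by omega)]; exact h3
  | cons m ms ih =>
    intro r a ha ha' ht
    obtain ⟨h1, h2, h3, h4, h5⟩ := ht
    have h3' : Bef k r a m := h3
    obtain ⟨i1, i2⟩ := ih _ m h1 (onWire_other h2) h5
    have ham := pot_node hw hp ha ha' h1 h2 h3'
    have hseg : ∀ j ∈ segList w r a m, h a < h j ∧ h j < h m := by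
      intro j hj
      obtain ⟨⟨b1, b2⟩, b3⟩ := mem_segList.1 hj
      constructor
      · refine pot_node hw hp ha ha' b1 b2 ?_
        unfold Bef at h3' ⊢; split_ifs at h3' ⊢ <;> omega
      · refine pot_node hw hp b1 b2 h1 h2 ?_
        unfold Bef at h3' ⊢; split_ifs at h3' ⊢ <;> omega
    constructor
    · unfold visitTail
      rw [List.nodup_append]
      refine ⟨(nodup_nodesOn w r).filter _, ?_, ?_⟩
      · rw [List.nodup_cons]
        exact ⟨fun hm => lt_irrefl _ (i2 m hm), i1⟩
      · intro x hx y hy hxy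
        subst hxy
        have := (hseg x hx).2
        rcases List.mem_cons.1 hy with rfl | hy
        · omega
        · have := i2 x hy; omega
    · intro j hj
      unfold visitTail at hj
      rcases List.mem_append.1 hj with hj | hj
      · exact (hseg j hj).1
      · rcases List.mem_cons.1 hj with rfl | hj
        · exact ham
        · have := i2 j hj; omega

theorem gp_nodup {n : ℕ} {w : List ℕ} (hw : IsReduced n w) {k m : ℕ} {ms : List ℕ} (hk' : k ≤ n)
    (hm : ValidNode w m) (hmk : NodeOnWire w m k)
    (ht : TravelOK w k (otherWire w m k) m ms) : (visitList w k (m :: ms)).Nodup := by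
  obtain ⟨h, M, hp, -⟩ := exists_pot (arr_nu hw) k (by omega)
  obtain ⟨i1, i2⟩ := visitTail_nodup hw hp ms _ m hm (onWire_other hmk) ht
  unfold visitList
  have htl : ∀ j ∈ tailList w k m, h j < h m := by
    intro j hj
    obtain ⟨⟨b1, b2⟩, b3⟩ := mem_tailList.1 hj
    refine pot_node hw hp b1 b2 hm hmk ?_
    unfold Bef; rw [if_pos le_rfl]; exact b3
  rw [List.nodup_append]
  refine ⟨(nodup_nodesOn w k).filter _, ?_, ?_⟩
  · rw [List.nodup_cons]
    exact ⟨fun hm => lt_irrefl _ (i2 m hm), i1⟩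
  · intro x hx y hy hxy
    subst hxy
    have := htl x hx
    rcases List.mem_cons.1 hy with rfl | hy
    · omega
    · have := i2 x hy; omega

theorem mem_stringCone {n : ℕ} {w : List ℕ} (hw : IsReduced n w) (t : Fin (Dim n) → ℝ) :
    t ∈ stringCone n w ↔ ∀ k l, WP n (nu w) k l → 0 ≤ wsum (tauOf n w t) k l := by
  constructor
  · intro h k l hl
    match l, hl with
    | s :: l, hl =>
      obtain ⟨h1, h2, h3, h4, h5, h6⟩ := hl
      obtain ⟨ms, i1, i2, i3⟩ := wt_to_travel hw t k l k s h3 h4 h6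
      obtain ⟨b1, b2, b3⟩ := nu_node hw h1 (by omega) h3 h4 h5
      have hgp : (k, nu w k s :: ms) ∈ GP n w := by
        refine ⟨h1, h2, ⟨b1, b2, ?_, ?_⟩, ?_⟩
        · intro j _ hf
          rw [forb_iff] at hf
          unfold Forb at hf; omega
        · rw [b3]; exact i2
        · refine gp_nodup hw h2 b1 b2 ?_
          rw [b3]; exact i2
      have := h _ hgp
      rw [ssum_eq] at this
      · simp only [ssum, b3] at this
        simp only [wsum, i3, tauOf]
        rw [nu_symm w s k]; exact this
      · intro m' hm'
        rcases List.mem_cons.1 hm' with rfl | h6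
        · exact b1.1
        · exact i1 m' h6
  · rintro h ⟨k, ms⟩ hp
    obtain ⟨h1, h2, h3, -⟩ := hp
    match ms, h3 with
    | m :: ms, h3 =>
      obtain ⟨a1, a2, a3, a4⟩ := h3
      dsimp only at h1 h2 a1 a2 a3 a4
      obtain ⟨b1, b2, b3, b4, -⟩ := other_spec hw a1 a2
      set q := otherWire w m k with hq
      obtain ⟨i1, l, i2, i3⟩ := travel_to_wt hw t k ms k q b1 b2 (by rw [b4]; exact a4)
      have := h k (q :: l) ⟨h1, h2, b1, b2, b3, i2⟩
      rw [ssum_eq]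
      · simp only [wsum, i3, tauOf] at this
        simp only [ssum, ← hq]
        rw [nu_symm w q k, b4] at this; exact this
      · intro m' hm'
        rcases List.mem_cons.1 hm' with rfl | h6
        · exact a1.1
        · exact i1 m' h6


/-! ### Irredundancy of the string inequalities -/

theorem wsum_add (τ σ : ℕ → ℕ → ℝ) (l : List ℕ) : ∀ r, wsum (fun a b => τ a b + σ a b) r l =
    wsum τ r l + wsum σ r l := by
  induction l with
  | nil => intro r; simp [wsum]
  | cons q l ih => intro r; simp only [wsum, ih]; split_ifs <;> ring

theorem wsum_smul (c : ℝ) (τ : ℕ → ℕ → ℝ) (l : List ℕ) : ∀ r, wsum (fun a b => c * τ a b) r l =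
    c * wsum τ r l := by
  induction l with
  | nil => intro r; simp [wsum]
  | cons q l ih => intro r; simp only [wsum, ih]; split_ifs <;> ring

theorem wsum_congr {n k : ℕ} {ν : ℕ → ℕ → ℕ} (τ σ : ℕ → ℕ → ℝ)
    (h : ∀ r s, 1 ≤ r → r < s → s ≤ n + 1 → τ r s = σ r s) (l : List ℕ) :
    ∀ p r, 1 ≤ r → r ≤ n + 1 → WT n ν k p r l → wsum τ r l = wsum σ r l := by
  induction l with
  | nil => intro p r _ _ _; rfl
  | cons q l ih =>
    intro p r hr hr' hw
    obtain ⟨h1, h2, h3, h4, h5, h6⟩ := hw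
    simp only [wsum]
    rw [ih r q h1 h2 h6]
    congr 1
    split_ifs with hlt
    · exact h r q hr hlt h2
    · rw [h q r h1 (by omega) hr']

theorem wsum_congr_wp {n k : ℕ} {ν : ℕ → ℕ → ℕ} (τ σ : ℕ → ℕ → ℝ)
    (h : ∀ r s, 1 ≤ r → r < s → s ≤ n + 1 → τ r s = σ r s) (l : List ℕ) (hl : WP n ν k l) :
    wsum τ k l = wsum σ k l := by
  match l, hl with
  | s :: l, hl =>
    obtain ⟨h1, h2, h3, h4, h5, h6⟩ := hl
    simp only [wsum]
    rw [wsum_congr τ σ h l k s h3 h4 h6]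
    congr 1
    split_ifs with hlt
    · exact h k s h1 hlt h4
    · rw [h s k h3 (by omega) (by omega)]

theorem wsum_tele_aux {n k : ℕ} {ν : ℕ → ℕ → ℕ} (F : ℕ → ℝ) (l : List ℕ) :
    ∀ p r, WT n ν k p r l → wsum (fun a b => F b - F a) r l = F (k + 1) - F r := by
  induction l with
  | nil => intro p r h; have h' : r = k + 1 := h; simp [wsum, h']
  | cons q l ih =>
    intro p r h
    simp only [wsum]
    rw [ih r q h.2.2.2.2.2]
    split_ifs <;> ring

theorem wsum_tele {n k : ℕ} {ν : ℕ → ℕ → ℕ} (F : ℕ → ℝ) (l : List ℕ) (hl : WP n ν k l) :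
    wsum (fun a b => F b - F a) k l = F (k + 1) - F k := by
  match l, hl with
  | s :: l, hl =>
    simp only [wsum]
    rw [wsum_tele_aux F l k s hl.2.2.2.2.2]
    split_ifs <;> ring

theorem wt_len {n k : ℕ} {ν : ℕ → ℕ → ℕ} (hA : Arr n ν) {h : ℕ → ℕ} {M : ℕ} (hp : IsPot n ν k h)
    (hM : ∀ j ≤ Dim n, h j < M) (l : List ℕ) : ∀ p r, 1 ≤ r → r ≤ n + 1 → 1 ≤ p → p ≤ n + 1 →
      p ≠ r → WT n ν k p r l → l.length + h (ν p r) < M ∧ ∀ x ∈ l, x ≤ n + 1 := by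
  induction l with
  | nil =>
    intro p r hr hr' hp hp' hpr _
    exact ⟨by simpa using hM _ (hA.rng' hp hp' hr hr' (Ne.symm hpr)).2, by simp⟩
  | cons q l ih =>
    intro p r hr hr' hp1 hp' hpr hw
    obtain ⟨h1, h2, h3, h4, h5, h6⟩ := hw
    obtain ⟨i1, i2⟩ := ih r q h1 h2 hr hr' (Ne.symm h3) h6
    have := hp r p q hr hr' hp1 hp' hpr h1 h2 h3 (by rw [hA.symm r p]; exact h4)
    rw [hA.symm r p] at this
    refine ⟨by simp only [List.length_cons]; omega, ?_⟩
    intro x hx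
    rcases List.mem_cons.1 hx with rfl | hx
    · exact h2
    · exact i2 x hx

theorem wp_finite {n : ℕ} {ν : ℕ → ℕ → ℕ} (hA : Arr n ν) :
    {p : ℕ × List ℕ | WP n ν p.1 p.2}.Finite := by
  have hk : ∀ k, {l : List ℕ | WP n ν k l}.Finite := by
    intro k
    by_cases hkn : k ≤ n
    · obtain ⟨h, M, hp, hM⟩ := exists_pot hA k (by omega)
      have hf : {l : List (Fin (n + 2)) | l.length ≤ M}.Finite := List.finite_length_le _ _
      refine (hf.image (List.map Fin.val)).subset ?_
      intro l hl
      match l, hl with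
      | s :: l, hl =>
        obtain ⟨h1, h2, h3, h4, h5, h6⟩ := hl
        obtain ⟨i1, i2⟩ := wt_len hA hp hM l k s h3 h4 h1 (by omega) (Ne.symm h5) h6
        refine ⟨(s :: l).map (Fin.ofNat (n + 2)), by simp; omega, ?_⟩
        rw [List.map_map]
        conv_rhs => rw [← List.map_id (s :: l)]
        apply List.map_congr_left
        intro x hx
        have : x ≤ n + 1 := by
          rcases List.mem_cons.1 hx with rfl | hx
          · exact h4
          · exact i2 x hx
        simp [Fin.ofNat, Nat.mod_eq_of_lt (show x < n + 2 by omega)]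
    · convert Set.finite_empty
      ext l
      simp only [Set.mem_setOf_eq, Set.mem_empty_iff_false, iff_false]
      intro hl
      match l, hl with
      | s :: l, hl => exact hkn hl.2.1
  have : {p : ℕ × List ℕ | WP n ν p.1 p.2} ⊆
      ⋃ k ∈ Set.Iic n, (Prod.mk k) '' {l | WP n ν k l} := by
    rintro ⟨k, l⟩ hl
    simp only [Set.mem_iUnion]
    refine ⟨k, ?_, l, hl, rfl⟩
    match l, hl with
    | s :: l, hl => exact hl.2.1
  exact ((Set.finite_Iic n).biUnion (fun k _ => (hk k).image _)).subset this

/-- the path (in-node `ν p r`, then along `r`, …) leaves the node `ν a b` along `a`. -/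
def LE (n : ℕ) (ν : ℕ → ℕ → ℕ) (k : ℕ) : ℕ → ℕ → List ℕ → ℕ → ℕ → Prop
  | p, r, [], a, b => a = r ∧ 1 ≤ b ∧ b ≤ n + 1 ∧ b ≠ r ∧ ¬ Bef k r (ν r b) (ν p r)
  | p, r, q :: l, a, b => (a = r ∧ 1 ≤ b ∧ b ≤ n + 1 ∧ b ≠ r ∧ ¬ Bef k r (ν r b) (ν p r) ∧
      Bef k r (ν r b) (ν r q)) ∨ LE n ν k r q l a b

def FE (n : ℕ) (ν : ℕ → ℕ → ℕ) (k : ℕ) : List ℕ → ℕ → ℕ → Prop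
  | [], _, _ => False
  | s :: l, a, b => (a = k ∧ 1 ≤ b ∧ b ≤ n + 1 ∧ b ≠ k ∧ Bef k k (ν k b) (ν k s)) ∨
      LE n ν k k s l a b

theorem bef_trichotomy {k r a b : ℕ} (h : ¬ Bef k r a b) : a = b ∨ Bef k r b a := by
  unfold Bef at *; split_ifs at * <;> omega

theorem Bef.trans {k r a b c : ℕ} (h : Bef k r a b) (h' : Bef k r b c) : Bef k r a c := by
  unfold Bef at *; split_ifs at * <;> omega

theorem Bef.irrefl {k r a : ℕ} (h : Bef k r a a) : False := by
  unfold Bef at *; split_ifs at * <;> omega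

theorem le_pot {n k : ℕ} {ν : ℕ → ℕ → ℕ} (hA : Arr n ν) {h : ℕ → ℕ} (hp : IsPot n ν k h)
    (l : List ℕ) : ∀ p r, 1 ≤ r → r ≤ n + 1 → 1 ≤ p → p ≤ n + 1 →
      p ≠ r → WT n ν k p r l → ∀ a b, LE n ν k p r l a b → h (ν p r) ≤ h (ν a b) := by
  have aux : ∀ p r, 1 ≤ r → r ≤ n + 1 → 1 ≤ p → p ≤ n + 1 → p ≠ r → ∀ b, 1 ≤ b → b ≤ n + 1 →
      b ≠ r → ¬ Bef k r (ν r b) (ν p r) → h (ν p r) ≤ h (ν r b) := by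
    intro p r hr hr' hp1 hp' hpr b hb hb' hbr hbef
    rw [hA.symm p r] at hbef ⊢
    rcases bef_trichotomy hbef with e | e
    · rw [e]
    · exact (hp r p b hr hr' hp1 hp' hpr hb hb' hbr e).le
  induction l with
  | nil =>
    rintro p r hr hr' hp1 hp' hpr _ a b ⟨rfl, hb, hb', hbr, h1⟩
    exact aux p a hr hr' hp1 hp' hpr b hb hb' hbr h1
  | cons q l ih =>
    rintro p r hr hr' hp1 hp' hpr ⟨h1, h2, h3, h4, h5, h6⟩ a b hab
    rcases hab with ⟨rfl, hb, hb', hbr, h7, h8⟩ | hab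
    · exact aux p a hr hr' hp1 hp' hpr b hb hb' hbr h7
    · have := ih r q h1 h2 hr hr' (Ne.symm h3) h6 a b hab
      have h9 := hp r p q hr hr' hp1 hp' hpr h1 h2 h3 (by rw [hA.symm r p]; exact h4)
      rw [hA.symm r p] at h9
      omega

theorem le_unique {n k : ℕ} {ν : ℕ → ℕ → ℕ} (hA : Arr n ν) {h : ℕ → ℕ} (hp : IsPot n ν k h)
    (l : List ℕ) : ∀ p r, 1 ≤ r → r ≤ n + 1 → 1 ≤ p → p ≤ n + 1 →
      p ≠ r → WT n ν k p r l → ∀ a b, LE n ν k p r l a b → LE n ν k p r l b a → False := by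
  induction l with
  | nil =>
    rintro p r hr hr' hp1 hp' hpr _ a b ⟨rfl, hb, hb', hbr, h1⟩ ⟨h2, -⟩
    exact hbr h2
  | cons q l ih =>
    rintro p r hr hr' hp1 hp' hpr ⟨h1, h2, h3, h4, h5, h6⟩ a b hab hba
    have key : ∀ b, 1 ≤ b → b ≤ n + 1 → b ≠ r → Bef k r (ν r b) (ν r q) →
        LE n ν k r q l b r → False := by
      intro b hb hb' hbr h8 hl
      have i1 := le_pot hA hp l r q h1 h2 hr hr' (Ne.symm h3) h6 b r hl
      have i2 := hp r b q hr hr' hb hb' hbr h1 h2 h3 h8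
      rw [hA.symm b r] at i1
      omega
    rcases hab with ⟨rfl, hb, hb', hbr, h7, h8⟩ | hab
    · rcases hba with ⟨h9, -⟩ | hba
      · exact hbr h9
      · exact key b hb hb' hbr h8 hba
    · rcases hba with ⟨rfl, hb, hb', hbr, h7, h8⟩ | hba
      · exact key a hb hb' hbr h8 hab
      · exact ih r q h1 h2 hr hr' (Ne.symm h3) h6 a b hab hba

theorem le_first {n k : ℕ} {ν : ℕ → ℕ → ℕ} (l : List ℕ) (p r : ℕ) (hp : 1 ≤ p) (hp' : p ≤ n + 1)
    (hpr : p ≠ r) (hA : Arr n ν) (h : WT n ν k p r l) : LE n ν k p r l r p := by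
  cases l with
  | nil => exact ⟨rfl, hp, hp', hpr, by rw [hA.symm p r]; exact fun h => h.irrefl⟩
  | cons q l =>
    refine Or.inl ⟨rfl, hp, hp', hpr, by rw [hA.symm p r]; exact fun h => h.irrefl, ?_⟩
    rw [hA.symm r p]; exact h.2.2.2.1

theorem le_eq {n k : ℕ} {ν : ℕ → ℕ → ℕ} (hA : Arr n ν) {h : ℕ → ℕ} (hp : IsPot n ν k h)
    (l : List ℕ) : ∀ l' p r, 1 ≤ r → r ≤ n + 1 → 1 ≤ p → p ≤ n + 1 →
      p ≠ r → WT n ν k p r l → WT n ν k p r l' →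
      (∀ a b, LE n ν k p r l a b → LE n ν k p r l' a b) → l = l' := by
  induction l with
  | nil =>
    intro l' p r hr hr' hp1 hp' hpr hw hw' hsub
    cases l' with
    | nil => rfl
    | cons q l' =>
      exfalso
      have hwc := hw'
      obtain ⟨h1, h2, h3, h4, h5, h6⟩ := hw'
      have e1 : LE n ν k p r [] r q := ⟨rfl, h1, h2, h3, fun hb => (hb.trans h4).irrefl⟩
      have e2 := hsub _ _ e1
      have e3 : LE n ν k p r (q :: l') q r :=
        Or.inr (le_first l' r q hr hr' (Ne.symm h3) hA h6)
      exact le_unique hA hp _ p r hr hr' hp1 hp' hpr hwc _ _ e2 e3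
  | cons q l ih =>
    intro l' p r hr hr' hp1 hp' hpr hw hw' hsub
    have hwc := hw'
    obtain ⟨h1, h2, h3, h4, h5, h6⟩ := hw
    have e3 : LE n ν k p r (q :: l) q r :=
        Or.inr (le_first l r q hr hr' (Ne.symm h3) hA h6)
    have e4 := hsub _ _ e3
    cases l' with
    | nil => exact absurd e4.1 h3
    | cons q' l' =>
      obtain ⟨g1, g2, g3, g4, g5, g6⟩ := hw'
      have f3 : LE n ν k p r (q' :: l') q' r :=
        Or.inr (le_first l' r q' hr hr' (Ne.symm g3) hA g6)
      have huniq := le_unique hA hp _ p r hr hr' hp1 hp' hpr hwc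
      have hqq : q = q' := by
        by_contra hne
        have hb : Bef k r (ν r q) (ν r q') ∨ Bef k r (ν r q') (ν r q) := by
          by_cases hb : Bef k r (ν r q) (ν r q')
          · exact Or.inl hb
          · rcases bef_trichotomy hb with e | e
            · exact absurd (hA.inj' hr hr' h1 h2 g1 g2 h3 g3 e) hne
            · exact Or.inr e
        rcases hb with hb | hb
        · have e5 : LE n ν k p r (q' :: l') r q :=
            Or.inl ⟨rfl, h1, h2, h3, fun hb => (hb.trans h4).irrefl, hb⟩
          exact huniq _ _ e5 e4
        · have e5 : LE n ν k p r (q :: l) r q' :=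
            Or.inl ⟨rfl, g1, g2, g3, fun hb => (hb.trans g4).irrefl, hb⟩
          exact huniq _ _ (hsub _ _ e5) f3
      subst hqq
      congr 1
      refine ih l' r q h1 h2 hr hr' (Ne.symm h3) h6 g6 ?_
      intro a b hab
      rcases hsub a b (Or.inr hab) with ⟨rfl, hb, hb', hbr, h7, h8⟩ | h7
      · exfalso
        have i1 := le_pot hA hp l a q h1 h2 hr hr' (Ne.symm h3) h6 a b hab
        have i2 := hp a b q hr hr' hb hb' hbr h1 h2 h3 h8
        omega
      · exact h7

theorem fe_eq {n k : ℕ} {ν : ℕ → ℕ → ℕ} (hA : Arr n ν) (l l' : List ℕ) (hl : WP n ν k l)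
    (hl' : WP n ν k l') (hsub : ∀ a b, FE n ν k l a b → FE n ν k l' a b) : l = l' := by
  match l, hl, l', hl' with
  | q :: l, hl, q' :: l', hl' =>
    obtain ⟨hk, hk', h1, h2, h3, h6⟩ := hl
    obtain ⟨-, -, g1, g2, g3, g6⟩ := hl'
    obtain ⟨h, M, hp, -⟩ := exists_pot hA k (by omega)
    have hkn : k ≤ n + 1 := by omega
    have huniq : ∀ a b, FE n ν k (q' :: l') a b → FE n ν k (q' :: l') b a → False := by
      intro a b hab hba
      have key : ∀ b, 1 ≤ b → b ≤ n + 1 → b ≠ k → Bef k k (ν k b) (ν k q') →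
          LE n ν k k q' l' b k → False := by
        intro b hb hb' hbr h8 hl
        have i1 := le_pot hA hp l' k q' g1 g2 hk hkn (Ne.symm g3) g6 b k hl
        have i2 := hp k b q' hk hkn hb hb' hbr g1 g2 g3 h8
        rw [hA.symm b k] at i1
        omega
      rcases hab with ⟨rfl, hb, hb', hbr, h8⟩ | hab
      · rcases hba with ⟨h9, -⟩ | hba
        · exact hbr h9
        · exact key b hb hb' hbr h8 hba
      · rcases hba with ⟨rfl, hb, hb', hbr, h8⟩ | hba
        · exact key a hb hb' hbr h8 hab
        · exact le_unique hA hp l' k q' g1 g2 hk hkn (Ne.symm g3) g6 a b hab hba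
    have e4 := hsub q k (Or.inr (le_first l k q hk hkn (Ne.symm h3) hA h6))
    have f3 : FE n ν k (q' :: l') q' k := Or.inr (le_first l' k q' hk hkn (Ne.symm g3) hA g6)
    have hqq : q = q' := by
      by_contra hne
      have hb : Bef k k (ν k q) (ν k q') ∨ Bef k k (ν k q') (ν k q) := by
        by_cases hb : Bef k k (ν k q) (ν k q')
        · exact Or.inl hb
        · rcases bef_trichotomy hb with e | e
          · exact absurd (hA.inj' hk hkn h1 h2 g1 g2 h3 g3 e) hne
          · exact Or.inr e
      rcases hb with hb | hb
      · exact huniq _ _ (Or.inl ⟨rfl, h1, h2, h3, hb⟩) e4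
      · exact huniq _ _ (hsub _ _ (Or.inl ⟨rfl, g1, g2, g3, hb⟩)) f3
    subst hqq
    congr 1
    refine le_eq hA hp l l' k q h1 h2 hk hkn (Ne.symm h3) h6 g6 ?_
    intro a b hab
    rcases hsub a b (Or.inr hab) with ⟨rfl, hb, hb', hbr, h8⟩ | h7
    · exfalso
      have i1 := le_pot hA hp l a q h1 h2 hk hkn (Ne.symm h3) h6 a b hab
      have i2 := hp a b q hk hkn hb hb' hbr h1 h2 h3 h8
      omega
    · exact h7

def ecost (E : ℕ → ℕ → Prop) (a b : ℕ) : ℝ := if E a b then 0 else 1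

def Tco (n : ℕ) (ν : ℕ → ℕ → ℕ) (k : ℕ) (E : ℕ → ℕ → Prop) (r j : ℕ) : ℝ :=
  ∑ x ∈ Finset.Icc 1 (n + 1), if x ≠ r ∧ ¬ Bef k r (ν r x) j then ecost E r x else 0

theorem Tco_diff {n k : ℕ} {ν : ℕ → ℕ → ℕ} (E : ℕ → ℕ → Prop) {r i j : ℕ} (hij : Bef k r i j) :
    Tco n ν k E r i - Tco n ν k E r j = ∑ x ∈ Finset.Icc 1 (n + 1),
      if x ≠ r ∧ ¬ Bef k r (ν r x) i ∧ Bef k r (ν r x) j then ecost E r x else 0 := by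
  unfold Tco
  rw [← Finset.sum_sub_distrib]
  apply Finset.sum_congr rfl
  intro x _
  by_cases h1 : x ≠ r
  · by_cases h2 : Bef k r (ν r x) i
    · have h3 := h2.trans hij
      simp [h2, h3]
    · by_cases h3 : Bef k r (ν r x) j <;> simp [h1, h2, h3]
  · simp [h1]

theorem esum_nonneg {n : ℕ} (E : ℕ → ℕ → Prop) (P : ℕ → Prop) [DecidablePred P] (r : ℕ) :
    (0 : ℝ) ≤ ∑ x ∈ Finset.Icc 1 (n + 1), (if P x then ecost E r x else 0) ∧
    ((∑ x ∈ Finset.Icc 1 (n + 1), (if P x then ecost E r x else 0)) = 0 ↔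
      ∀ x, 1 ≤ x → x ≤ n + 1 → P x → E r x) := by
  have hnn : ∀ x ∈ Finset.Icc 1 (n + 1), (0 : ℝ) ≤ (if P x then ecost E r x else 0) := by
    intro x _; unfold ecost; split_ifs <;> norm_num
  refine ⟨Finset.sum_nonneg hnn, ?_⟩
  rw [Finset.sum_eq_zero_iff_of_nonneg hnn]
  constructor
  · intro h x h1 h2 hP
    have := h x (Finset.mem_Icc.2 ⟨h1, h2⟩)
    rw [if_pos hP] at this
    unfold ecost at this
    by_contra hE
    rw [if_neg hE] at this; norm_num at this
  · intro h x hx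
    rw [Finset.mem_Icc] at hx
    split_ifs with hP
    · unfold ecost; rw [if_pos (h x hx.1 hx.2 hP)]
    · rfl

theorem tau_switch {n : ℕ} {ν : ℕ → ℕ → ℕ} (hA : Arr n ν) (H : ℕ → ℕ → ℝ) (r q : ℕ) :
    (if r < q then (H q (ν r q) - H r (ν r q)) else -(H r (ν q r) - H q (ν q r))) =
      H q (ν r q) - H r (ν r q) := by
  split_ifs
  · rfl
  · rw [hA.symm q r]; ring

theorem wt_cost {n k : ℕ} {ν : ℕ → ℕ → ℕ} (hA : Arr n ν) (E : ℕ → ℕ → Prop) (l : List ℕ) :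
    ∀ p r, WT n ν k p r l →
      0 ≤ Tco n ν k E r (ν p r) +
        wsum (fun a b => Tco n ν k E b (ν a b) - Tco n ν k E a (ν a b)) r l ∧
      (Tco n ν k E r (ν p r) +
        wsum (fun a b => Tco n ν k E b (ν a b) - Tco n ν k E a (ν a b)) r l = 0 ↔
        ∀ a b, LE n ν k p r l a b → E a b) := by
  induction l with
  | nil =>
    intro p r h
    simp only [wsum, add_zero]
    obtain ⟨h1, h2⟩ := esum_nonneg (n := n) E (fun x => x ≠ r ∧ ¬ Bef k r (ν r x) (ν p r)) r
    refine ⟨h1, h2.trans ?_⟩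
    constructor
    · rintro h3 a b ⟨rfl, hb, hb', hbr, h7⟩
      exact h3 b hb hb' ⟨hbr, h7⟩
    · intro h3 x hx hx' hx2
      exact h3 r x ⟨rfl, hx, hx', hx2.1, hx2.2⟩
  | cons q l ih =>
    rintro p r ⟨h1, h2, h3, h4, h5, h6⟩
    obtain ⟨i1, i2⟩ := ih r q h6
    simp only [wsum]
    rw [tau_switch hA (Tco n ν k E)]
    obtain ⟨g1, g2⟩ := esum_nonneg (n := n) E
      (fun x => x ≠ r ∧ ¬ Bef k r (ν r x) (ν p r) ∧ Bef k r (ν r x) (ν r q)) r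
    rw [← Tco_diff E h4] at g1 g2
    refine ⟨by linarith, ?_⟩
    constructor
    · intro h0
      have z1 := g2.1 (by linarith)
      have z2 := i2.1 (by linarith)
      rintro a b (⟨rfl, hb, hb', hbr, h7, h8⟩ | hab)
      · exact z1 b hb hb' ⟨hbr, h7, h8⟩
      · exact z2 a b hab
    · intro h0
      have z1 := i2.2 (fun a b hab => h0 a b (Or.inr hab))
      have z2 := g2.2 (fun x hx hx' hx2 => h0 r x (Or.inl ⟨rfl, hx, hx', hx2.1, hx2.2.1, hx2.2.2⟩))
      linarith

theorem wp_cost {n k : ℕ} {ν : ℕ → ℕ → ℕ} (hA : Arr n ν) (E : ℕ → ℕ → Prop) : ∃ C : ℝ,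
    ∀ l, WP n ν k l →
      0 ≤ C + wsum (fun a b => Tco n ν k E b (ν a b) - Tco n ν k E a (ν a b)) k l ∧
      (C + wsum (fun a b => Tco n ν k E b (ν a b) - Tco n ν k E a (ν a b)) k l = 0 ↔
        ∀ a b, FE n ν k l a b → E a b) := by
  refine ⟨∑ x ∈ Finset.Icc 1 (n + 1), if x ≠ k then ecost E k x else 0, ?_⟩
  intro l hl
  match l, hl with
  | q :: l, hl =>
    obtain ⟨hk, hk', h1, h2, h3, h6⟩ := hl
    simp only [wsum]
    rw [tau_switch hA (Tco n ν k E)]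
    obtain ⟨i1, i2⟩ := wt_cost hA E l k q h6
    obtain ⟨g1, g2⟩ := esum_nonneg (n := n) E
      (fun x => x ≠ k ∧ Bef k k (ν k x) (ν k q)) k
    have hd : (∑ x ∈ Finset.Icc 1 (n + 1), if x ≠ k then ecost E k x else 0) -
        Tco n ν k E k (ν k q) = ∑ x ∈ Finset.Icc 1 (n + 1),
          if x ≠ k ∧ Bef k k (ν k x) (ν k q) then ecost E k x else 0 := by
      unfold Tco
      rw [← Finset.sum_sub_distrib]
      apply Finset.sum_congr rfl
      intro x _
      by_cases h1 : x ≠ k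
      · by_cases h2 : Bef k k (ν k x) (ν k q) <;> simp [h1, h2]
      · simp [h1]
    rw [← hd] at g1 g2
    refine ⟨by linarith, ?_⟩
    constructor
    · intro h0
      have z1 := g2.1 (by linarith)
      have z2 := i2.1 (by linarith)
      rintro a b (⟨rfl, hb, hb', hbr, h8⟩ | hab)
      · exact z1 b hb hb' ⟨hbr, h8⟩
      · exact z2 a b hab
    · intro h0
      have z1 := i2.2 (fun a b hab => h0 a b (Or.inr hab))
      have z2 := g2.2 (fun x hx hx' hx2 => h0 k x (Or.inl ⟨rfl, hx, hx', hx2.1, hx2.2⟩))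
      linarith

theorem wp_interior {n : ℕ} {ν : ℕ → ℕ → ℕ} :
    ∀ k l, WP n ν k l → 0 < wsum (fun a b => (b : ℝ) - (a : ℝ)) k l := by
  intro k l hl
  rw [wsum_tele (fun a => (a : ℝ)) l hl]
  push_cast; linarith

theorem wp_witness {n k : ℕ} {ν : ℕ → ℕ → ℕ} (hA : Arr n ν) {l : List ℕ} (hl : WP n ν k l) :
    ∃ τ : ℕ → ℕ → ℝ, wsum τ k l = 0 ∧
      ∀ k' l', WP n ν k' l' → (k', l') ≠ (k, l) → 0 < wsum τ k' l' := by
  obtain ⟨C, hC⟩ := wp_cost (k := k) hA (FE n ν k l)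
  set τ₁ : ℕ → ℕ → ℝ := fun a b => Tco n ν k (FE n ν k l) b (ν a b) -
    Tco n ν k (FE n ν k l) a (ν a b) with hτ
  obtain ⟨B, hB⟩ := ((wp_finite hA).image (fun p : ℕ × List ℕ => wsum τ₁ p.1 p.2)).bddBelow
  have hB' : ∀ k' l', WP n ν k' l' → B ≤ wsum τ₁ k' l' := fun k' l' h =>
    hB ⟨(k', l'), h, rfl⟩
  let d : ℕ → ℝ := fun i => if i = k then C else 1 - B
  let F : ℕ → ℝ := fun m => ∑ i ∈ Finset.range m, d i
  have hF : ∀ m, F (m + 1) - F m = d m := fun m => by simp [F, Finset.sum_range_succ]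
  refine ⟨fun a b => τ₁ a b + (F b - F a), ?_, ?_⟩
  · rw [wsum_add τ₁ (fun a b => F b - F a), wsum_tele F l hl, hF]
    have := (hC l hl).2.2 (fun a b h => h)
    simp only [d, if_true]
    linarith
  · intro k' l' hl' hne
    rw [wsum_add τ₁ (fun a b => F b - F a), wsum_tele F l' hl', hF]
    by_cases hk : k' = k
    · subst hk
      simp only [d, if_true]
      have h1 := hC l' hl'
      rcases h1.1.lt_or_eq with h2 | h2
      · linarith
      · exfalso
        apply hne
        rw [fe_eq hA l' l hl' hl (h1.2.1 h2.symm)]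
    · simp only [d, if_neg hk]
      have := hB' k' l' hl'
      linarith


/-! ### Facet counts of the string cone and the string polytope -/

theorem entry_comb (n : ℕ) (x y : Fin (Dim n) → ℝ) (a b : ℝ) (j : ℕ) :
    entry n (a • x + b • y) j = a * entry n x j + b * entry n y j := by
  unfold entry; split_ifs <;> simp

theorem wsum_aff (n : ℕ) (w : List ℕ) (k : ℕ) (l : List ℕ) (x y : Fin (Dim n) → ℝ) (a b : ℝ) :
    wsum (tauOf n w (a • x + b • y)) k l =
      a * wsum (tauOf n w x) k l + b * wsum (tauOf n w y) k l := by
  rw [← wsum_smul, ← wsum_smul, ← wsum_add]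
  congr 1
  funext r s
  exact entry_comb n x y a b _

def ptOf (n : ℕ) (w : List ℕ) (τ : ℕ → ℕ → ℝ) : Fin (Dim n) → ℝ :=
  fun j => τ (wireX w ((j : ℕ) + 1)) (wireY w ((j : ℕ) + 1))

theorem tauOf_ptOf {n : ℕ} {w : List ℕ} (hw : IsReduced n w) (τ : ℕ → ℕ → ℝ) (r s : ℕ) (hr : 1 ≤ r)
    (hrs : r < s) (hs : s ≤ n + 1) : tauOf n w (ptOf n w τ) r s = τ r s := by
  obtain ⟨h1, h2, h3⟩ := nu_spec hw hr hrs hs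
  have hlen : w.length = Dim n := hw.1
  unfold tauOf entry ptOf
  have h4 := h1.1
  have h5 := h1.2
  rw [dif_pos (by omega)]
  dsimp only
  rw [Nat.sub_add_cancel h4, h2, h3]

theorem wsum_ptOf {n : ℕ} {w : List ℕ} (hw : IsReduced n w) (τ : ℕ → ℕ → ℝ) (k : ℕ) (l : List ℕ)
    (hl : WP n (nu w) k l) : wsum (tauOf n w (ptOf n w τ)) k l = wsum τ k l :=
  wsum_congr_wp _ _ (tauOf_ptOf hw τ) l hl

abbrev WPt (n : ℕ) (ν : ℕ → ℕ → ℕ) : Type := {p : ℕ × List ℕ // WP n ν p.1 p.2}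

def ellS (n : ℕ) (w : List ℕ) (p : WPt n (nu w)) (t : Fin (Dim n) → ℝ) : ℝ :=
  wsum (tauOf n w t) p.1.1 p.1.2

theorem wpt_finite {n : ℕ} {ν : ℕ → ℕ → ℕ} (hA : Arr n ν) : Finite (WPt n ν) :=
  (wp_finite hA).to_subtype

theorem wp_direct {n k : ℕ} {ν : ℕ → ℕ → ℕ} (hk : 1 ≤ k) (hk' : k ≤ n) : WP n ν k [k + 1] :=
  ⟨hk, hk', by omega, by omega, by omega, rfl⟩

theorem wpt_nonempty {n : ℕ} {ν : ℕ → ℕ → ℕ} (hn : 1 ≤ n) : Nonempty (WPt n ν) :=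
  ⟨⟨(1, [2]), wp_direct le_rfl hn⟩⟩

theorem ellS_aff (n : ℕ) (w : List ℕ) (p : WPt n (nu w)) : AffOn (ellS n w p) := by
  intro x y a b _
  exact wsum_aff n w _ _ x y a b

theorem ellS_zero (n : ℕ) (w : List ℕ) (p : WPt n (nu w)) : ellS n w p 0 = 0 := by
  have := wsum_aff n w p.1.1 p.1.2 0 0 0 0
  simp only [smul_zero, add_zero, zero_mul] at this
  exact this

theorem stringCone_eq {n : ℕ} {w : List ℕ} (hw : IsReduced n w) :
    stringCone n w = polyH (ellS n w) := by
  ext t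
  rw [mem_stringCone hw]
  constructor
  · rintro h ⟨⟨k, l⟩, hp⟩; exact h k l hp
  · intro h k l hl; exact h ⟨(k, l), hl⟩

theorem ellS_interior {n : ℕ} {w : List ℕ} (hw : IsReduced n w) : ∃ t, ∀ p, 0 < ellS n w p t := by
  refine ⟨ptOf n w (fun a b => (b : ℝ) - (a : ℝ)), ?_⟩
  rintro ⟨⟨k, l⟩, hp⟩
  unfold ellS
  dsimp only at hp ⊢
  rw [wsum_ptOf hw _ k l hp]
  exact wp_interior k l hp

theorem ellS_witness {n : ℕ} {w : List ℕ} (hw : IsReduced n w) (p : WPt n (nu w)) :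
    ∃ t, ellS n w p t = 0 ∧ ∀ q, q ≠ p → 0 < ellS n w q t := by
  obtain ⟨⟨k, l⟩, hp⟩ := p
  dsimp only at hp
  obtain ⟨τ, h1, h2⟩ := wp_witness (arr_nu hw) hp
  refine ⟨ptOf n w τ, ?_, ?_⟩
  · unfold ellS; dsimp only; rw [wsum_ptOf hw _ k l hp]; exact h1
  · rintro ⟨⟨k', l'⟩, hq⟩ hne
    unfold ellS; dsimp only at hq ⊢
    rw [wsum_ptOf hw _ k' l' hq]
    exact h2 k' l' hq (fun h => hne (Subtype.ext h))

theorem numFacets_cone {n : ℕ} {w : List ℕ} (hn : 1 ≤ n) (hw : IsReduced n w) :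
    numFacets (stringCone n w) = Nat.card (WPt n (nu w)) := by
  have := wpt_finite (arr_nu hw)
  have := wpt_nonempty (ν := nu w) hn
  rw [stringCone_eq hw]
  exact numFacets_polyH _ (ellS_aff n w) (ellS_interior hw) (ellS_witness hw)

theorem small_eps {m : ℕ} {ι : Type} [Finite ι] (f : ι → (Fin m → ℝ) → ℝ)
    (haff : ∀ a, AffOn (f a)) (x y : Fin m → ℝ) (h : ∀ a, 0 < f a x) :
    ∃ ε : ℝ, 0 < ε ∧ ε < 1 ∧ ∀ a, 0 < f a ((1 - ε) • x + ε • y) := by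
  have h1 : ∀ a, ∀ᶠ ε in nhdsWithin (0 : ℝ) (Set.Ioi 0), 0 < f a ((1 - ε) • x + ε • y) := by
    intro a
    have h2 : ∀ ε : ℝ, f a ((1 - ε) • x + ε • y) = (1 - ε) * f a x + ε * f a y := fun ε =>
      haff a x y _ _ (by ring)
    simp only [h2]
    have hc : Continuous (fun ε : ℝ => (1 - ε) * f a x + ε * f a y) := by fun_prop
    have hc0 := hc.tendsto 0
    simp only [sub_zero, one_mul, zero_mul, add_zero] at hc0
    exact (hc0.eventually (lt_mem_nhds (h a))).filter_mono nhdsWithin_le_nhds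
  have h3 := Filter.eventually_all.2 h1
  have h4 : ∀ᶠ ε in nhdsWithin (0 : ℝ) (Set.Ioi 0), ε < 1 :=
    (gt_mem_nhds (show (0 : ℝ) < 1 by norm_num)).filter_mono nhdsWithin_le_nhds
  obtain ⟨ε, h5, h6, h7⟩ := (h3.and (h4.and self_mem_nhdsWithin)).exists
  exact ⟨ε, h7, h6, h5⟩

def sco (c d : ℕ) : ℝ := if d = c then -2 else if d = c + 1 ∨ d + 1 = c then 1 else 0

/-- `⟨λ - ∑_{k > m} t_k α_{i_k}, α_c^∨⟩` with zero-based summation `k ≥ m`. -/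
def colS (n : ℕ) (w : List ℕ) (lam : ℕ → ℝ) (m : ℕ) (t : Fin (Dim n) → ℝ) (c : ℕ) : ℝ :=
  lam c + ∑ k : Fin (Dim n), (if m ≤ (k : ℕ) then sco c (letterAt w ((k : ℕ) + 1)) else 0) * t k

def slackR (n : ℕ) (w : List ℕ) (lam : ℕ → ℝ) (j : Fin (Dim n)) (t : Fin (Dim n) → ℝ) : ℝ :=
  colS n w lam ((j : ℕ) + 1) t (letterAt w ((j : ℕ) + 1)) - t j

theorem lamIneq_iff (n : ℕ) (w : List ℕ) (lam : ℕ → ℤ) (j : Fin (Dim n)) (t : Fin (Dim n) → ℝ) :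
    LamIneq n w lam j t ↔ 0 ≤ slackR n w (fun c => (lam c : ℝ)) j t := by
  unfold LamIneq slackR colS
  rw [sub_nonneg]
  have : ∀ k : Fin (Dim n), (if (j : ℕ) < (k : ℕ) then lamCoeff w ((j : ℕ) + 1) ((k : ℕ) + 1) else 0)
      = (if (j : ℕ) + 1 ≤ (k : ℕ) then
        sco (letterAt w ((j : ℕ) + 1)) (letterAt w ((k : ℕ) + 1)) else 0) := by
    intro k
    by_cases h : (j : ℕ) < (k : ℕ)
    · rw [if_pos h, if_pos (by omega)]; rfl
    · rw [if_neg h, if_neg (by omega)]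
  simp only [this]

theorem sum_step {N : ℕ} (f : Fin N → ℝ) (m : ℕ) (hm : m < N) :
    (∑ k : Fin N, if m ≤ (k : ℕ) then f k else 0) =
      f ⟨m, hm⟩ + ∑ k : Fin N, if m + 1 ≤ (k : ℕ) then f k else 0 := by
  have h1 : f ⟨m, hm⟩ = ∑ k : Fin N, if k = ⟨m, hm⟩ then f k else 0 := by simp
  rw [h1, ← Finset.sum_add_distrib]
  apply Finset.sum_congr rfl
  intro k _
  by_cases h2 : k = ⟨m, hm⟩
  · have : (k : ℕ) = m := by rw [h2]
    rw [if_pos h2, if_pos (by omega), if_neg (by omega), add_zero]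
  · have : (k : ℕ) ≠ m := fun h => h2 (Fin.ext h)
    rw [if_neg h2, zero_add]
    by_cases h3 : m ≤ (k : ℕ)
    · rw [if_pos h3, if_pos (by omega)]
    · rw [if_neg h3, if_neg (by omega)]

theorem colS_step (n : ℕ) (w : List ℕ) (lam : ℕ → ℝ) (m : ℕ) (t : Fin (Dim n) → ℝ) (c : ℕ)
    (hm : m < Dim n) : colS n w lam m t c =
      colS n w lam (m + 1) t c + sco c (letterAt w (m + 1)) * t ⟨m, hm⟩ := by
  unfold colS
  simp only [ite_mul, zero_mul]
  rw [sum_step (fun k => sco c (letterAt w ((k : ℕ) + 1)) * t k) m hm]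
  ring

theorem colS_top (n : ℕ) (w : List ℕ) (lam : ℕ → ℝ) (t : Fin (Dim n) → ℝ) (c : ℕ) :
    colS n w lam (Dim n) t c = lam c := by
  unfold colS
  rw [Finset.sum_eq_zero, add_zero]
  intro k _
  rw [if_neg (by have := k.2; omega), zero_mul]

theorem slackR_aff (n : ℕ) (w : List ℕ) (lam : ℕ → ℝ) (j : Fin (Dim n)) :
    AffOn (slackR n w lam j) := by
  intro x y a b hab
  unfold slackR colS
  simp only [Pi.add_apply, Pi.smul_apply, smul_eq_mul, mul_add, Finset.sum_add_distrib]
  have : ∀ (z : Fin (Dim n) → ℝ) (d : ℝ) (g : Fin (Dim n) → ℝ),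
      ∑ k, g k * (d * z k) = d * ∑ k, g k * z k := by
    intro z d g
    rw [Finset.mul_sum]; apply Finset.sum_congr rfl; intros; ring
  rw [this, this]
  obtain rfl : b = 1 - a := by linarith
  ring

/-- solvability of the unitriangular system. -/
theorem slack_solve (n : ℕ) (w : List ℕ) (g : Fin (Dim n) → ℝ) :
    ∃ v, ∀ lam t j, slackR n w lam j (t + v) = slackR n w lam j t + g j := by
  let L : (Fin (Dim n) → ℝ) →ₗ[ℝ] (Fin (Dim n) → ℝ) :=
    { toFun := fun v j => slackR n w 0 j v
      map_add' := by
        intro x y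
        funext j
        simp only [slackR, colS, Pi.add_apply, mul_add, Finset.sum_add_distrib, Pi.zero_apply]
        ring
      map_smul' := by
        intro a x
        funext j
        simp only [slackR, colS, Pi.smul_apply, smul_eq_mul, Pi.zero_apply, RingHom.id_apply,
          zero_add, mul_sub, Finset.mul_sum]
        congr 1
        apply Finset.sum_congr rfl; intros; ring }
  have hL : ∀ v j, L v j = slackR n w 0 j v := fun _ _ => rfl
  have hinj : Function.Injective L := by
    rw [injective_iff_map_eq_zero]
    intro v hv
    have key : ∀ d, ∀ j : Fin (Dim n), Dim n - (j : ℕ) = d → v j = 0 := by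
      intro d
      induction d using Nat.strong_induction_on with
      | _ d ih =>
        intro j hj
        have h1 : slackR n w 0 j v = 0 := by rw [← hL, hv]; rfl
        unfold slackR colS at h1
        rw [Finset.sum_eq_zero] at h1
        · simp only [Pi.zero_apply] at h1; linarith
        · intro k _
          by_cases h2 : (j : ℕ) + 1 ≤ (k : ℕ)
          · rw [ih (Dim n - (k : ℕ)) (by have := k.2; omega) k rfl, mul_zero]
          · rw [if_neg h2, zero_mul]
    funext j; exact key _ j rfl
  obtain ⟨v, hv⟩ := LinearMap.injective_iff_surjective.1 hinj g
  refine ⟨v, fun lam t j => ?_⟩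
  rw [← hv, hL]
  simp only [slackR, colS, Pi.add_apply, mul_add, Finset.sum_add_distrib, Pi.zero_apply]
  ring

/-- the point where all `λ`-slacks vanish. -/
theorem colS_extremal {n : ℕ} {w : List ℕ} (hw : IsReduced n w) (Lam : ℕ → ℝ) (m : ℕ)
    (hm : m ≤ Dim n) :
    ∀ c, 1 ≤ c → c ≤ n → colS n w (fun c => Lam c - Lam (c + 1)) m
      (ptOf n w (fun a b => Lam (n + 2 - b) - Lam (n + 2 - a))) c =
      Lam (n + 2 - wordProd (w.take m) c) - Lam (n + 2 - wordProd (w.take m) (c + 1)) := by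
  have hlen : w.length = Dim n := hw.1
  induction hm using Nat.decreasingInduction with
  | self =>
    intro c hc hc'
    rw [colS_top, ← hlen, List.take_length, hw.2.2, longestPerm_apply, longestPerm_apply,
      if_pos (by omega), if_pos (by omega)]
    congr 2 <;> omega
  | of_succ m hm ih =>
    intro c hc hc'
    rw [colS_step n w _ m _ c hm, ih c hc hc', take_succ_letter w m (by omega), wordProd_append,
      wordProd_singleton]
    simp only [Equiv.Perm.mul_apply, ptOf]
    unfold wireX wireY stateAbove
    rw [Nat.add_sub_cancel]
    set i := letterAt w (m + 1)
    set σ := wordProd (w.take m)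
    unfold sTrans sco
    rw [Equiv.swap_apply_def, Equiv.swap_apply_def]
    rcases Nat.lt_trichotomy c i with h | h | h
    · by_cases h2 : c + 1 = i
      · rw [← h2]; simp; rw [if_neg (by omega)]
      · rw [if_neg (by omega), if_neg (by omega), if_neg (by omega), if_neg (by omega),
          if_neg (by omega), if_neg (by omega)]; ring
    · rw [h]; simp; ring
    · by_cases h2 : c = i + 1
      · rw [h2]; simp; rw [if_neg (by omega)]
      · rw [if_neg (by omega), if_neg (by omega), if_neg (by omega), if_neg (by omega),
          if_neg (by omega), if_neg (by omega)]; ring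

theorem letter_rng {n : ℕ} {w : List ℕ} (hw : IsReduced n w) (j : Fin (Dim n)) :
    1 ≤ letterAt w ((j : ℕ) + 1) ∧ letterAt w ((j : ℕ) + 1) ≤ n := by
  have hlen : w.length = Dim n := hw.1
  apply hw.2.1
  have h : (j : ℕ) < w.length := by rw [hlen]; exact j.2
  unfold letterAt
  rw [Nat.add_sub_cancel, List.getD_eq_getElem _ _ h]
  exact List.getElem_mem h

theorem slack_extremal {n : ℕ} {w : List ℕ} (hw : IsReduced n w) (Lam : ℕ → ℝ) (j : Fin (Dim n)) :
    slackR n w (fun c => Lam c - Lam (c + 1)) j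
      (ptOf n w (fun a b => Lam (n + 2 - b) - Lam (n + 2 - a))) = 0 := by
  have hlen : w.length = Dim n := hw.1
  obtain ⟨h1, h2⟩ := letter_rng hw j
  unfold slackR
  rw [colS_extremal hw Lam ((j : ℕ) + 1) (by have := j.2; omega) _ h1 h2,
    take_succ_letter w j (by rw [hlen]; exact j.2), wordProd_append,
      wordProd_singleton]
  simp only [Equiv.Perm.mul_apply, ptOf]
  unfold wireX wireY stateAbove sTrans
  rw [Nat.add_sub_cancel]
  simp

def ellP (n : ℕ) (w : List ℕ) (lam : ℕ → ℝ) :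
    WPt n (nu w) ⊕ Fin (Dim n) → (Fin (Dim n) → ℝ) → ℝ :=
  Sum.elim (ellS n w) (slackR n w lam)

theorem stringPolytope_eq {n : ℕ} {w : List ℕ} (hw : IsReduced n w) (lam : ℕ → ℤ) :
    stringPolytope n w lam = polyH (ellP n w (fun c => (lam c : ℝ))) := by
  ext t
  unfold stringPolytope
  rw [stringCone_eq hw]
  constructor
  · rintro ⟨h1, h2⟩ (p | j)
    · exact h1 p
    · exact (lamIneq_iff n w lam j t).1 (h2 j)
  · intro h
    exact ⟨fun p => h (Sum.inl p), fun j => (lamIneq_iff n w lam j t).2 (h (Sum.inr j))⟩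

theorem slack_congr {n : ℕ} {w : List ℕ} (hw : IsReduced n w) (l1 l2 : ℕ → ℝ)
    (h : ∀ c, 1 ≤ c → c ≤ n → l1 c = l2 c) (j : Fin (Dim n)) (t : Fin (Dim n) → ℝ) :
    slackR n w l1 j t = slackR n w l2 j t := by
  obtain ⟨h1, h2⟩ := letter_rng hw j
  unfold slackR colS
  rw [h _ h1 h2]

theorem numFacets_poly {n : ℕ} {w : List ℕ} (hn : 1 ≤ n) (hw : IsReduced n w) (lam : ℕ → ℤ)
    (hlam : RegularDominant n lam) :
    numFacets (stringPolytope n w lam) = Nat.card (WPt n (nu w)) + Dim n := by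
  have := wpt_finite (arr_nu hw)
  have := wpt_nonempty (ν := nu w) hn
  rw [stringPolytope_eq hw]
  have haff : ∀ a, AffOn (ellP n w (fun c => (lam c : ℝ)) a) := by
    rintro (p | j)
    · exact ellS_aff n w p
    · exact slackR_aff n w _ j
  have h0 : ∀ j, 0 < slackR n w (fun c => (lam c : ℝ)) j 0 := by
    intro j
    obtain ⟨h1, h2⟩ := letter_rng hw j
    simp only [slackR, colS, Pi.zero_apply, mul_zero, Finset.sum_const_zero, add_zero, sub_zero]
    exact_mod_cast hlam _ h1 h2
  rw [numFacets_polyH (ellP n w (fun c => (lam c : ℝ))) haff, Nat.card_sum, Nat.card_fin]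
  · obtain ⟨t, ht⟩ := ellS_interior hw
    obtain ⟨ε, e1, e2, e3⟩ := small_eps _ (fun j => slackR_aff n w (fun c => (lam c : ℝ)) j) 0 t h0
    refine ⟨(1 - ε) • 0 + ε • t, ?_⟩
    rintro (p | j)
    · change 0 < ellS n w p _
      rw [ellS_aff n w p 0 t _ _ (by ring), ellS_zero, mul_zero, zero_add]
      exact mul_pos e1 (ht p)
    · exact e3 j
  · rintro (p | j)
    · obtain ⟨t, ht, ht'⟩ := ellS_witness hw p
      obtain ⟨ε, e1, e2, e3⟩ :=
        small_eps _ (fun j => slackR_aff n w (fun c => (lam c : ℝ)) j) 0 t h0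
      refine ⟨(1 - ε) • 0 + ε • t, ?_, ?_⟩
      · change ellS n w p _ = 0
        rw [ellS_aff n w p 0 t _ _ (by ring), ellS_zero, ht]; ring
      · rintro (q | j) hne
        · change 0 < ellS n w q _
          rw [ellS_aff n w q 0 t _ _ (by ring), ellS_zero, mul_zero, zero_add]
          exact mul_pos e1 (ht' q (fun h => hne (by rw [h])))
        · exact e3 j
    · let Lam : ℕ → ℝ := fun c => ∑ i ∈ Finset.Ico c (n + 1), (lam i : ℝ)
      have hLam : ∀ c, 1 ≤ c → c ≤ n → Lam c - Lam (c + 1) = (lam c : ℝ) := by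
        intro c _ hc
        simp only [Lam]
        rw [Finset.sum_eq_sum_Ico_succ_bot (by omega : c < n + 1)]; ring
      have hz : ∀ i, slackR n w (fun c => (lam c : ℝ)) i
          (ptOf n w (fun a b => Lam (n + 2 - b) - Lam (n + 2 - a))) = 0 := by
        intro i
        rw [← slack_extremal hw Lam i]
        exact (slack_congr hw _ _ hLam i _).symm
      set t0 := ptOf n w (fun a b => Lam (n + 2 - b) - Lam (n + 2 - a)) with ht0
      have hpos : ∀ p, 0 < ellS n w p t0 := by
        rintro ⟨⟨k, l⟩, hp⟩
        unfold ellS; dsimp only at hp ⊢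
        rw [ht0, wsum_ptOf hw _ k l hp, wsum_tele (fun b => Lam (n + 2 - b)) l hp]
        have hk : 1 ≤ k ∧ k ≤ n := by
          match l, hp with
          | s :: l, hp => exact ⟨hp.1, hp.2.1⟩
        have h2 := hLam (n + 2 - (k + 1)) (by omega) (by omega)
        rw [show n + 2 - (k + 1) + 1 = n + 2 - k by omega] at h2
        rw [h2]
        exact_mod_cast hlam _ (by omega) (by omega)
      obtain ⟨v, hv⟩ := slack_solve n w (fun i => if i = j then 0 else 1)
      obtain ⟨ε, e1, e2, e3⟩ := small_eps _ (ellS_aff n w) t0 (t0 + v) hpos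
      have hs : ∀ i, slackR n w (fun c => (lam c : ℝ)) i ((1 - ε) • t0 + ε • (t0 + v)) =
          ε * (if i = j then 0 else 1) := by
        intro i
        rw [slackR_aff n w _ i _ _ _ _ (by ring), hv, hz]; ring
      refine ⟨(1 - ε) • t0 + ε • (t0 + v), ?_, ?_⟩
      · change slackR n w _ j _ = 0
        rw [hs]; simp
      · rintro (q | i) hne
        · exact e3 q
        · change 0 < slackR n w _ i _
          rw [hs, if_neg (fun h => hne (by rw [h]))]; simpa using e1

theorem cone_interior {n : ℕ} {w : List ℕ} (hw : IsReduced n w) :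
    (interior (stringCone n w)).Nonempty := by
  have := wpt_finite (arr_nu hw)
  obtain ⟨t, ht⟩ := ellS_interior hw
  refine ⟨t, mem_interior.2 ⟨{x | ∀ p, 0 < ellS n w p x}, ?_, ?_, ht⟩⟩
  · rw [stringCone_eq hw]; exact fun x hx p => (hx p).le
  · have hc : ∀ p, Continuous (ellS n w p) := by
      rintro ⟨⟨k, l⟩, hp⟩
      unfold ellS; dsimp only
      have : ∀ (l : List ℕ) (k : ℕ), Continuous (fun t => wsum (tauOf n w t) k l) := by
        intro l
        induction l with
        | nil => intro k; exact continuous_const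
        | cons q l ih =>
          intro k
          simp only [wsum]
          have he : ∀ a b, Continuous (fun t => tauOf n w t a b) := by
            intro a b; unfold tauOf entry; split_ifs <;> fun_prop
          refine Continuous.add ?_ (ih q)
          split_ifs
          · exact he _ _
          · exact (he _ _).neg
      exact this l k
    rw [Set.setOf_forall]
    exact isOpen_iInter_of_finite (fun p => isOpen_lt continuous_const (hc p))


/-! ### Single-peak paths and the simplicial case -/

def pl : ℕ → List ℕ → List (ℕ × ℕ)
  | _, [] => []
  | r, q :: l => if r < q then (r, q) :: pl q l else pl q l

theorem exists_min_above (f : ℕ → ℕ) (P : ℕ → Prop) (c y0 : ℕ) (h0 : P y0) (hc : c < f y0) :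
    ∃ y, P y ∧ c < f y ∧ ∀ z, P z → c < f z → f y ≤ f z := by
  have hex : ∃ v, ∃ y, P y ∧ c < f y ∧ f y = v := ⟨_, y0, h0, hc, rfl⟩
  obtain ⟨y, h1, h2, h3⟩ := Nat.find_spec hex
  refine ⟨y, h1, h2, fun z hz hz' => ?_⟩
  rw [h3]
  exact Nat.find_min' hex ⟨z, hz, hz', rfl⟩

theorem down_path {n k : ℕ} {ν : ℕ → ℕ → ℕ} (hA : Arr n ν) (x : ℕ) : ∀ p, k + 1 ≤ x → x ≤ n + 1 →
    (x = k + 1 ∨ ν p x < ν x (k + 1)) → ∃ l, WT n ν k p x l ∧ pl x l = [] := by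
  induction x using Nat.strong_induction_on with
  | _ x ih =>
    intro p hx hx' hc
    by_cases hxk : x = k + 1
    · exact ⟨[], hxk, rfl⟩
    have hc' : ν p x < ν x (k + 1) := hc.resolve_left hxk
    obtain ⟨y, ⟨hy1, hy2⟩, hy3, hy4⟩ := exists_min_above (fun y => ν x y)
      (fun y => k + 1 ≤ y ∧ y < x) (ν p x) (k + 1) ⟨le_rfl, by omega⟩ hc'
    have hnext : y = k + 1 ∨ ν x y < ν y (k + 1) := by
      by_cases hyk : y = k + 1
      · exact Or.inl hyk
      · right
        have h1 := hy4 (k + 1) ⟨le_rfl, by omega⟩ hc'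
        have h2 := hA.betw (k + 1) y x (by omega) (by omega) hy2 hx'
        rw [hA.symm (k + 1) y, hA.symm (k + 1) x, hA.symm y x] at h2
        omega
    obtain ⟨l, hl, hpl⟩ := ih y hy2 x hy1 (by omega) hnext
    refine ⟨y :: l, ⟨by omega, by omega, by omega, ?_, ?_, hl⟩, ?_⟩
    · unfold Bef; rw [if_neg (by omega)]; exact hy3
    · intro z hz hz' hzx hb1 hb2 hf
      unfold Bef at hb1 hb2
      rw [if_neg (by omega)] at hb1 hb2
      unfold Forb at hf
      have := hy4 z (by omega) hb1
      omega
    · simp only [pl]; rw [if_neg (by omega)]; exact hpl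

theorem up_path {n k : ℕ} {ν : ℕ → ℕ → ℕ} (hA : Arr n ν) (hk : k ≤ n) (d : ℕ) :
    ∀ x q l, 1 ≤ x → x ≤ k → k - x = d → 1 ≤ q → q ≤ n + 1 → q ≠ x → WT n ν k x q l →
      (x = k ∨ ν x q < ν x k) → ∃ L, WP n ν k L ∧ pl k L = pl x (q :: l) := by
  induction d using Nat.strong_induction_on with
  | _ d ih =>
    intro x q l hx hx' hd hq hq' hqx hl hc
    by_cases hxk : x = k
    · subst hxk
      exact ⟨q :: l, ⟨hx, hk, hq, hq', hqx, hl⟩, rfl⟩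
    have hc' := hc.resolve_left hxk
    obtain ⟨y, ⟨hy1, hy2⟩, hy3, hy4⟩ := exists_min_above (fun y => ν x y)
      (fun y => x < y ∧ y ≤ k) (ν x q) k ⟨by omega, le_rfl⟩ hc'
    have hnext : y = k ∨ ν y x < ν y k := by
      by_cases hyk : y = k
      · exact Or.inl hyk
      · right
        have h1 := hy4 k ⟨by omega, le_rfl⟩ hc'
        have h2 := hA.betw x y k hx hy1 (by omega) (by omega)
        rw [hA.symm y x]
        omega
    have hwt : WT n ν k y x (q :: l) := by
      refine ⟨hq, hq', hqx, ?_, ?_, hl⟩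
      · unfold Bef; rw [if_pos hx', hA.symm y x]; exact hy3
      · intro z hz hz' hzx hb1 hb2 hf
        unfold Bef at hb1 hb2
        rw [if_pos hx'] at hb1 hb2
        rw [hA.symm y x] at hb1
        unfold Forb at hf
        have := hy4 z (by omega) hb2
        omega
    obtain ⟨L, h1, h2⟩ := ih (k - y) (by omega) y x (q :: l) (by omega) hy2 rfl hx (by omega)
      (by omega) hwt hnext
    refine ⟨L, h1, ?_⟩
    rw [h2]
    conv_lhs => rw [pl]
    rw [if_neg (by omega)]

theorem peak_path {n : ℕ} {ν : ℕ → ℕ → ℕ} (hA : Arr n ν) (r s : ℕ) (hr : 1 ≤ r) (hrs : r < s)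
    (hs : s ≤ n + 1) : ∃ k L, WP n ν k L ∧ pl k L = [(r, s)] := by
  have hex : ∃ k, r ≤ k ∧ k < s ∧ (k = r ∨ ν r s < ν r k) ∧
      ∀ q, k < q → q < s → ν r q < ν r s := by
    obtain ⟨S, hS⟩ : ∃ S, S = (Finset.Ico r s).filter (fun k => k = r ∨ ν r s < ν r k) := ⟨_, rfl⟩
    have hmem : ∀ k, k ∈ S ↔ (r ≤ k ∧ k < s) ∧ (k = r ∨ ν r s < ν r k) := by
      intro k; rw [hS, Finset.mem_filter, Finset.mem_Ico]
    have hne : S.Nonempty := ⟨r, (hmem r).2 ⟨⟨le_rfl, hrs⟩, Or.inl rfl⟩⟩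
    obtain ⟨k, hk⟩ : ∃ k, k = S.max' hne := ⟨_, rfl⟩
    have h1 := (hmem k).1 (hk ▸ S.max'_mem hne)
    refine ⟨k, h1.1.1, h1.1.2, h1.2, ?_⟩
    intro q hq hq'
    by_contra hcon
    have hne2 : ν r q ≠ ν r s := fun h => by
      have := hA.inj' hr (by omega) (by omega : 1 ≤ q) (by omega) (by omega) hs (by omega)
        (by omega) h
      omega
    have h2 : q ∈ S := (hmem q).2 ⟨⟨by omega, hq'⟩, Or.inr (by omega)⟩
    have h3 := S.le_max' q h2
    rw [← hk] at h3
    omega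
  obtain ⟨k, h1, h2, h3, h4⟩ := hex
  have hd : s = k + 1 ∨ ν r s < ν s (k + 1) := by
    by_cases h : s = k + 1
    · exact Or.inl h
    · right
      have h5 := h4 (k + 1) (by omega) (by omega)
      have h6 := hA.betw r (k + 1) s hr (by omega) (by omega) hs
      rw [hA.symm s (k + 1)]
      omega
  obtain ⟨l, hl, hpl⟩ := down_path hA s r (by omega) hs hd
  obtain ⟨L, g1, g2⟩ := up_path hA (by omega : k ≤ n) (k - r) r s l hr h1 rfl (by omega) hs
    (by omega) hl (by
      rcases h3 with h | h
      · exact Or.inl h.symm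
      · exact Or.inr h)
  refine ⟨k, L, g1, ?_⟩
  rw [g2]
  simp only [pl]
  rw [if_pos hrs, hpl]

structure GoodArr (n : ℕ) (ν : ℕ → ℕ → ℕ) : Prop where
  one : ∀ k l, WP n ν k l → (pl k l).length = 1
  uniq : ∀ k l k' l', WP n ν k l → WP n ν k' l' → pl k l = pl k' l' → (k, l) = (k', l')

theorem good_of_card {n : ℕ} {ν : ℕ → ℕ → ℕ} (hA : Arr n ν) (hc : Nat.card (WPt n ν) = Dim n) :
    GoodArr n ν := by
  have hfin := wpt_finite hA
  have hch : ∀ p : pairSet n, ∃ q : WPt n ν, pl q.1.1 q.1.2 = [p.1] := by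
    rintro ⟨⟨r, s⟩, hp⟩
    rw [mem_pairSet] at hp
    obtain ⟨k, L, h1, h2⟩ := peak_path hA r s hp.1 hp.2.1 hp.2.2
    exact ⟨⟨(k, L), h1⟩, h2⟩
  choose f hf using hch
  have hinj : Function.Injective f := by
    intro p q h
    have h1 := hf p
    rw [h, hf q] at h1
    simp only [List.cons.injEq, and_true] at h1
    exact Subtype.ext h1.symm
  have hbij : Function.Bijective f := by
    have := Fintype.ofFinite (WPt n ν)
    rw [Fintype.bijective_iff_injective_and_card]
    refine ⟨hinj, ?_⟩
    rw [Fintype.card_coe, card_pairSet, ← Nat.card_eq_fintype_card, hc]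
  constructor
  · intro k l hl
    obtain ⟨p, hp⟩ := hbij.2 ⟨(k, l), hl⟩
    have := hf p
    rw [hp] at this
    dsimp only at this
    rw [this]; rfl
  · intro k l k' l' hl hl' he
    obtain ⟨p, hp⟩ := hbij.2 ⟨(k, l), hl⟩
    obtain ⟨p', hp'⟩ := hbij.2 ⟨(k', l'), hl'⟩
    have h1 := hf p
    have h2 := hf p'
    rw [hp] at h1
    rw [hp'] at h2
    dsimp only at h1 h2
    have h3 : p = p' := by
      rw [h1, h2] at he
      simp only [List.cons.injEq, and_true] at he
      exact Subtype.ext he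
    have h4 : (⟨(k, l), hl⟩ : WPt n ν) = ⟨(k', l'), hl'⟩ := by rw [← hp, ← hp', h3]
    exact congrArg Subtype.val h4

def TD (ν : ℕ → ℕ → ℕ) (r q s : ℕ) : Prop := ν r q < ν r s ∧ ν r s < ν q s
def TA (ν : ℕ → ℕ → ℕ) (r q s : ℕ) : Prop := ν q s < ν r s ∧ ν r s < ν r q

def SS (ν : ℕ → ℕ → ℕ) : ℕ → ℕ → Prop
  | _, 0 => True
  | a, m + 1 =>
    ((∀ r q, a ≤ r → r < q → q < a + m + 1 → TD ν r q (a + m + 1)) ∧ SS ν a m) ∨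
    ((∀ q s, a < q → q < s → s ≤ a + m + 1 → TA ν a q s) ∧ SS ν (a + 1) m)

theorem bef_up {k r a b : ℕ} (h : r ≤ k) : Bef k r a b ↔ b < a := by unfold Bef; rw [if_pos h]
theorem bef_dn {k r a b : ℕ} (h : k < r) : Bef k r a b ↔ a < b := by
  unfold Bef; rw [if_neg (by omega)]

/-- path `p → b → a → p+1`. -/
theorem bad_bd {n : ℕ} {ν : ℕ → ℕ → ℕ} (hA : Arr n ν) (hG : GoodArr n ν) {a b p : ℕ} (ha : 1 ≤ a)
    (hb : b ≤ n + 1) (hap : a < p) (hpb : p + 1 < b)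
    (h1 : ∀ q, a < q → q ≤ p → TA ν a q b) (h2 : ∀ q, p < q → q < b → TD ν a q b) : False := by
  have hwp : WP n ν p [b, a, p + 1] := by
    refine ⟨by omega, by omega, by omega, hb, by omega, by omega, by omega, by omega, ?_, ?_,
      by omega, by omega, by omega, ?_, ?_, rfl⟩
    · rw [bef_dn (by omega), hA.symm b a]
      exact (h1 p hap le_rfl).1
    · intro x hx hx' hxb e1 e2 hf
      rw [bef_dn (by omega)] at e1 e2
      unfold Forb at hf
      have := h2 x (by omega) (by omega)
      unfold TD at this
      rw [hA.symm b x, hA.symm b a] at e2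
      omega
    · rw [bef_up (by omega), hA.symm b a]
      exact (h2 (p + 1) (by omega) (by omega)).1
    · intro x hx hx' hxb e1 e2 hf
      rw [bef_up (by omega)] at e1 e2
      unfold Forb at hf
      have := h1 x (by omega) (by omega)
      unfold TA at this
      rw [hA.symm b a] at e1
      omega
  have := hG.one _ _ hwp
  simp only [pl] at this
  rw [if_pos (by omega), if_neg (by omega), if_pos (by omega)] at this
  simp at this

theorem bad_ac {n : ℕ} {ν : ℕ → ℕ → ℕ} (hA : Arr n ν) (hG : GoodArr n ν) {a : ℕ} (ha : 1 ≤ a)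
    (hb : a + 3 ≤ n + 1) (h1 : TD ν a (a + 1) (a + 2)) (h2 : TA ν (a + 1) (a + 2) (a + 3)) :
    False := by
  have b1 := hA.betw a (a + 1) (a + 3) ha (by omega) (by omega) hb
  have b2 := hA.betw a (a + 2) (a + 3) ha (by omega) (by omega) hb
  unfold TD at h1
  unfold TA at h2
  have e12 := hA.symm (a + 1) a
  have e13 := hA.symm (a + 2) a
  have e14 := hA.symm (a + 3) a
  have e23 := hA.symm (a + 2) (a + 1)
  have e24 := hA.symm (a + 3) (a + 1)
  have e34 := hA.symm (a + 3) (a + 2)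
  rcases b2 with b2 | b2
  · rcases b1 with b1 | b1
    · have hwp : WP n ν a [a + 2, a + 3, a + 1] := by
        refine ⟨by omega, by omega, by omega, by omega, by omega, by omega, by omega, by omega,
          ?_, ?_, by omega, by omega, by omega, ?_, ?_, rfl⟩
        · rw [bef_dn (by omega)]; omega
        · intro x hx hx' hxb e1 e2 hf
          rw [bef_dn (by omega)] at e1 e2
          unfold Forb at hf
          obtain rfl : x = a + 1 := by omega
          omega
        · rw [bef_dn (by omega)]; omega
        · intro x hx hx' hxb e1 e2 hf
          rw [bef_dn (by omega)] at e1 e2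
          unfold Forb at hf
          obtain rfl | rfl : x = a + 1 ∨ x = a + 2 := by omega
          · omega
          · omega
      have := hG.one _ _ hwp
      simp only [pl] at this
      rw [if_pos (by omega), if_pos (by omega), if_neg (by omega)] at this
      simp at this
    · omega
  · rcases b1 with b1 | b1
    · have hw1 : WP n ν (a + 2) [a, a + 3] := by
        refine ⟨by omega, by omega, by omega, by omega, by omega, by omega, by omega, by omega,
          ?_, ?_, rfl⟩
        · rw [bef_up (by omega)]; omega
        · intro x hx hx' hxb e1 e2 hf
          rw [bef_up (by omega)] at e1 e2
          unfold Forb at hf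
          obtain rfl | rfl : x = a + 1 ∨ x = a + 2 := by omega
          · omega
          · omega
      have hw2 : WP n ν a [a + 3, a + 1] := by
        refine ⟨by omega, by omega, by omega, by omega, by omega, by omega, by omega, by omega,
          ?_, ?_, rfl⟩
        · rw [bef_dn (by omega)]; omega
        · intro x hx hx' hxb e1 e2 hf
          rw [bef_dn (by omega)] at e1 e2
          unfold Forb at hf
          obtain rfl | rfl : x = a + 1 ∨ x = a + 2 := by omega
          · omega
          · omega
      have := hG.uniq _ _ _ _ hw1 hw2 (by
        simp only [pl]
        rw [if_neg (by omega), if_pos (by omega), if_pos (by omega), if_neg (by omega)])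
      simp at this
    · have hwp : WP n ν (a + 2) [a, a + 1, a + 3] := by
        refine ⟨by omega, by omega, by omega, by omega, by omega, by omega, by omega, by omega,
          ?_, ?_, by omega, by omega, by omega, ?_, ?_, rfl⟩
        · rw [bef_up (by omega)]; omega
        · intro x hx hx' hxb e1 e2 hf
          rw [bef_up (by omega)] at e1 e2
          unfold Forb at hf
          obtain rfl | rfl : x = a + 1 ∨ x = a + 2 := by omega
          · omega
          · omega
        · rw [bef_up (by omega)]; omega
        · intro x hx hx' hxb e1 e2 hf
          rw [bef_up (by omega)] at e1 e2
          unfold Forb at hf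
          obtain rfl : x = a + 2 := by omega
          omega
      have := hG.one _ _ hwp
      simp only [pl] at this
      rw [if_neg (by omega), if_pos (by omega), if_pos (by omega)] at this
      simp at this

theorem good_ss {n : ℕ} {ν : ℕ → ℕ → ℕ} (hA : Arr n ν) (hG : GoodArr n ν) (m : ℕ) :
    ∀ a, 1 ≤ a → a + m ≤ n + 1 → SS ν a m := by
  induction m with
  | zero => intro a _ _; trivial
  | succ m ih =>
    intro a ha ham
    have s1 := ih a ha (by omega)
    have s2 := ih (a + 1) (by omega) (by omega)
    by_cases hm0 : m = 0
    · left
      exact ⟨fun r q h1 h2 h3 => by omega, s1⟩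
    by_cases hm1 : m = 1
    · have b1 := hA.betw a (a + 1) (a + 2) ha (by omega) (by omega) (by omega)
      have e : a + m + 1 = a + 2 := by omega
      rw [SS, e]
      rcases b1 with b1 | b1
      · left
        refine ⟨fun r q h1 h2 h3 => ?_, s1⟩
        rw [show r = a by omega, show q = a + 1 by omega]
        exact b1
      · right
        refine ⟨fun q s h1 h2 h3 => ?_, s2⟩
        rw [show q = a + 1 by omega, show s = a + 2 by omega]
        exact b1
    obtain ⟨m, rfl⟩ : ∃ m', m = m' + 1 := ⟨m - 1, by omega⟩
    set b := a + (m + 1) + 1 with hb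
    have s1c := s1
    have s2c := s2
    have e2 : a + 1 + m + 1 = b := by omega
    have e1 : a + m + 1 = b - 1 := by omega
    rw [SS, e1] at s1
    rw [SS, e2] at s2
    have hbet := fun q (h1 : a < q) (h2 : q < b) => hA.betw a q b ha h1 h2 (by omega)
    rcases s1 with ⟨sa, -⟩ | ⟨sb, -⟩
    · rcases s2 with ⟨sd, -⟩ | ⟨sc, -⟩
      · left
        refine ⟨fun r q h1 h2 h3 => ?_, s1c⟩
        by_cases hra : r = a
        · subst hra
          rcases hbet q h2 h3 with h4 | h4
          · exact h4
          · exfalso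
            by_cases hq : q = b - 1
            · have c1 := sa r (r + 1) le_rfl (by omega) (by omega)
              have c2 := sd (r + 1) (b - 1) (by omega) (by omega) (by omega)
              unfold TD at c1 c2
              rw [hq] at h4
              omega
            · have c1 := sa r q le_rfl (by omega) (by omega)
              have c2 := sd q (b - 1) (by omega) (by omega) (by omega)
              unfold TD at c1 c2
              omega
        · exact sd r q (by omega) h2 h3
      · exfalso
        by_cases hm2 : m = 1
        · subst hm2
          have c1 := sa a (a + 1) le_rfl (by omega) (by omega)
          have c2 := sc (a + 2) (a + 3) (by omega) (by omega) (by omega)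
          rw [show b - 1 = a + 2 by omega] at c1
          exact bad_ac hA hG ha (by omega) c1 c2
        · have c1 := sa (a + 1) (a + 2) (by omega) (by omega) (by omega)
          have c2 := sc (a + 2) (b - 1) (by omega) (by omega) (by omega)
          unfold TD at c1
          unfold TA at c2
          omega
    · rcases s2 with ⟨sd, -⟩ | ⟨sc, -⟩
      · by_cases hall : ∀ q, a < q → q < b → TA ν a q b
        · right
          refine ⟨fun q s h1 h2 h3 => ?_, s2c⟩
          by_cases hs : s = b
          · rw [hs]; exact hall q h1 (by omega)
          · exact sb q s h1 h2 (by omega)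
        · by_cases hall2 : TD ν a (a + 1) b
          · left
            refine ⟨fun r q h1 h2 h3 => ?_, s1c⟩
            by_cases hra : r = a
            · rw [hra] at h2 ⊢
              by_cases hq : q = a + 1
              · rw [hq]; exact hall2
              · have c1 := sb (a + 1) q (by omega) (by omega) (by omega)
                rcases hbet q h2 h3 with c2 | c2
                · exact c2
                · exfalso
                  unfold TA at c1
                  unfold TD at hall2
                  omega
            · exact sd r q (by omega) h2 h3
          · exfalso
            have hex : ∃ q, a < q ∧ q < b ∧ ¬ TA ν a q b := by
              push Not at hall; exact hall
            obtain ⟨g1, g2, g3⟩ := Nat.find_spec hex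
            have hmin := fun q (hq : q < Nat.find hex) => Nat.find_min hex hq
            set f := Nat.find hex
            have hTDf : TD ν a f b := by
              rcases hbet f g1 g2 with h | h
              · exact h
              · exact absurd h g3
            have hf1 : f ≠ a + 1 := fun h => hall2 (h ▸ hTDf)
            refine bad_bd hA hG (a := a) (b := b) (p := f - 1) ha (by omega) (by omega) (by omega)
              ?_ ?_
            · intro q h1 h2
              by_contra hcon
              exact hmin q (by omega) ⟨h1, by omega, hcon⟩
            · intro q h1 h2
              by_cases hq : q = f
              · rw [hq]; exact hTDf
              · have c1 := sb f q (by omega) (by omega) (by omega)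
                have c2 := hbet q (by omega) h2
                unfold TA at c1
                unfold TD at hTDf ⊢
                omega
      · right
        refine ⟨fun q s h1 h2 h3 => ?_, s2c⟩
        by_cases hs : s = b
        · subst hs
          rcases hbet q h1 h2 with h4 | h4
          · exfalso
            by_cases hq : q = a + 1
            · have c1 := sb (a + 1) (a + 2) (by omega) (by omega) (by omega)
              have c2 := sc (a + 2) b (by omega) (by omega) (by omega)
              unfold TA at c1 c2
              rw [hq] at h4
              omega
            · have c1 := sb (a + 1) q (by omega) (by omega) (by omega)
              have c2 := sc q b (by omega) (by omega) (by omega)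
              unfold TA at c1 c2
              omega
          · exact h4
        · exact sb q s h1 h2 (by omega)


/-! ### Two-moves -/

theorem letter_pre (u v : List ℕ) (m : ℕ) (h : m < u.length) :
    letterAt (u ++ v) (m + 1) = letterAt u (m + 1) := by
  unfold letterAt
  simp only [Nat.add_sub_cancel, List.getD_eq_getElem?_getD]
  rw [List.getElem?_append_left h]

theorem letter_suf (u v : List ℕ) (m : ℕ) (h : u.length ≤ m) :
    letterAt (u ++ v) (m + 1) = letterAt v (m - u.length + 1) := by
  unfold letterAt
  simp only [Nat.add_sub_cancel, List.getD_eq_getElem?_getD]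
  rw [List.getElem?_append_right h]

theorem take_pre (u v : List ℕ) (m : ℕ) (h : m ≤ u.length) : (u ++ v).take m = u.take m :=
  List.take_append_of_le_length h

theorem sTrans_comm {a b : ℕ} (h : a + 1 < b ∨ b + 1 < a) :
    sTrans a * sTrans b = sTrans b * sTrans a := by
  unfold sTrans
  ext x
  simp only [Equiv.Perm.mul_apply, Equiv.swap_apply_def]
  split_ifs <;> omega

theorem wordProd_cons (a : ℕ) (l : List ℕ) : wordProd (a :: l) = sTrans a * wordProd l := by
  simp [wordProd]

structure MoveData (w w' : List ℕ) (j : ℕ) : Prop where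
  hj : j + 1 < w.length
  len : w'.length = w.length
  far : letterAt w (j + 1) + 1 < letterAt w (j + 2) ∨ letterAt w (j + 2) + 1 < letterAt w (j + 1)
  letter : ∀ m, letterAt w' (m + 1) = letterAt w (Equiv.swap j (j + 1) m + 1)
  wX : ∀ m, wireX w' (m + 1) = wireX w (Equiv.swap j (j + 1) m + 1)
  wY : ∀ m, wireY w' (m + 1) = wireY w (Equiv.swap j (j + 1) m + 1)

theorem move_data {w w' : List ℕ} (h : TwoMoveStep w w') : ∃ j, MoveData w w' j := by
  obtain ⟨p, q, a, b, hab, rfl, rfl⟩ := h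
  have hA : letterAt (p ++ a :: b :: q) (p.length + 1) = a := by
    rw [letter_suf _ _ _ le_rfl]; simp [letterAt]
  have hB : letterAt (p ++ a :: b :: q) (p.length + 1 + 1) = b := by
    rw [letter_suf _ _ _ (by omega)]; simp [letterAt]
  have hA' : letterAt (p ++ b :: a :: q) (p.length + 1) = b := by
    rw [letter_suf _ _ _ le_rfl]; simp [letterAt]
  have hB' : letterAt (p ++ b :: a :: q) (p.length + 1 + 1) = a := by
    rw [letter_suf _ _ _ (by omega)]; simp [letterAt]
  have hother : ∀ m, m ≠ p.length → m ≠ p.length + 1 →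
      letterAt (p ++ b :: a :: q) (m + 1) = letterAt (p ++ a :: b :: q) (m + 1) := by
    intro m h1 h2
    rcases Nat.lt_or_ge m p.length with h | h
    · rw [letter_pre _ _ _ h, letter_pre _ _ _ h]
    · rw [letter_suf _ _ _ h, letter_suf _ _ _ h]
      obtain ⟨d, hd⟩ : ∃ d, m - p.length = d + 2 := ⟨m - p.length - 2, by omega⟩
      rw [hd]; simp [letterAt]
  have hprod : ∀ m, m ≠ p.length + 1 → wordProd ((p ++ b :: a :: q).take m) =
      wordProd ((p ++ a :: b :: q).take m) := by
    intro m h1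
    rcases Nat.lt_or_ge p.length m with h | h
    · obtain ⟨d, rfl⟩ : ∃ d, m = p.length + (d + 2) := ⟨m - p.length - 2, by omega⟩
      rw [List.take_length_add_append, List.take_length_add_append]
      simp only [List.take_succ_cons, wordProd_append, wordProd_cons]
      rw [← mul_assoc (sTrans b), ← mul_assoc (sTrans a), sTrans_comm hab]
    · rw [take_pre _ _ _ h, take_pre _ _ _ h]
  have hP : wordProd ((p ++ a :: b :: q).take p.length) = wordProd p := by
    rw [take_pre _ _ _ le_rfl, List.take_length]
  have hP1 : wordProd ((p ++ a :: b :: q).take (p.length + 1)) = wordProd p * sTrans a := by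
    rw [List.take_length_add_append]
    simp [wordProd]
  have hP1' : wordProd ((p ++ b :: a :: q).take (p.length + 1)) = wordProd p * sTrans b := by
    rw [List.take_length_add_append]
    simp [wordProd]
  have hsw : ∀ c d x, (c + 1 < d ∨ d + 1 < c) → (x = d ∨ x = d + 1) → sTrans c x = x := by
    intro c d x h1 h2
    unfold sTrans
    rw [Equiv.swap_apply_of_ne_of_ne] <;> omega
  refine ⟨p.length, ⟨by simp, by simp, ?_, ?_, ?_, ?_⟩⟩
  · rw [hA, show p.length + 2 = p.length + 1 + 1 from rfl, hB]; exact hab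
  · intro m
    by_cases h1 : m = p.length
    · rw [h1, Equiv.swap_apply_left, hA', hB]
    by_cases h2 : m = p.length + 1
    · rw [h2, Equiv.swap_apply_right, hA, hB']
    rw [Equiv.swap_apply_of_ne_of_ne h1 h2, hother m h1 h2]
  · intro m
    unfold wireX stateAbove
    simp only [Nat.add_sub_cancel]
    by_cases h1 : m = p.length
    · rw [h1, Equiv.swap_apply_left, hA', hB, hP1, hprod _ (by omega), hP, Equiv.Perm.mul_apply,
        hsw a b b hab (Or.inl rfl)]
    by_cases h2 : m = p.length + 1
    · rw [h2, Equiv.swap_apply_right, hA, hB', hP1', hP, Equiv.Perm.mul_apply,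
        hsw b a a hab.symm (Or.inl rfl)]
    rw [Equiv.swap_apply_of_ne_of_ne h1 h2, hother m h1 h2, hprod m h2]
  · intro m
    unfold wireY stateAbove
    simp only [Nat.add_sub_cancel]
    by_cases h1 : m = p.length
    · rw [h1, Equiv.swap_apply_left, hA', hB, hP1, hprod _ (by omega), hP, Equiv.Perm.mul_apply,
        hsw a b (b + 1) hab (Or.inr rfl)]
    by_cases h2 : m = p.length + 1
    · rw [h2, Equiv.swap_apply_right, hA, hB', hP1', hP, Equiv.Perm.mul_apply,
        hsw b a (a + 1) hab.symm (Or.inr rfl)]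
    rw [Equiv.swap_apply_of_ne_of_ne h1 h2, hother m h1 h2, hprod m h2]

theorem step_reduced {n : ℕ} {w w' : List ℕ} (hw : IsReduced n w) (h : TwoMoveStep w w') :
    IsReduced n w' := by
  obtain ⟨p, q, a, b, hab, rfl, rfl⟩ := h
  obtain ⟨h1, h2, h3⟩ := hw
  refine ⟨by simpa using h1, ?_, ?_⟩
  · intro x hx
    apply h2
    simp only [List.mem_append, List.mem_cons] at hx ⊢
    tauto
  · rw [← h3]
    simp only [wordProd_append, wordProd_cons]
    rw [← mul_assoc (sTrans b), ← mul_assoc (sTrans a), sTrans_comm hab]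

theorem step_symm {w w' : List ℕ} (h : TwoMoveStep w w') : TwoMoveStep w' w := by
  obtain ⟨p, q, a, b, hab, rfl, rfl⟩ := h
  exact ⟨p, q, b, a, hab.symm, rfl, rfl⟩

theorem move_nu {n : ℕ} {w w' : List ℕ} (hw : IsReduced n w) (hw' : IsReduced n w') {j : ℕ}
    (h : MoveData w w' j) {r s : ℕ} (hr : 1 ≤ r) (hrs : r < s) (hs : s ≤ n + 1) :
    nu w' r s = Equiv.swap j (j + 1) (nu w r s - 1) + 1 := by
  obtain ⟨⟨v1, v2⟩, hX, hY⟩ := nu_spec hw hr hrs hs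
  have hj := h.hj
  have hlen := h.len
  apply nu_eq hw'
  · constructor
    · omega
    · rw [Equiv.swap_apply_def]; split_ifs <;> omega
  · rw [h.wX, Equiv.swap_apply_self, Nat.sub_add_cancel v1, hX]
  · rw [h.wY, Equiv.swap_apply_self, Nat.sub_add_cancel v1, hY]

def SameOrd (n : ℕ) (ν ν' : ℕ → ℕ → ℕ) : Prop :=
  ∀ r s q, 1 ≤ r → r ≤ n + 1 → 1 ≤ s → s ≤ n + 1 → 1 ≤ q → q ≤ n + 1 → r ≠ s → r ≠ q →
    (ν r s < ν r q ↔ ν' r s < ν' r q)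

theorem node_disj {n : ℕ} {w : List ℕ} (hw : IsReduced n w) {j : ℕ} (hj : j + 1 < w.length)
    (far : letterAt w (j + 1) + 1 < letterAt w (j + 2) ∨ letterAt w (j + 2) + 1 < letterAt w (j + 1))
    {r s q : ℕ} (hr : 1 ≤ r) (hr' : r ≤ n + 1) (hs : 1 ≤ s) (hs' : s ≤ n + 1) (hq : 1 ≤ q)
    (hq' : q ≤ n + 1) (hrs : r ≠ s) (hrq : r ≠ q) (h1 : nu w r s = j + 1) (h2 : nu w r q = j + 2) :
    False := by
  have key : ∀ s, 1 ≤ s → s ≤ n + 1 → r ≠ s → ∀ k, nu w r s = k + 1 →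
      pos w k r = letterAt w (k + 1) ∨ pos w k r = letterAt w (k + 1) + 1 := by
    intro s hs hs' hrs k hk
    rcases Nat.lt_or_ge r s with h | h
    · obtain ⟨_, hX, _⟩ := nu_spec hw hr h hs'
      rw [hk] at hX
      exact Or.inl ((wireX_iff w k r).1 hX)
    · obtain ⟨_, _, hX⟩ := nu_spec hw hs (by omega : s < r) hr'
      rw [nu_symm, hk] at hX
      exact Or.inr ((wireY_iff w k r).1 hX)
  have k1 := key s hs hs' hrs j h1
  have k2 := key q hq hq' hrq (j + 1) h2
  rw [pos_succ w j r (by omega)] at k2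
  rw [show j + 1 + 1 = j + 2 from rfl] at k2
  rw [Equiv.swap_apply_def] at k2
  split_ifs at k2 <;> omega

theorem step_sameOrd {n : ℕ} {w w' : List ℕ} (hw : IsReduced n w) (h : TwoMoveStep w w') :
    SameOrd n (nu w) (nu w') := by
  have hw' := step_reduced hw h
  obtain ⟨j, hj⟩ := move_data h
  intro r s q hr hr' hs hs' hq hq' hrs hrq
  have hA := arr_nu hw
  have key : ∀ s, 1 ≤ s → s ≤ n + 1 → r ≠ s →
      nu w' r s = Equiv.swap j (j + 1) (nu w r s - 1) + 1 := by
    intro s hs hs' hrs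
    rcases Nat.lt_or_ge r s with h | h
    · exact move_nu hw hw' hj hr h hs'
    · rw [nu_symm, nu_symm w]; exact move_nu hw hw' hj hs (by omega) hr'
  rw [key s hs hs' hrs, key q hq hq' hrq]
  have d1 := node_disj hw hj.hj hj.far hr hr' hs hs' hq hq' hrs hrq
  have d2 := node_disj hw hj.hj hj.far hr hr' hq hq' hs hs' hrq hrs
  have r1 := hA.rng' hr hr' hs hs' hrs.symm
  have r2 := hA.rng' hr hr' hq hq' hrq.symm
  have e1 : ¬ (nu w r s = j + 1 ∧ nu w r q = j + 2) := fun h => d1 h.1 h.2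
  have e2 : ¬ (nu w r q = j + 1 ∧ nu w r s = j + 2) := fun h => d2 h.1 h.2
  simp only [Equiv.swap_apply_def]
  split_ifs <;> omega

theorem equiv_reduced {n : ℕ} {w w' : List ℕ} (hw : IsReduced n w) (h : TwoMoveEquiv w w') :
    IsReduced n w' := by
  induction h with
  | refl => exact hw
  | tail _ h2 ih => exact step_reduced ih h2

theorem equiv_sameOrd {n : ℕ} {w w' : List ℕ} (hw : IsReduced n w) (h : TwoMoveEquiv w w') :
    SameOrd n (nu w) (nu w') := by
  induction h with
  | refl => intro r s q _ _ _ _ _ _ _ _; exact Iff.rfl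
  | tail h1 h2 ih =>
    have := step_sameOrd (equiv_reduced hw h1) h2
    intro r s q a1 a2 a3 a4 a5 a6 a7 a8
    rw [ih r s q a1 a2 a3 a4 a5 a6 a7 a8, this r s q a1 a2 a3 a4 a5 a6 a7 a8]

theorem equiv_symm {w w' : List ℕ} (h : TwoMoveEquiv w w') : TwoMoveEquiv w' w := by
  induction h with
  | refl => exact Relation.ReflTransGen.refl
  | tail _ h2 ih => exact Relation.ReflTransGen.head (step_symm h2) ih

theorem equiv_append {w w' : List ℕ} (h : TwoMoveEquiv w w') (v : List ℕ) :
    TwoMoveEquiv (w ++ v) (w' ++ v) := by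
  induction h with
  | refl => exact Relation.ReflTransGen.refl
  | tail _ h2 ih =>
    refine Relation.ReflTransGen.tail ih ?_
    obtain ⟨p, q, a, b, hab, rfl, rfl⟩ := h2
    exact ⟨p, q ++ v, a, b, hab, by simp, by simp⟩

theorem equiv_push (c : ℕ) (l : List ℕ) : ∀ u, (∀ x ∈ l, x + 1 < c ∨ c + 1 < x) →
    TwoMoveEquiv (u ++ l ++ [c]) (u ++ [c] ++ l) := by
  induction l with
  | nil => intro u _; simp; exact Relation.ReflTransGen.refl
  | cons x l ih =>
    intro u h
    have h1 := ih (u ++ [x]) (fun y hy => h y (by simp [hy]))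
    have h2 : TwoMoveStep (u ++ [x] ++ [c] ++ l) (u ++ [c] ++ (x :: l)) :=
      ⟨u, l, x, c, h x (by simp), by simp, by simp⟩
    have h3 := Relation.ReflTransGen.tail h1 h2
    simpa [TwoMoveEquiv] using h3

theorem same_ss {n : ℕ} {ν ν' : ℕ → ℕ → ℕ} (hA : Arr n ν) (hA' : Arr n ν') (h : SameOrd n ν ν')
    (m : ℕ) : ∀ a, 1 ≤ a → a + m ≤ n + 1 → SS ν a m → SS ν' a m := by
  induction m with
  | zero => intro a _ _ _; trivial
  | succ m ih =>
    intro a ha ham hs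
    rcases hs with ⟨h1, h2⟩ | ⟨h1, h2⟩
    · refine Or.inl ⟨fun r q g1 g2 g3 => ?_, ih a ha (by omega) h2⟩
      obtain ⟨e1, e2⟩ := h1 r q g1 g2 g3
      have f1 := h r q (a + m + 1) (by omega) (by omega) (by omega) (by omega) (by omega)
        (by omega) (by omega) (by omega)
      have f2 := h (a + m + 1) r q (by omega) (by omega) (by omega) (by omega) (by omega)
        (by omega) (by omega) (by omega)
      rw [hA.symm _ r, hA.symm _ q, hA'.symm _ r, hA'.symm _ q] at f2
      exact ⟨f1.1 e1, f2.1 e2⟩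
    · refine Or.inr ⟨fun q s g1 g2 g3 => ?_, ih (a + 1) (by omega) (by omega) h2⟩
      obtain ⟨e1, e2⟩ := h1 q s g1 g2 g3
      have f1 := h a s q (by omega) (by omega) (by omega) (by omega) (by omega)
        (by omega) (by omega) (by omega)
      have f2 := h s q a (by omega) (by omega) (by omega) (by omega) (by omega)
        (by omega) (by omega) (by omega)
      rw [hA.symm s q, hA.symm s a, hA'.symm s q, hA'.symm s a] at f2
      exact ⟨f2.1 e1, f1.1 e2⟩


/-! ### Descending and ascending blocks -/

def dw (m : ℕ) : ℕ → List ℕ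
  | 0 => []
  | k + 1 => (m + k + 1) :: dw m k

theorem dw_len (m k : ℕ) : (dw m k).length = k := by
  induction k with
  | zero => rfl
  | succ k ih => simp [dw, ih]

theorem dw_snoc (m k : ℕ) : dw (m + 1) k ++ [m + 1] = dw m (k + 1) := by
  induction k with
  | zero => rfl
  | succ k ih =>
    rw [dw, dw, List.cons_append, ih]
    congr 1
    omega

theorem dw_split (m i : ℕ) : dw 0 (m + i) = dw m i ++ dw 0 m := by
  induction i with
  | zero => rfl
  | succ i ih =>
    rw [← Nat.add_assoc, dw, dw, ih, List.cons_append]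
    congr 1
    omega

theorem mem_dw {m k x : ℕ} (h : x ∈ dw m k) : m + 1 ≤ x ∧ x ≤ m + k := by
  induction k with
  | zero => simp [dw] at h
  | succ k ih =>
    simp only [dw, List.mem_cons] at h
    rcases h with h | h
    · omega
    · have := ih h; omega

theorem asc_succ (n : ℕ) : ascWord (n + 1) = ascWord n ++ [n + 1] := by
  simp [ascWord, List.range_succ]

theorem desc_eq (n : ℕ) : descWord n = dw 0 n := by
  induction n with
  | zero => rfl
  | succ n ih =>
    unfold descWord at ih ⊢
    rw [asc_succ, List.reverse_append, ih]
    simp [dw]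

theorem asc_len (n : ℕ) : (ascWord n).length = n := by simp [ascWord]

theorem mem_asc {n x : ℕ} (h : x ∈ ascWord n) : 1 ≤ x ∧ x ≤ n := by
  simp only [ascWord, List.mem_map, List.mem_range] at h
  obtain ⟨a, h1, h2⟩ := h
  omega

theorem asc_split (i m : ℕ) : ∃ q, ascWord (i + (m + 1)) = ascWord i ++ (i + 1) :: q := by
  induction m with
  | zero => exact ⟨[], by rw [asc_succ]⟩
  | succ m ih =>
    obtain ⟨q, hq⟩ := ih
    exact ⟨q ++ [i + (m + 1) + 1], by rw [← Nat.add_assoc, asc_succ, hq]; simp⟩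

theorem dw_prod (m k x : ℕ) : wordProd (dw m k) x =
    if x = m + 1 then m + k + 1 else if m + 2 ≤ x ∧ x ≤ m + k + 1 then x - 1 else x := by
  induction k with
  | zero => simp only [dw, wordProd, List.map_nil, List.prod_nil, Equiv.Perm.one_apply]
            split_ifs <;> omega
  | succ k ih =>
    rw [dw, wordProd_cons, Equiv.Perm.mul_apply, ih, sTrans, Equiv.swap_apply_def]
    split_ifs <;> omega

theorem asc_prod (k x : ℕ) : wordProd (ascWord k) x =
    if x = k + 1 then 1 else if 1 ≤ x ∧ x ≤ k then x + 1 else x := by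
  induction k generalizing x with
  | zero => simp only [ascWord, wordProd, List.range_zero, List.map_nil, List.prod_nil,
              Equiv.Perm.one_apply]
            split_ifs <;> omega
  | succ k ih =>
    rw [asc_succ, wordProd_append, wordProd_singleton, Equiv.Perm.mul_apply, ih, sTrans,
      Equiv.swap_apply_def]
    split_ifs <;> omega

theorem wordProd_fix (w : List ℕ) (x : ℕ) (h : ∀ a ∈ w, a ≠ x ∧ a + 1 ≠ x) : wordProd w x = x := by
  induction w with
  | nil => rfl
  | cons a w ih =>
    rw [wordProd_cons, Equiv.Perm.mul_apply, ih (fun b hb => h b (by simp [hb])), sTrans]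
    have := h a (by simp)
    exact Equiv.swap_apply_of_ne_of_ne this.1.symm this.2.symm

theorem wordProd_shift (w : List ℕ) (x : ℕ) :
    wordProd (w.map (· + 1)) (x + 1) = wordProd w x + 1 := by
  induction w generalizing x with
  | nil => rfl
  | cons a w ih =>
    rw [List.map_cons, wordProd_cons, wordProd_cons, Equiv.Perm.mul_apply, Equiv.Perm.mul_apply, ih]
    unfold sTrans
    simp only [Equiv.swap_apply_def]
    split_ifs <;> omega

theorem prod_rng {n : ℕ} {w : List ℕ} (h : ∀ a ∈ w, 1 ≤ a ∧ a ≤ n) {c r : ℕ} (hc : wordProd w c = r)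
    (hr : 1 ≤ r) (hr' : r ≤ n + 1) : 1 ≤ c ∧ c ≤ n + 1 := by
  by_contra hcon
  have : wordProd w c = c := wordProd_fix w c (fun a ha => by have := h a ha; omega)
  omega

theorem Dim_succ (n : ℕ) : Dim (n + 1) = Dim n + (n + 1) := by
  unfold Dim
  have : (n + 1) * (n + 1 + 1) = n * (n + 1) + 2 * (n + 1) := by ring
  omega

theorem redD {n : ℕ} {u : List ℕ} (h : IsReduced (n + 1) (u ++ descWord (n + 1)))
    (hu : ∀ a ∈ u, 1 ≤ a ∧ a ≤ n) : IsReduced n u := by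
  obtain ⟨h1, h2, h3⟩ := h
  refine ⟨?_, hu, ?_⟩
  · have := Dim_succ n
    unfold Dim at this
    rw [List.length_append, desc_eq, dw_len] at h1
    omega
  · ext x
    by_cases hx : 1 ≤ x ∧ x ≤ n + 1
    · have h4 := congrArg (fun f : Equiv.Perm ℕ => f (x + 1)) h3
      simp only [wordProd_append, Equiv.Perm.mul_apply, desc_eq, dw_prod, longestPerm_apply] at h4
      rw [if_neg (by omega), if_pos (by omega), if_pos (by omega)] at h4
      rw [longestPerm_apply, if_pos hx]
      simp only [Nat.add_sub_cancel] at h4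
      omega
    · rw [longestPerm_apply, if_neg hx]
      exact wordProd_fix u x (fun a ha => by have := hu a ha; omega)

theorem redA {n : ℕ} {u : List ℕ} (h : IsReduced (n + 1) (u.map (· + 1) ++ ascWord (n + 1)))
    (hu : ∀ a ∈ u, 1 ≤ a ∧ a ≤ n) : IsReduced n u := by
  obtain ⟨h1, h2, h3⟩ := h
  refine ⟨?_, hu, ?_⟩
  · have := Dim_succ n
    unfold Dim at this
    rw [List.length_append, asc_len, List.length_map] at h1
    omega
  · ext x
    by_cases hx : 1 ≤ x ∧ x ≤ n + 1
    · have h4 := congrArg (fun f : Equiv.Perm ℕ => f x) h3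
      simp only [wordProd_append, Equiv.Perm.mul_apply, asc_prod, longestPerm_apply] at h4
      rw [if_neg (by omega), if_pos (by omega), if_pos (by omega), wordProd_shift] at h4
      rw [longestPerm_apply, if_pos hx]
      omega
    · rw [longestPerm_apply, if_neg hx]
      exact wordProd_fix u x (fun a ha => by have := hu a ha; omega)

theorem node_letters {n : ℕ} {w : List ℕ} (hw : IsReduced n w) {j : ℕ} (hj : j < w.length) :
    ∃ r s, 1 ≤ r ∧ r < s ∧ s ≤ n + 1 ∧ nu w r s = j + 1 ∧ pos w j r = letterAt w (j + 1) ∧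
      pos w j s = letterAt w (j + 1) + 1 ∧ 1 ≤ letterAt w (j + 1) ∧ letterAt w (j + 1) ≤ n := by
  obtain ⟨h1, h2, h3, h4⟩ := node_pair hw (j := j + 1) ⟨by omega, by omega⟩
  have h5 := letter_rng hw ⟨j, by have : w.length = Dim n := hw.1; omega⟩
  exact ⟨_, _, h1, h2, h3, h4, (wireX_iff w j _).1 rfl, (wireY_iff w j _).1 rfl, h5⟩

theorem prefD {n : ℕ} {w : List ℕ} (hw : IsReduced (n + 1) w)
    (hD : ∀ r q, 1 ≤ r → r < q → q < n + 2 → TD (nu w) r q (n + 2)) :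
    ∀ j, j ≤ w.length → ∃ u m k, m + k = n + 1 ∧ pos w j (n + 2) = m + 1 ∧
      (∀ a ∈ u, 1 ≤ a ∧ a ≤ n) ∧ TwoMoveEquiv (w.take j) (u ++ dw m k) := by
  intro j
  induction j with
  | zero =>
    intro _
    refine ⟨[], n + 1, 0, rfl, pos_zero w _, by simp, ?_⟩
    simp only [List.take_zero, dw, List.append_nil]
    exact Relation.ReflTransGen.refl
  | succ j ih =>
    intro hj
    obtain ⟨u, m, k, hmk, hp, hu, he⟩ := ih (by omega)
    obtain ⟨r, s, hr, hrs, hs, hnu, pr, ps, c1, c2⟩ := node_letters hw (by omega : j < w.length)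
    rw [take_succ_letter w j (by omega), pos_succ w j _ (by omega), hp]
    set c := letterAt w (j + 1) with hc
    have he' := equiv_append he [c]
    rcases Nat.lt_trichotomy c m with h | h | h
    · refine ⟨u ++ [c], m, k, hmk, ?_, ?_, ?_⟩
      · exact Equiv.swap_apply_of_ne_of_ne (by omega) (by omega)
      · intro a ha
        simp only [List.mem_append, List.mem_singleton] at ha
        rcases ha with ha | ha
        · exact hu a ha
        · omega
      · refine Relation.ReflTransGen.trans he' (equiv_push c (dw m k) u ?_)
        intro x hx
        have := mem_dw hx
        omega
    · refine ⟨u, m - 1, k + 1, by omega, ?_, hu, ?_⟩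
      · rw [h, Equiv.swap_apply_right]; omega
      · have h2 := dw_snoc (m - 1) k
        rw [Nat.sub_add_cancel (by omega)] at h2
        rw [← h2, ← List.append_assoc, ← h]
        rw [← h] at he'
        exact he'
    · exfalso
      by_cases hcp : c = m + 1
      · have : r = n + 2 := pos_inj w j (by omega)
        omega
      · have hs2 : s ≠ n + 2 := fun h => by rw [h] at ps; omega
        have h1 := (hD r s hr hrs (by omega)).1
        have h2 := pos_lt_iff hw hr (by omega : r < n + 2) (by omega) j (by omega)
        omega

theorem exD {n : ℕ} {w : List ℕ} (hw : IsReduced (n + 1) w)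
    (hD : ∀ r q, 1 ≤ r → r < q → q < n + 2 → TD (nu w) r q (n + 2)) :
    ∃ u, IsReduced n u ∧ TwoMoveEquiv w (u ++ descWord (n + 1)) := by
  obtain ⟨u, m, k, hmk, hp, hu, he⟩ := prefD hw hD w.length le_rfl
  rw [pos_len hw, longestPerm_apply, if_pos (by omega)] at hp
  obtain rfl : m = 0 := by omega
  obtain rfl : k = n + 1 := by omega
  rw [List.take_length, ← desc_eq] at he
  exact ⟨u, redD (equiv_reduced hw he) hu, he⟩

theorem prefA {n : ℕ} {w : List ℕ} (hw : IsReduced (n + 1) w)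
    (hA : ∀ q s, 1 < q → q < s → s ≤ n + 2 → TA (nu w) 1 q s) :
    ∀ j, j ≤ w.length → ∃ u k, pos w j 1 = k + 1 ∧
      (∀ a ∈ u, 2 ≤ a ∧ a ≤ n + 1) ∧ TwoMoveEquiv (w.take j) (u ++ ascWord k) := by
  intro j
  induction j with
  | zero =>
    intro _
    refine ⟨[], 0, pos_zero w _, by simp, ?_⟩
    simp only [List.take_zero, ascWord, List.range_zero, List.map_nil, List.append_nil]
    exact Relation.ReflTransGen.refl
  | succ j ih =>
    intro hj
    obtain ⟨u, k, hp, hu, he⟩ := ih (by omega)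
    obtain ⟨r, s, hr, hrs, hs, hnu, pr, ps, c1, c2⟩ := node_letters hw (by omega : j < w.length)
    rw [take_succ_letter w j (by omega), pos_succ w j _ (by omega), hp]
    set c := letterAt w (j + 1) with hc
    have he' := equiv_append he [c]
    rcases Nat.lt_trichotomy c (k + 1) with h | h | h
    · exfalso
      by_cases hcp : c = k
      · have : s = 1 := pos_inj w j (by omega)
        omega
      · have hs2 : r ≠ 1 := fun h => by rw [h] at pr; omega
        have h1 := (hA r s (by omega) hrs (by omega)).1
        have h2 := (hA r s (by omega) hrs (by omega)).2
        have h2 := pos_lt_iff hw le_rfl (by omega : 1 < s) (by omega) j (by omega)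
        omega
    · refine ⟨u, k + 1, ?_, hu, ?_⟩
      · rw [h, Equiv.swap_apply_left]
      · rw [asc_succ, ← List.append_assoc, ← h]
        exact he'
    · refine ⟨u ++ [c], k, ?_, ?_, ?_⟩
      · exact Equiv.swap_apply_of_ne_of_ne (by omega) (by omega)
      · intro a ha
        simp only [List.mem_append, List.mem_singleton] at ha
        rcases ha with ha | ha
        · exact hu a ha
        · omega
      · refine Relation.ReflTransGen.trans he' (equiv_push c (ascWord k) u ?_)
        intro x hx
        have := mem_asc hx
        omega

theorem map_sub_add {n : ℕ} {u : List ℕ} (hu : ∀ a ∈ u, 2 ≤ a ∧ a ≤ n + 1) :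
    (u.map (· - 1)).map (· + 1) = u ∧ ∀ a ∈ u.map (· - 1), 1 ≤ a ∧ a ≤ n := by
  constructor
  · rw [List.map_map]
    conv_rhs => rw [← List.map_id u]
    apply List.map_congr_left
    intro a ha
    have := hu a ha
    simp only [Function.comp, id]
    omega
  · intro a ha
    rw [List.mem_map] at ha
    obtain ⟨b, hb, rfl⟩ := ha
    have := hu b hb
    omega

theorem exA {n : ℕ} {w : List ℕ} (hw : IsReduced (n + 1) w)
    (hA : ∀ q s, 1 < q → q < s → s ≤ n + 2 → TA (nu w) 1 q s) :
    ∃ u, IsReduced n u ∧ TwoMoveEquiv w (u.map (· + 1) ++ ascWord (n + 1)) := by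
  obtain ⟨u, k, hp, hu, he⟩ := prefA hw hA w.length le_rfl
  rw [pos_len hw, longestPerm_apply, if_pos (by omega)] at hp
  obtain rfl : k = n + 1 := by omega
  rw [List.take_length] at he
  obtain ⟨h1, h2⟩ := map_sub_add hu
  rw [← h1] at he
  exact ⟨u.map (· - 1), redA (equiv_reduced hw he) h2, he⟩

/-! ### Nodes in a block -/

theorem wires_at (p q : List ℕ) (c : ℕ) : wireX (p ++ c :: q) (p.length + 1) = wordProd p c ∧
    wireY (p ++ c :: q) (p.length + 1) = wordProd p (c + 1) := by
  have h1 : letterAt (p ++ c :: q) (p.length + 1) = c := by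
    rw [letter_suf _ _ _ le_rfl]; simp [letterAt]
  unfold wireX wireY stateAbove
  rw [h1, Nat.add_sub_cancel, take_pre _ _ _ le_rfl, List.take_length]
  exact ⟨rfl, rfl⟩

theorem wires_pre (u v : List ℕ) (j : ℕ) (h1 : 1 ≤ j) (h : j ≤ u.length) :
    wireX (u ++ v) j = wireX u j ∧ wireY (u ++ v) j = wireY u j := by
  obtain ⟨j, rfl⟩ : ∃ i, j = i + 1 := ⟨j - 1, by omega⟩
  unfold wireX wireY stateAbove
  rw [letter_pre _ _ _ (by omega), Nat.add_sub_cancel, take_pre _ _ _ (by omega)]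
  exact ⟨rfl, rfl⟩

theorem letter_shift (u : List ℕ) (j : ℕ) (h : j < u.length) :
    letterAt (u.map (· + 1)) (j + 1) = letterAt u (j + 1) + 1 := by
  unfold letterAt
  simp only [Nat.add_sub_cancel, List.getD_eq_getElem?_getD, List.getElem?_map,
    List.getElem?_eq_getElem h, Option.map_some, Option.getD_some]

theorem wires_shift (u : List ℕ) (j : ℕ) (h1 : 1 ≤ j) (h : j ≤ u.length) :
    wireX (u.map (· + 1)) j = wireX u j + 1 ∧ wireY (u.map (· + 1)) j = wireY u j + 1 := by
  obtain ⟨j, rfl⟩ : ∃ i, j = i + 1 := ⟨j - 1, by omega⟩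
  unfold wireX wireY stateAbove
  rw [letter_shift _ _ (by omega), Nat.add_sub_cancel, ← List.map_take, wordProd_shift,
    wordProd_shift]
  exact ⟨rfl, rfl⟩

theorem blockD_node (u v : List ℕ) (n m i : ℕ) (h : m + 1 + i = n) :
    wireX (u ++ descWord n ++ v) (u.length + i + 1) = wordProd u (m + 1) ∧
    wireY (u ++ descWord n ++ v) (u.length + i + 1) = wordProd u (n + 1) := by
  have e : u ++ descWord n ++ v = (u ++ dw (m + 1) i) ++ (m + 1) :: (dw 0 m ++ v) := by
    rw [desc_eq, ← h, dw_split, dw]; simp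
  have hl : (u ++ dw (m + 1) i).length = u.length + i := by rw [List.length_append, dw_len]
  have := wires_at (u ++ dw (m + 1) i) (dw 0 m ++ v) (m + 1)
  rw [← e, hl, wordProd_append, Equiv.Perm.mul_apply, Equiv.Perm.mul_apply, dw_prod, dw_prod,
    if_neg (by omega), if_neg (by omega), if_pos (by omega), h] at this
  exact this

theorem blockA_node (u v : List ℕ) (n m i : ℕ) (h : i + (m + 1) = n) :
    wireX (u ++ ascWord n ++ v) (u.length + i + 1) = wordProd u 1 ∧
    wireY (u ++ ascWord n ++ v) (u.length + i + 1) = wordProd u (i + 2) := by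
  obtain ⟨q, hq⟩ := asc_split i m
  have e : u ++ ascWord n ++ v = (u ++ ascWord i) ++ (i + 1) :: (q ++ v) := by
    rw [← h, hq]; simp
  have hl : (u ++ ascWord i).length = u.length + i := by rw [List.length_append, asc_len]
  have := wires_at (u ++ ascWord i) (q ++ v) (i + 1)
  rw [← e, hl, wordProd_append, Equiv.Perm.mul_apply, Equiv.Perm.mul_apply, asc_prod, asc_prod,
    if_pos (by omega), if_neg (by omega), if_neg (by omega)] at this
  exact this

theorem blockD_nu {n : ℕ} {u v : List ℕ} (hw : IsReduced n (u ++ descWord n ++ v)) :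
    wordProd u (n + 1) = n + 1 ∧ (∀ c, 1 ≤ c → c ≤ n →
      nu (u ++ descWord n ++ v) (wordProd u c) (n + 1) = u.length + (n + 1 - c)) ∧
      ∀ r, 1 ≤ r → r ≤ n → ∃ c, 1 ≤ c ∧ c ≤ n ∧ wordProd u c = r := by
  have hlet : ∀ a ∈ u, 1 ≤ a ∧ a ≤ n := fun a ha => hw.2.1 a (by simp [ha])
  have hval : ∀ i, i < n → ValidNode (u ++ descWord n ++ v) (u.length + i + 1) := by
    intro i hi
    constructor
    · omega
    · rw [List.length_append, List.length_append, desc_eq, dw_len]; omega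
  have hfix : wordProd u (n + 1) = n + 1 := by
    by_contra hne
    obtain ⟨c, hc⟩ := (wordProd u).surjective (n + 1)
    have hcr := prod_rng hlet hc (by omega) le_rfl
    have hcn : c ≠ n + 1 := fun h => hne (h ▸ hc)
    have h1 := blockD_node u v n (c - 1) (n - c) (by omega)
    have h2 := node_pair hw (hval (n - c) (by omega))
    rw [Nat.sub_add_cancel hcr.1] at h1
    rw [h1.1, h1.2, hc] at h2
    omega
  refine ⟨hfix, ?_, ?_⟩
  · intro c hc hc'
    have h1 := blockD_node u v n (c - 1) (n - c) (by omega)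
    rw [Nat.sub_add_cancel hc, hfix] at h1
    rw [nu_eq hw (hval (n - c) (by omega)) h1.1 h1.2]
    omega
  · intro r hr hr'
    obtain ⟨c, hc⟩ := (wordProd u).surjective r
    have hcr := prod_rng hlet hc (by omega) (by omega)
    have hcn : c ≠ n + 1 := fun h => by rw [h, hfix] at hc; omega
    exact ⟨c, hcr.1, by omega, hc⟩

theorem blockA_nu {n : ℕ} {u v : List ℕ} (hw : IsReduced n (u ++ ascWord n ++ v)) :
    wordProd u 1 = 1 ∧ (∀ c, 2 ≤ c → c ≤ n + 1 →
      nu (u ++ ascWord n ++ v) 1 (wordProd u c) = u.length + (c - 1)) ∧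
      ∀ r, 2 ≤ r → r ≤ n + 1 → ∃ c, 2 ≤ c ∧ c ≤ n + 1 ∧ wordProd u c = r := by
  have hlet : ∀ a ∈ u, 1 ≤ a ∧ a ≤ n := fun a ha => hw.2.1 a (by simp [ha])
  have hval : ∀ i, i < n → ValidNode (u ++ ascWord n ++ v) (u.length + i + 1) := by
    intro i hi
    constructor
    · omega
    · rw [List.length_append, List.length_append, asc_len]; omega
  have hfix : wordProd u 1 = 1 := by
    by_contra hne
    obtain ⟨c, hc⟩ := (wordProd u).surjective 1
    have hcr := prod_rng hlet hc (by omega) (by omega)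
    have hcn : c ≠ 1 := fun h => hne (h ▸ hc)
    have h1 := blockA_node u v n (n + 1 - c) (c - 2) (by omega)
    have h2 := node_pair hw (hval (c - 2) (by omega))
    rw [show c - 2 + 2 = c by omega] at h1
    rw [h1.1, h1.2, hc] at h2
    omega
  refine ⟨hfix, ?_, ?_⟩
  · intro c hc hc'
    have h1 := blockA_node u v n (n + 1 - c) (c - 2) (by omega)
    rw [Nat.sub_add_cancel hc, hfix] at h1
    rw [nu_eq hw (hval (c - 2) (by omega)) h1.1 h1.2]
    omega
  · intro r hr hr'
    obtain ⟨c, hc⟩ := (wordProd u).surjective r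
    have hcr := prod_rng hlet hc (by omega) (by omega)
    have hcn : c ≠ 1 := fun h => by rw [h, hfix] at hc; omega
    exact ⟨c, by omega, by omega, hc⟩

theorem no_vD {n : ℕ} {u v u' : List ℕ} (hw : IsReduced n (u ++ descWord n ++ v))
    (hw' : IsReduced n (u' ++ descWord n))
    (hs : SameOrd n (nu (u ++ descWord n ++ v)) (nu (u' ++ descWord n))) : v = [] := by
  by_contra hv
  have hvl : 0 < v.length := List.length_pos_iff.2 hv
  have hlen : (u ++ descWord n ++ v).length = u.length + n + v.length := by
    rw [List.length_append, List.length_append, desc_eq, dw_len]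
  have hlen' : (u' ++ descWord n).length = u'.length + n := by
    rw [List.length_append, desc_eq, dw_len]
  obtain ⟨r, s, h1, h2, h3, h4, -⟩ := node_letters hw
    (by omega : u.length + n < (u ++ descWord n ++ v).length)
  obtain ⟨f1, f2, f3⟩ := blockD_nu hw
  have hw2 : IsReduced n (u' ++ descWord n ++ []) := by rw [List.append_nil]; exact hw'
  obtain ⟨g1, g2, g3⟩ := blockD_nu hw2
  rw [List.append_nil] at g2
  obtain ⟨c, c1, c2, c3⟩ := f3 r h1 (by omega)
  have e1 := f2 c c1 c2
  rw [c3] at e1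
  have hsn : s ≠ n + 1 := fun h => by rw [h] at h4; omega
  have e2 := (hs r (n + 1) s h1 (by omega) (by omega) le_rfl (by omega) h3 (by omega) (by omega)).1
    (by omega)
  obtain ⟨d, d1, d2, d3⟩ := g3 r h1 (by omega)
  have e3 := g2 d d1 d2
  rw [d3] at e3
  obtain ⟨⟨k1, k2⟩, k3, k4⟩ := nu_spec hw' h1 h2 h3
  obtain ⟨i, hi⟩ : ∃ i, nu (u' ++ descWord n) r s = u'.length + i + 1 :=
    ⟨nu (u' ++ descWord n) r s - u'.length - 1, by omega⟩
  have e4 := (blockD_node u' [] n (n - i - 1) i (by omega)).2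
  rw [List.append_nil, ← hi, k4, g1] at e4
  omega

theorem no_vA {n : ℕ} {u v u' : List ℕ} (hw : IsReduced n (u ++ ascWord n ++ v))
    (hw' : IsReduced n (u' ++ ascWord n))
    (hs : SameOrd n (nu (u ++ ascWord n ++ v)) (nu (u' ++ ascWord n))) : v = [] := by
  by_contra hv
  have hvl : 0 < v.length := List.length_pos_iff.2 hv
  have hlen : (u ++ ascWord n ++ v).length = u.length + n + v.length := by
    rw [List.length_append, List.length_append, asc_len]
  have hlen' : (u' ++ ascWord n).length = u'.length + n := by
    rw [List.length_append, asc_len]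
  obtain ⟨r, s, h1, h2, h3, h4, -⟩ := node_letters hw
    (by omega : u.length + n < (u ++ ascWord n ++ v).length)
  obtain ⟨f1, f2, f3⟩ := blockA_nu hw
  have hw2 : IsReduced n (u' ++ ascWord n ++ []) := by rw [List.append_nil]; exact hw'
  obtain ⟨g1, g2, g3⟩ := blockA_nu hw2
  rw [List.append_nil] at g2
  obtain ⟨c, c1, c2, c3⟩ := f3 s (by omega) (by omega)
  have e1 := f2 c c1 c2
  rw [c3] at e1
  have hsn : r ≠ 1 := fun h => by rw [h] at h4; omega
  have e2 := hs s 1 r (by omega) (by omega) (by omega) (by omega) (by omega) (by omega) (by omega)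
    (by omega)
  rw [nu_symm _ s 1, nu_symm _ s r, nu_symm _ s 1, nu_symm _ s r] at e2
  have e2 := e2.1 (by omega)
  obtain ⟨d, d1, d2, d3⟩ := g3 s (by omega) (by omega)
  have e3 := g2 d d1 d2
  rw [d3] at e3
  obtain ⟨⟨k1, k2⟩, k3, k4⟩ := nu_spec hw' h1 h2 h3
  obtain ⟨i, hi⟩ : ∃ i, nu (u' ++ ascWord n) r s = u'.length + i + 1 :=
    ⟨nu (u' ++ ascWord n) r s - u'.length - 1, by omega⟩
  have e4 := (blockA_node u' [] n (n - i - 1) i (by omega)).1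
  rw [List.append_nil, ← hi, k3, g1] at e4
  omega

theorem mem_letter {u : List ℕ} {a : ℕ} (h : a ∈ u) : ∃ j, j < u.length ∧ letterAt u (j + 1) = a := by
  obtain ⟨j, hj, e⟩ := List.getElem_of_mem h
  refine ⟨j, hj, ?_⟩
  unfold letterAt
  simp only [Nat.add_sub_cancel, List.getD_eq_getElem?_getD, List.getElem?_eq_getElem hj,
    Option.getD_some]
  exact e

theorem lettersD {n : ℕ} {u : List ℕ} (hw : IsReduced (n + 1) (u ++ descWord (n + 1))) :
    ∀ a ∈ u, 1 ≤ a ∧ a ≤ n := by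
  have hw2 : IsReduced (n + 1) (u ++ descWord (n + 1) ++ []) := by rw [List.append_nil]; exact hw
  obtain ⟨g1, g2, g3⟩ := blockD_nu hw2
  rw [List.append_nil] at g2
  have hlen : (u ++ descWord (n + 1)).length = u.length + (n + 1) := by
    rw [List.length_append, desc_eq, dw_len]
  have hno : ∀ j, j < u.length → pos (u ++ descWord (n + 1)) j (n + 2) = n + 2 →
      1 ≤ letterAt (u ++ descWord (n + 1)) (j + 1) ∧
      letterAt (u ++ descWord (n + 1)) (j + 1) ≤ n := by
    intro j hj hp
    obtain ⟨r, s, h1, h2, h3, h4, h5, h6, h7, h8⟩ := node_letters hw (by omega : j < (u ++ descWord (n + 1)).length)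
    refine ⟨h7, ?_⟩
    by_contra hcon
    have : s = n + 2 := pos_inj (u ++ descWord (n + 1)) j (by omega)
    rw [this] at h4
    obtain ⟨c, c1, c2, c3⟩ := g3 r h1 (by omega)
    have := g2 c c1 c2
    rw [c3] at this
    have h9 : nu (u ++ descWord (n + 1)) r (n + 2) = _ := this
    omega
  have hpos : ∀ j, j ≤ u.length → pos (u ++ descWord (n + 1)) j (n + 2) = n + 2 := by
    intro j
    induction j with
    | zero => intro _; exact pos_zero _ _
    | succ j ih =>
      intro hj
      have h1 := ih (by omega)
      have h2 := hno j (by omega) h1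
      rw [pos_succ _ _ _ (by omega), h1]
      exact Equiv.swap_apply_of_ne_of_ne (by omega) (by omega)
  intro a ha
  obtain ⟨j, hj, rfl⟩ := mem_letter ha
  have := hno j hj (hpos j (by omega))
  rwa [letter_pre _ _ _ hj] at this

theorem lettersA {n : ℕ} {u : List ℕ} (hw : IsReduced (n + 1) (u ++ ascWord (n + 1))) :
    ∀ a ∈ u, 2 ≤ a ∧ a ≤ n + 1 := by
  have hw2 : IsReduced (n + 1) (u ++ ascWord (n + 1) ++ []) := by rw [List.append_nil]; exact hw
  obtain ⟨g1, g2, g3⟩ := blockA_nu hw2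
  rw [List.append_nil] at g2
  have hlen : (u ++ ascWord (n + 1)).length = u.length + (n + 1) := by
    rw [List.length_append, asc_len]
  have hno : ∀ j, j < u.length → pos (u ++ ascWord (n + 1)) j 1 = 1 →
      2 ≤ letterAt (u ++ ascWord (n + 1)) (j + 1) ∧
      letterAt (u ++ ascWord (n + 1)) (j + 1) ≤ n + 1 := by
    intro j hj hp
    obtain ⟨r, s, h1, h2, h3, h4, h5, h6, h7, h8⟩ := node_letters hw (by omega : j < (u ++ ascWord (n + 1)).length)
    refine ⟨?_, h8⟩
    by_contra hcon
    have : r = 1 := pos_inj (u ++ ascWord (n + 1)) j (by omega)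
    rw [this] at h4
    obtain ⟨c, c1, c2, c3⟩ := g3 s (by omega) (by omega)
    have := g2 c c1 c2
    rw [c3] at this
    omega
  have hpos : ∀ j, j ≤ u.length → pos (u ++ ascWord (n + 1)) j 1 = 1 := by
    intro j
    induction j with
    | zero => intro _; exact pos_zero _ _
    | succ j ih =>
      intro hj
      have h1 := ih (by omega)
      have h2 := hno j (by omega) h1
      rw [pos_succ _ _ _ (by omega), h1]
      exact Equiv.swap_apply_of_ne_of_ne (by omega) (by omega)
  intro a ha
  obtain ⟨j, hj, rfl⟩ := mem_letter ha
  have := hno j hj (hpos j (by omega))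
  rwa [letter_pre _ _ _ hj] at this

/-! ### `nu` for extended words -/

theorem nuD_top {n : ℕ} {u : List ℕ} (hu : IsReduced n u)
    (hw : IsReduced (n + 1) (u ++ descWord (n + 1))) {r : ℕ} (hr : 1 ≤ r) (hr' : r ≤ n + 1) :
    nu (u ++ descWord (n + 1)) r (n + 2) = Dim n + r := by
  have hw2 : IsReduced (n + 1) (u ++ descWord (n + 1) ++ []) := by rw [List.append_nil]; exact hw
  obtain ⟨g1, g2, g3⟩ := blockD_nu hw2
  rw [List.append_nil] at g2
  have := g2 (n + 2 - r) (by omega) (by omega)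
  rw [hu.2.2, longestPerm_apply, if_pos (by omega), show n + 2 - (n + 2 - r) = r by omega] at this
  have hl : u.length = Dim n := hu.1
  rw [this, hl]

theorem nuD_low {n : ℕ} {u : List ℕ} (hu : IsReduced n u)
    (hw : IsReduced (n + 1) (u ++ descWord (n + 1))) {r s : ℕ} (hr : 1 ≤ r) (hrs : r < s)
    (hs : s ≤ n + 1) : nu (u ++ descWord (n + 1)) r s = nu u r s := by
  obtain ⟨⟨h1, h2⟩, h3, h4⟩ := nu_spec hu hr hrs hs
  have h5 := wires_pre u (descWord (n + 1)) _ h1 h2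
  apply nu_eq hw
  · exact ⟨h1, by rw [List.length_append]; omega⟩
  · rw [h5.1, h3]
  · rw [h5.2, h4]

theorem nuA_top {n : ℕ} {u : List ℕ} (hu : IsReduced n u)
    (hw : IsReduced (n + 1) (u.map (· + 1) ++ ascWord (n + 1))) {s : ℕ} (hs : 2 ≤ s)
    (hs' : s ≤ n + 2) : nu (u.map (· + 1) ++ ascWord (n + 1)) 1 s = Dim n + (n + 3 - s) := by
  have hw2 : IsReduced (n + 1) (u.map (· + 1) ++ ascWord (n + 1) ++ []) := by
    rw [List.append_nil]; exact hw
  obtain ⟨g1, g2, g3⟩ := blockA_nu hw2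
  rw [List.append_nil] at g2
  have := g2 (n + 3 - s + 1) (by omega) (by omega)
  rw [wordProd_shift, hu.2.2, longestPerm_apply, if_pos (by omega),
    show n + 2 - (n + 3 - s) + 1 = s by omega, List.length_map] at this
  have hl : u.length = Dim n := hu.1
  rw [this, hl]
  omega

theorem nuA_low {n : ℕ} {u : List ℕ} (hu : IsReduced n u)
    (hw : IsReduced (n + 1) (u.map (· + 1) ++ ascWord (n + 1))) {r s : ℕ} (hr : 1 ≤ r) (hrs : r < s)
    (hs : s ≤ n + 1) : nu (u.map (· + 1) ++ ascWord (n + 1)) (r + 1) (s + 1) = nu u r s := by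
  obtain ⟨⟨h1, h2⟩, h3, h4⟩ := nu_spec hu hr hrs hs
  have h5 := wires_pre (u.map (· + 1)) (ascWord (n + 1)) _ h1 (by rw [List.length_map]; exact h2)
  have h6 := wires_shift u _ h1 h2
  apply nu_eq hw
  · exact ⟨h1, by rw [List.length_append, List.length_map]; omega⟩
  · rw [h5.1, h6.1, h3]
  · rw [h5.2, h6.2, h4]

/-! ### Nice words -/

def Nice : ℕ → List ℕ → Prop
  | 0, _ => True
  | n + 1, w => ∃ u, IsReduced n u ∧ Nice n u ∧
      (TwoMoveEquiv w (u ++ descWord (n + 1)) ∨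
        TwoMoveEquiv w (u.map (· + 1) ++ ascWord (n + 1)))

theorem ss_shift {ν ν' : ℕ → ℕ → ℕ} (d m : ℕ) : ∀ a,
    (∀ r s, a ≤ r → r < s → s ≤ a + m → ν (r + d) (s + d) = ν' r s) → SS ν (a + d) m → SS ν' a m := by
  induction m with
  | zero => intro a _ _; trivial
  | succ m ih =>
    intro a h hs
    rcases hs with ⟨h1, h2⟩ | ⟨h1, h2⟩
    · refine Or.inl ⟨fun r q g1 g2 g3 => ?_,
        ih a (fun r s k1 k2 k3 => h r s k1 k2 (by omega)) h2⟩
      have := h1 (r + d) (q + d) (by omega) (by omega) (by omega)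
      rw [show a + d + m + 1 = (a + m + 1) + d by omega] at this
      unfold TD at this ⊢
      rw [h _ _ (by omega) (by omega) (by omega), h _ _ (by omega) (by omega) (by omega),
        h _ _ (by omega) (by omega) (by omega)] at this
      exact this
    · rw [show a + d + 1 = a + 1 + d by omega] at h2
      refine Or.inr ⟨fun q s g1 g2 g3 => ?_,
        ih (a + 1) (fun r s k1 k2 k3 => h r s (by omega) k2 (by omega)) h2⟩
      have := h1 (q + d) (s + d) (by omega) (by omega) (by omega)
      unfold TA at this ⊢
      rw [h _ _ (by omega) (by omega) (by omega), h _ _ (by omega) (by omega) (by omega),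
        h _ _ (by omega) (by omega) (by omega)] at this
      exact this

theorem ss_nice (n : ℕ) : ∀ w, IsReduced n w → SS (nu w) 1 n → Nice n w := by
  induction n with
  | zero => intro w _ _; trivial
  | succ n ih =>
    intro w hw hs
    rcases hs with ⟨h1, h2⟩ | ⟨h1, h2⟩
    · obtain ⟨u, hu, he⟩ := exD hw (fun r q a1 a2 a3 => by
        have := h1 r q a1 a2 (by omega)
        rwa [show 1 + n + 1 = n + 2 by omega] at this)
      have hw' := equiv_reduced hw he
      refine ⟨u, hu, ih u hu ?_, Or.inl he⟩
      have h3 := same_ss (arr_nu hw) (arr_nu hw') (equiv_sameOrd hw he) n 1 le_rfl (by omega) h2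
      exact ss_shift 0 n 1 (fun r s a1 a2 a3 => nuD_low hu hw' a1 a2 (by omega)) h3
    · obtain ⟨u, hu, he⟩ := exA hw (fun q s a1 a2 a3 => h1 q s a1 a2 (by omega))
      have hw' := equiv_reduced hw he
      refine ⟨u, hu, ih u hu ?_, Or.inr he⟩
      have h3 := same_ss (arr_nu hw) (arr_nu hw') (equiv_sameOrd hw he) n 2 (by omega) (by omega) h2
      exact ss_shift 1 n 1 (fun r s a1 a2 a3 => nuA_low hu hw' a1 a2 (by omega)) h3

theorem nice_simplicial (n : ℕ) : ∀ w, Nice n w → SimplicialWord n w := by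
  induction n with
  | zero => intro w _; exact ⟨fun _ => true, fun _ => w, rfl, fun k h1 h2 => by omega⟩
  | succ n ih =>
    rintro w ⟨u, hu, hN, he⟩
    obtain ⟨σ, c, hc, h⟩ := ih u hN
    have main : ∀ b : Bool, (if b then IsContractionD (n + 1) w u ∧ indD (n + 1) w = 0
       else IsContractionA (n + 1) w u ∧ indA (n + 1) w = 0) → SimplicialWord (n + 1) w := by
      intro b hb
      refine ⟨fun k => if k = n + 1 then b else σ k, fun k => if k = n + 1 then w else c k,
        by simp, ?_⟩
      intro k h1 h2
      by_cases hk : k = n + 1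
      · subst hk
        simp only [if_true, Nat.add_sub_cancel, if_neg (show ¬ n = n + 1 by omega), hc]
        exact hb
      · simp only [if_neg hk, if_neg (show ¬ k - 1 = n + 1 by omega)]
        exact h k h1 (by omega)
    rcases he with he | he
    · apply main true
      simp only [if_true]
      refine ⟨⟨u, [], by rw [List.append_nil]; exact he, by simp⟩, ?_⟩
      exact Nat.sInf_eq_zero.2 (Or.inl ⟨u, [], rfl, by rw [List.append_nil]; exact he⟩)
    · apply main false
      simp only [Bool.false_eq_true, if_false]
      refine ⟨⟨u.map (· + 1), [], by rw [List.append_nil]; exact he, ?_⟩, ?_⟩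
      · rw [List.map_map, List.append_nil]
        conv_lhs => rw [← List.map_id u]
        apply List.map_congr_left
        intro a _
        simp
      · exact Nat.sInf_eq_zero.2
          (Or.inl ⟨u.map (· + 1), [], rfl, by rw [List.append_nil]; exact he⟩)

theorem sameOrd_trans {n : ℕ} {w a b : List ℕ} (hw : IsReduced n w) (h1 : TwoMoveEquiv w a)
    (h2 : TwoMoveEquiv w b) : SameOrd n (nu a) (nu b) :=
  equiv_sameOrd (equiv_reduced hw h1) (Relation.ReflTransGen.trans (equiv_symm h1) h2)

theorem simplicial_nice (n : ℕ) : ∀ w, IsReduced n w → SimplicialWord n w → Nice n w := by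
  induction n with
  | zero => intro w _ _; trivial
  | succ n ih =>
    rintro w hw ⟨σ, c, hc, h⟩
    have hrec : SimplicialWord n (c n) := ⟨σ, c, rfl, fun k h1 h2 => h k h1 (by omega)⟩
    have htop := h (n + 1) (by omega) le_rfl
    rw [Nat.add_sub_cancel, hc] at htop
    by_cases hσ : σ (n + 1) = true
    · rw [if_pos hσ] at htop
      obtain ⟨⟨u, v, h1, h2⟩, h3⟩ := htop
      have h4 : (0 : ℕ) ∈ {s | ∃ u v : List ℕ, v.length = s ∧
          TwoMoveEquiv w (u ++ descWord (n + 1) ++ v)} := by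
        rw [← h3]
        exact Nat.sInf_mem ⟨_, u, v, rfl, h1⟩
      obtain ⟨u', v', h5, h6⟩ := h4
      rw [List.length_eq_zero_iff.1 h5, List.append_nil] at h6
      have hv : v = [] := no_vD (equiv_reduced hw h1) (equiv_reduced hw h6) (sameOrd_trans hw h1 h6)
      subst hv
      rw [List.append_nil] at h1
      simp only [List.map_nil, List.append_nil] at h2
      have hu := redD (equiv_reduced hw h1) (lettersD (equiv_reduced hw h1))
      rw [h2] at hrec
      exact ⟨u, hu, ih u hu hrec, Or.inl h1⟩
    · rw [if_neg hσ] at htop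
      obtain ⟨⟨u, v, h1, h2⟩, h3⟩ := htop
      have h4 : (0 : ℕ) ∈ {s | ∃ u v : List ℕ, v.length = s ∧
          TwoMoveEquiv w (u ++ ascWord (n + 1) ++ v)} := by
        rw [← h3]
        exact Nat.sInf_mem ⟨_, u, v, rfl, h1⟩
      obtain ⟨u', v', h5, h6⟩ := h4
      rw [List.length_eq_zero_iff.1 h5, List.append_nil] at h6
      have hv : v = [] := no_vA (equiv_reduced hw h1) (equiv_reduced hw h6) (sameOrd_trans hw h1 h6)
      subst hv
      rw [List.append_nil] at h1
      simp only [List.append_nil] at h2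
      obtain ⟨e1, e2⟩ := map_sub_add (lettersA (equiv_reduced hw h1))
      rw [← e1] at h1
      have hu := redA (equiv_reduced hw h1) e2
      rw [h2] at hrec
      exact ⟨u.map (· - 1), hu, ih _ hu hrec, Or.inr h1⟩


/-! ### Paths of extended arrangements -/

structure ExtD (n N : ℕ) (ν ν' : ℕ → ℕ → ℕ) : Prop where
  low : ∀ r s, 1 ≤ r → r ≤ n + 1 → 1 ≤ s → s ≤ n + 1 → r ≠ s → ν r s = ν' r s
  le : ∀ r s, 1 ≤ r → r ≤ n + 1 → 1 ≤ s → s ≤ n + 1 → r ≠ s → ν' r s ≤ N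
  top : ∀ r, 1 ≤ r → r ≤ n + 1 → ν r (n + 2) = N + r
  top' : ∀ r, 1 ≤ r → r ≤ n + 1 → ν (n + 2) r = N + r

theorem extD_dead {n N k : ℕ} {ν ν' : ℕ → ℕ → ℕ} (h : ExtD n N ν ν') {r : ℕ} {l : List ℕ}
    (hr : 1 ≤ r) (hr' : r ≤ n + 1) (hk : k < r) (hw : WT (n + 1) ν k (n + 2) r l) :
    l = [] ∧ r = k + 1 := by
  match l, hw with
  | [], hw => exact ⟨rfl, hw⟩
  | q :: l, hw =>
    obtain ⟨h1, h2, h3, h4, h5, h6⟩ := hw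
    exfalso
    unfold Bef at h4
    rw [if_neg (by omega), h.top' r hr hr'] at h4
    by_cases hq : q = n + 2
    · rw [hq, h.top r hr hr'] at h4; omega
    · have := h.le r q hr hr' h1 (by omega) (by omega)
      rw [h.low r q hr hr' h1 (by omega) (by omega)] at h4; omega

theorem extD_top {n N k : ℕ} {ν ν' : ℕ → ℕ → ℕ} (h : ExtD n N ν ν') {r : ℕ} {l : List ℕ}
    (hr : 1 ≤ r) (hr' : r ≤ n + 1) (hk : k ≤ r) (hkn : k ≤ n) (hw : WT (n + 1) ν k r (n + 2) l) :
    r = k ∧ l = [k + 1] := by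
  match l, hw with
  | [], hw => 
    have : n + 2 = k + 1 := hw
    omega
  | q :: l, hw =>
    obtain ⟨h1, h2, h3, h4, h5, h6⟩ := hw
    unfold Bef at h4
    rw [if_neg (by omega), h.top r hr hr', h.top' q h1 (by omega)] at h4
    obtain ⟨g1, g2⟩ := extD_dead h h1 (by omega) (by omega) h6
    subst g1
    exact ⟨by omega, by rw [g2]⟩

theorem extD_desc {n N k : ℕ} {ν ν' : ℕ → ℕ → ℕ} (h : ExtD n N ν ν') (l : List ℕ) :
    ∀ p r, 1 ≤ p → p ≤ n + 1 → 1 ≤ r → r ≤ n + 1 → p ≠ r → WT (n + 1) ν k p r l →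
      WT n ν' k p r l := by
  induction l with
  | nil => intro p r _ _ _ _ _ hw; exact hw
  | cons q l ih =>
    intro p r hp hp' hr hr' hpr hw
    obtain ⟨h1, h2, h3, h4, h5, h6⟩ := hw
    have e1 := h.low p r hp hp' hr hr' hpr
    have e2 := h.le p r hp hp' hr hr' hpr
    have hq : q ≤ n + 1 := by
      by_contra hc
      have hq : q = n + 2 := by omega
      subst hq
      unfold Bef at h4
      rw [h.top r hr hr', e1] at h4
      split_ifs at h4 with hk
      · omega
      · have := extD_top h hr hr' (by omega) (by omega) h6
        omega
    refine ⟨h1, hq, h3, ?_, ?_, ih r q hr hr' h1 hq (by omega) h6⟩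
    · rw [← e1, ← h.low r q hr hr' h1 hq (by omega)]; exact h4
    · intro x x1 x2 x3 x4 x5
      apply h5 x x1 (by omega) x3
      · rw [e1, h.low r x hr hr' x1 x2 (by omega)]; exact x4
      · rw [h.low r x hr hr' x1 x2 (by omega), h.low r q hr hr' h1 hq (by omega)]; exact x5

theorem extD_lift {n N k : ℕ} {ν ν' : ℕ → ℕ → ℕ} (h : ExtD n N ν ν') (l : List ℕ) :
    ∀ p r, 1 ≤ p → p ≤ n + 1 → 1 ≤ r → r ≤ n + 1 → p ≠ r → WT n ν' k p r l →
      WT (n + 1) ν k p r l := by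
  induction l with
  | nil => intro p r _ _ _ _ _ hw; exact hw
  | cons q l ih =>
    intro p r hp hp' hr hr' hpr hw
    obtain ⟨h1, h2, h3, h4, h5, h6⟩ := hw
    have e1 := h.low p r hp hp' hr hr' hpr
    have e2 := h.le p r hp hp' hr hr' hpr
    have e3 := h.low r q hr hr' h1 h2 (by omega)
    have e4 := h.le r q hr hr' h1 h2 (by omega)
    refine ⟨h1, by omega, h3, ?_, ?_, ih r q hr hr' h1 h2 (by omega) h6⟩
    · rw [e1, e3]; exact h4
    · intro x x1 x2 x3 x4 x5
      by_cases hx : x = n + 2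
      · exfalso
        subst hx
        rw [h.top r hr hr', e1] at x4
        rw [h.top r hr hr', e3] at x5
        unfold Bef at x4 x5
        split_ifs at x4 x5 <;> omega
      · rw [e1, h.low r x hr hr' x1 (by omega) (by omega)] at x4
        rw [h.low r x hr hr' x1 (by omega) (by omega), e3] at x5
        exact h5 x x1 (by omega) x3 x4 x5

theorem wt_bad {n : ℕ} {ν : ℕ → ℕ → ℕ} (l : List ℕ) : ∀ p r, r ≤ n + 1 →
    ¬ WT n ν (n + 1) p r l := by
  induction l with
  | nil =>
    intro p r hr hw
    have : r = n + 1 + 1 := hw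
    omega
  | cons q l ih => intro p r hr hw; exact ih r q hw.2.1 hw.2.2.2.2.2

theorem extD_wp {n N : ℕ} {ν ν' : ℕ → ℕ → ℕ} (h : ExtD n N ν ν') (k : ℕ) (l : List ℕ) :
    WP (n + 1) ν k l ↔ WP n ν' k l ∨ (1 ≤ k ∧ k ≤ n ∧ l = [n + 2, k + 1]) ∨
      (k = n + 1 ∧ l = [n + 2]) := by
  constructor
  · intro hw
    match l, hw with
    | s :: l, hw =>
      obtain ⟨h1, h2, h3, h4, h5, h6⟩ := hw
      by_cases hs : s = n + 2
      · subst hs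
        right
        by_cases hk : k = n + 1
        · right
          refine ⟨hk, ?_⟩
          match l, h6 with
          | [], _ => rfl
          | q :: l, h6 =>
            exfalso
            obtain ⟨g1, g2, g3, g4, g5, g6⟩ := h6
            unfold Bef at g4
            rw [if_neg (by omega), h.top k h1 (by omega), h.top' q g1 (by omega)] at g4
            omega
        · left
          obtain ⟨-, g⟩ := extD_top h h1 (by omega) le_rfl (by omega) h6
          exact ⟨h1, by omega, by rw [g]⟩
      · left
        have g := extD_desc h l k s h1 (by omega) h3 (by omega) (by omega) h6
        by_cases hk : k = n + 1
        · subst hk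
          exact absurd g (wt_bad l _ s (by omega))
        · exact ⟨h1, by omega, h3, by omega, h5, g⟩
  · rintro (hw | ⟨h1, h2, rfl⟩ | ⟨rfl, rfl⟩)
    · match l, hw with
      | s :: l, hw =>
        obtain ⟨h1, h2, h3, h4, h5, h6⟩ := hw
        exact ⟨h1, by omega, h3, by omega, h5,
          extD_lift h l k s h1 (by omega) h3 h4 (by omega) h6⟩
    · refine ⟨h1, by omega, by omega, le_rfl, by omega, by omega, by omega, by omega, ?_, ?_, rfl⟩
      · unfold Bef
        rw [if_neg (by omega), h.top k h1 (by omega), h.top' (k + 1) (by omega) (by omega)]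
        omega
      · intro x x1 x2 x3 x4 x5
        unfold Bef at x4 x5
        rw [if_neg (by omega), h.top k h1 (by omega), h.top' x (by omega) (by omega)] at x4
        rw [if_neg (by omega), h.top' x (by omega) (by omega),
          h.top' (k + 1) (by omega) (by omega)] at x5
        omega
    · exact ⟨by omega, le_rfl, by omega, le_rfl, by omega, rfl⟩

structure ExtA (n N : ℕ) (ν ν' : ℕ → ℕ → ℕ) : Prop where
  low : ∀ r s, 1 ≤ r → r ≤ n + 1 → 1 ≤ s → s ≤ n + 1 → r ≠ s → ν (r + 1) (s + 1) = ν' r s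
  le : ∀ r s, 1 ≤ r → r ≤ n + 1 → 1 ≤ s → s ≤ n + 1 → r ≠ s → ν' r s ≤ N
  top : ∀ s, 1 ≤ s → s ≤ n + 1 → ν 1 (s + 1) = N + (n + 2 - s)
  top' : ∀ s, 1 ≤ s → s ≤ n + 1 → ν (s + 1) 1 = N + (n + 2 - s)

theorem extA_dead {n N k : ℕ} {ν ν' : ℕ → ℕ → ℕ} (h : ExtA n N ν ν') {r : ℕ} {l : List ℕ}
    (hr : 1 ≤ r) (hr' : r ≤ n + 1) (hk : k < r + 1) (hw : WT (n + 1) ν k 1 (r + 1) l) :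
    l = [] ∧ r = k := by
  match l, hw with
  | [], hw =>
    have : r + 1 = k + 1 := hw
    exact ⟨rfl, by omega⟩
  | q :: l, hw =>
    obtain ⟨h1, h2, h3, h4, h5, h6⟩ := hw
    exfalso
    unfold Bef at h4
    rw [if_neg (by omega), h.top r hr hr'] at h4
    by_cases hq : q = 1
    · rw [hq, h.top' r hr hr'] at h4; omega
    · obtain ⟨q, rfl⟩ : ∃ q', q = q' + 1 := ⟨q - 1, by omega⟩
      have := h.le r q hr hr' (by omega) (by omega) (by omega)
      rw [h.low r q hr hr' (by omega) (by omega) (by omega)] at h4; omega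

theorem extA_top {n N k : ℕ} {ν ν' : ℕ → ℕ → ℕ} (h : ExtA n N ν ν') {r : ℕ} {l : List ℕ}
    (hr : 1 ≤ r) (hr' : r ≤ n + 1) (hk : k ≤ r + 1) (hk1 : 2 ≤ k)
    (hw : WT (n + 1) ν k (r + 1) 1 l) :
    r + 1 = k ∧ l = [k + 1] := by
  match l, hw with
  | [], hw =>
    have : 1 = k + 1 := hw
    omega
  | q :: l, hw =>
    obtain ⟨h1, h2, h3, h4, h5, h6⟩ := hw
    obtain ⟨q, rfl⟩ : ∃ q', q = q' + 1 := ⟨q - 1, by omega⟩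
    unfold Bef at h4
    rw [if_pos (by omega), h.top' r hr hr', h.top q (by omega) (by omega)] at h4
    obtain ⟨g1, g2⟩ := extA_dead h (by omega) (by omega) (by omega) h6
    subst g1
    exact ⟨by omega, by rw [g2]⟩

theorem bef_shift (k r a b : ℕ) : Bef (k + 1) (r + 1) a b ↔ Bef k r a b := by
  unfold Bef; simp only [Nat.add_le_add_iff_right]

theorem forb_shift (k r x : ℕ) : Forb (k + 1) (r + 1) (x + 1) ↔ Forb k r x := by
  unfold Forb; omega

theorem extA_desc {n N k : ℕ} {ν ν' : ℕ → ℕ → ℕ} (h : ExtA n N ν ν') (hk : 1 ≤ k) (l : List ℕ) :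
    ∀ p r, 1 ≤ p → p ≤ n + 1 → 1 ≤ r → r ≤ n + 1 → p ≠ r → WT (n + 1) ν (k + 1) (p + 1) (r + 1) l →
      ∃ l', l = l'.map (· + 1) ∧ WT n ν' k p r l' := by
  induction l with
  | nil =>
    intro p r _ _ _ _ _ hw
    have : r + 1 = k + 1 + 1 := hw
    refine ⟨[], rfl, ?_⟩
    show r = k + 1
    omega
  | cons q l ih =>
    intro p r hp hp' hr hr' hpr hw
    obtain ⟨h1, h2, h3, h4, h5, h6⟩ := hw
    have e1 := h.low p r hp hp' hr hr' hpr
    have e2 := h.le p r hp hp' hr hr' hpr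
    by_cases hq : q = 1
    · exfalso
      subst hq
      unfold Bef at h4
      rw [h.top' r hr hr', e1] at h4
      split_ifs at h4 with hk
      · omega
      · have := extA_top h hr hr' (by omega) (by omega) h6
        omega
    · obtain ⟨q, rfl⟩ : ∃ q', q = q' + 1 := ⟨q - 1, by omega⟩
      obtain ⟨l', rfl, hl'⟩ := ih r q hr hr' (by omega) (by omega) (by omega) h6
      have e3 := h.low r q hr hr' (by omega) (by omega) (by omega)
      refine ⟨q :: l', rfl, by omega, by omega, by omega, ?_, ?_, hl'⟩
      · rw [← bef_shift, ← e1, ← e3]; exact h4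
      · intro x x1 x2 x3 x4 x5
        rw [← forb_shift]
        apply h5 (x + 1) (by omega) (by omega) (by omega)
        · rw [e1, h.low r x hr hr' x1 x2 (by omega), bef_shift]; exact x4
        · rw [h.low r x hr hr' x1 x2 (by omega), e3, bef_shift]; exact x5

theorem extA_lift {n N k : ℕ} {ν ν' : ℕ → ℕ → ℕ} (h : ExtA n N ν ν') (l : List ℕ) :
    ∀ p r, 1 ≤ p → p ≤ n + 1 → 1 ≤ r → r ≤ n + 1 → p ≠ r → WT n ν' k p r l →
      WT (n + 1) ν (k + 1) (p + 1) (r + 1) (l.map (· + 1)) := by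
  induction l with
  | nil =>
    intro p r _ _ _ _ _ hw
    have : r = k + 1 := hw
    show r + 1 = k + 1 + 1
    omega
  | cons q l ih =>
    intro p r hp hp' hr hr' hpr hw
    obtain ⟨h1, h2, h3, h4, h5, h6⟩ := hw
    have e1 := h.low p r hp hp' hr hr' hpr
    have e2 := h.le p r hp hp' hr hr' hpr
    have e3 := h.low r q hr hr' h1 h2 (by omega)
    have e4 := h.le r q hr hr' h1 h2 (by omega)
    refine ⟨by dsimp only; omega, by dsimp only; omega, by dsimp only; omega, ?_, ?_, ih r q hr hr' h1 h2 (by omega) h6⟩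
    · rw [e1, e3, bef_shift]; exact h4
    · intro x x1 x2 x3 x4 x5
      rw [e1] at x4
      rw [e3] at x5
      by_cases hx : x = 1
      · exfalso
        subst hx
        rw [h.top' r hr hr'] at x4 x5
        unfold Bef at x4 x5
        split_ifs at x4 x5 <;> omega
      · obtain ⟨x, rfl⟩ : ∃ q', x = q' + 1 := ⟨x - 1, by omega⟩
        rw [h.low r x hr hr' (by omega) (by omega) (by omega), bef_shift] at x4 x5
        rw [forb_shift]
        exact h5 x (by omega) (by omega) (by omega) x4 x5

theorem extA_wp {n N : ℕ} {ν ν' : ℕ → ℕ → ℕ} (h : ExtA n N ν ν') (k : ℕ) (l : List ℕ) :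
    WP (n + 1) ν (k + 1) l ↔ (∃ l', l = l'.map (· + 1) ∧ WP n ν' k l') ∨
      (1 ≤ k ∧ k ≤ n ∧ l = [1, k + 2]) ∨ (k = 0 ∧ l = [2]) := by
  constructor
  · intro hw
    match l, hw with
    | s :: l, hw =>
      obtain ⟨h1, h2, h3, h4, h5, h6⟩ := hw
      by_cases hk : k = 0
      · subst hk
        right; right
        obtain ⟨s, rfl⟩ : ∃ q', s = q' + 1 := ⟨s - 1, by omega⟩
        obtain ⟨g1, g2⟩ := extA_dead h (by omega) (by omega) (by omega) h6
        exact ⟨rfl, by rw [g1, g2]⟩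
      · by_cases hs : s = 1
        · subst hs
          obtain ⟨-, g⟩ := extA_top h (by omega) (by omega) le_rfl (by omega) h6
          exact Or.inr (Or.inl ⟨by omega, by omega, by rw [g]⟩)
        · obtain ⟨s, rfl⟩ : ∃ q', s = q' + 1 := ⟨s - 1, by omega⟩
          obtain ⟨l', rfl, hl'⟩ := extA_desc h (by omega) l k s (by omega) (by omega) (by omega)
            (by omega) (by omega) h6
          exact Or.inl ⟨s :: l', rfl, by omega, by omega, by omega, by omega, by omega, hl'⟩
  · rintro (⟨l', rfl, hw⟩ | ⟨h1, h2, rfl⟩ | ⟨rfl, rfl⟩)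
    · match l', hw with
      | s :: l, hw =>
        obtain ⟨h1, h2, h3, h4, h5, h6⟩ := hw
        exact ⟨by omega, by omega, by dsimp only; omega, by dsimp only; omega, by dsimp only; omega,
          extA_lift h l k s h1 (by omega) h3 h4 (by omega) h6⟩
    · refine ⟨by omega, by omega, by omega, by omega, by omega, by omega, by omega, by omega,
        ?_, ?_, rfl⟩
      · unfold Bef
        rw [if_pos (by omega), h.top' k h1 (by omega), h.top (k + 1) (by omega) (by omega)]
        omega
      · intro x x1 x2 x3 x4 x5
        obtain ⟨x, rfl⟩ : ∃ q', x = q' + 1 := ⟨x - 1, by omega⟩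
        unfold Bef at x4 x5
        rw [if_pos (by omega), h.top' k h1 (by omega), h.top x (by omega) (by omega)] at x4
        unfold Forb
        omega
    · exact ⟨by omega, by omega, by omega, by omega, by omega, rfl⟩

theorem extD_nu {n : ℕ} {u : List ℕ} (hu : IsReduced n u)
    (hw : IsReduced (n + 1) (u ++ descWord (n + 1))) :
    ExtD n (Dim n) (nu (u ++ descWord (n + 1))) (nu u) where
  low := by
    intro r s h1 h2 h3 h4 h5
    rcases Nat.lt_or_ge r s with h | h
    · exact nuD_low hu hw h1 h h4
    · rw [nu_symm, nu_symm u]; exact nuD_low hu hw h3 (by omega) h2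
  le := fun r s h1 h2 h3 h4 h5 => ((arr_nu hu).rng' h1 h2 h3 h4 (by omega)).2
  top := fun r h1 h2 => nuD_top hu hw h1 h2
  top' := fun r h1 h2 => by rw [nu_symm]; exact nuD_top hu hw h1 h2

theorem extA_nu {n : ℕ} {u : List ℕ} (hu : IsReduced n u)
    (hw : IsReduced (n + 1) (u.map (· + 1) ++ ascWord (n + 1))) :
    ExtA n (Dim n) (nu (u.map (· + 1) ++ ascWord (n + 1))) (nu u) where
  low := by
    intro r s h1 h2 h3 h4 h5
    rcases Nat.lt_or_ge r s with h | h
    · exact nuA_low hu hw h1 h h4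
    · rw [nu_symm, nu_symm u]; exact nuA_low hu hw h3 (by omega) h2
  le := fun r s h1 h2 h3 h4 h5 => ((arr_nu hu).rng' h1 h2 h3 h4 (by omega)).2
  top := fun r h1 h2 => by
    rw [nuA_top hu hw (by omega) (by omega)]; omega
  top' := fun r h1 h2 => by
    rw [nu_symm, nuA_top hu hw (by omega) (by omega)]; omega


/-! ### String polytopes in sequence coordinates -/

def StrC (n : ℕ) (w : List ℕ) (t : ℕ → ℝ) : Prop :=
  ∀ k l, WP n (nu w) k l → 0 ≤ wsum (fun r s => t (nu w r s - 1)) k l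

def StrL (n : ℕ) (w : List ℕ) (L t : ℕ → ℝ) : Prop :=
  ∀ j, j < Dim n → t j ≤ L (letterAt w (j + 1) - 1) - L (letterAt w (j + 1)) +
    ∑ k ∈ Finset.range (Dim n),
      if j < k then sco (letterAt w (j + 1)) (letterAt w (k + 1)) * t k else 0

def Chain (n : ℕ) (t : ℕ → ℝ) : Prop :=
  (∀ i, i < n → t (Dim n + (i + 1)) ≤ t (Dim n + i)) ∧ 0 ≤ t (Dim n + n)

theorem strC_D {n : ℕ} {u : List ℕ} (hu : IsReduced n u)
    (hw : IsReduced (n + 1) (u ++ descWord (n + 1))) (t : ℕ → ℝ) :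
    StrC (n + 1) (u ++ descWord (n + 1)) t ↔ StrC n u t ∧ Chain n t := by
  have hE := extD_nu hu hw
  have hcong : ∀ k l, WP n (nu u) k l →
      wsum (fun r s => t (nu (u ++ descWord (n + 1)) r s - 1)) k l =
      wsum (fun r s => t (nu u r s - 1)) k l := by
    intro k l hl
    apply wsum_congr_wp _ _ _ l hl
    intro r s h1 h2 h3
    rw [hE.low r s h1 (by omega) (by omega) h3 (by omega)]
  unfold StrC
  constructor
  · intro h
    refine ⟨?_, ?_, ?_⟩
    · intro k l hl
      rw [← hcong k l hl]
      exact h k l ((extD_wp hE k l).2 (Or.inl hl))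
    · intro i hi
      have := h (i + 1) [n + 2, i + 1 + 1] ((extD_wp hE _ _).2 (Or.inr (Or.inl ⟨by omega, by omega, rfl⟩)))
      simp only [wsum] at this
      rw [if_pos (by omega), if_neg (by omega), hE.top (i + 1) (by omega) (by omega),
        hE.top (i + 1 + 1) (by omega) (by omega)] at this
      rw [show Dim n + (i + 1) - 1 = Dim n + i by omega,
        show Dim n + (i + 1 + 1) - 1 = Dim n + (i + 1) by omega] at this
      linarith
    · have := h (n + 1) [n + 2] ((extD_wp hE _ _).2 (Or.inr (Or.inr ⟨rfl, rfl⟩)))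
      simp only [wsum] at this
      rw [if_pos (by omega), hE.top (n + 1) (by omega) (by omega),
        show Dim n + (n + 1) - 1 = Dim n + n by omega] at this
      linarith
  · rintro ⟨h1, h2, h3⟩ k l hl
    rcases (extD_wp hE k l).1 hl with hl | ⟨k1, k2, rfl⟩ | ⟨rfl, rfl⟩
    · rw [hcong k l hl]; exact h1 k l hl
    · obtain ⟨i, rfl⟩ : ∃ q', k = q' + 1 := ⟨k - 1, by omega⟩
      have := h2 i (by omega)
      simp only [wsum]
      rw [if_pos (by omega), if_neg (by omega), hE.top (i + 1) (by omega) (by omega),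
        hE.top (i + 1 + 1) (by omega) (by omega),
        show Dim n + (i + 1) - 1 = Dim n + i by omega,
        show Dim n + (i + 1 + 1) - 1 = Dim n + (i + 1) by omega]
      linarith
    · simp only [wsum]
      rw [if_pos (by omega), hE.top (n + 1) (by omega) (by omega),
        show Dim n + (n + 1) - 1 = Dim n + n by omega]
      linarith

theorem wsum_shift (τ : ℕ → ℕ → ℝ) (l : List ℕ) : ∀ r,
    wsum τ (r + 1) (l.map (· + 1)) = wsum (fun a b => τ (a + 1) (b + 1)) r l := by
  induction l with
  | nil => intro r; rfl
  | cons q l ih =>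
    intro r
    simp only [List.map_cons, wsum, ih, Nat.add_lt_add_iff_right]

theorem strC_A {n : ℕ} {u : List ℕ} (hu : IsReduced n u)
    (hw : IsReduced (n + 1) (u.map (· + 1) ++ ascWord (n + 1))) (t : ℕ → ℝ) :
    StrC (n + 1) (u.map (· + 1) ++ ascWord (n + 1)) t ↔ StrC n u t ∧ Chain n t := by
  have hE := extA_nu hu hw
  have hcong : ∀ k l, WP n (nu u) k l →
      wsum (fun r s => t (nu (u.map (· + 1) ++ ascWord (n + 1)) r s - 1)) (k + 1) (l.map (· + 1)) =
      wsum (fun r s => t (nu u r s - 1)) k l := by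
    intro k l hl
    rw [wsum_shift]
    apply wsum_congr_wp _ _ _ l hl
    intro r s h1 h2 h3
    rw [hE.low r s h1 (by omega) (by omega) h3 (by omega)]
  unfold StrC
  constructor
  · intro h
    refine ⟨?_, ?_, ?_⟩
    · intro k l hl
      rw [← hcong k l hl]
      exact h _ _ ((extA_wp hE k _).2 (Or.inl ⟨l, rfl, hl⟩))
    · intro i hi
      have := h (n - i + 1) [1, n - i + 2] ((extA_wp hE _ _).2 (Or.inr (Or.inl ⟨by omega, by omega, rfl⟩)))
      simp only [wsum] at this
      rw [if_neg (by omega), if_pos (by omega), hE.top (n - i) (by omega) (by omega),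
        hE.top (n - i + 1) (by omega) (by omega)] at this
      rw [show Dim n + (n + 2 - (n - i)) - 1 = Dim n + (i + 1) by omega,
        show Dim n + (n + 2 - (n - i + 1)) - 1 = Dim n + i by omega] at this
      linarith
    · have := h (0 + 1) [2] ((extA_wp hE _ _).2 (Or.inr (Or.inr ⟨rfl, rfl⟩)))
      simp only [wsum] at this
      rw [if_pos (by omega), hE.top 1 (by omega) (by omega),
        show Dim n + (n + 2 - 1) - 1 = Dim n + n by omega] at this
      linarith
  · rintro ⟨h1, h2, h3⟩ k l hl
    obtain ⟨k, rfl⟩ : ∃ q', k = q' + 1 := ⟨k - 1, by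
      cases l with
      | nil => exact hl.elim
      | cons a b => have := hl.1; omega⟩
    rcases (extA_wp hE k l).1 hl with ⟨l', rfl, hl2⟩ | ⟨k1, k2, rfl⟩ | ⟨rfl, rfl⟩
    · rw [hcong k l' hl2]; exact h1 k l' hl2
    · have := h2 (n - k) (by omega)
      simp only [wsum]
      rw [if_neg (by omega), if_pos (by omega), hE.top k (by omega) (by omega),
        hE.top (k + 1) (by omega) (by omega),
        show Dim n + (n + 2 - k) - 1 = Dim n + (n - k + 1) by omega,
        show Dim n + (n + 2 - (k + 1)) - 1 = Dim n + (n - k) by omega]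
      linarith
    · simp only [wsum]
      rw [if_pos (by omega), hE.top 1 (by omega) (by omega),
        show Dim n + (n + 2 - 1) - 1 = Dim n + n by omega]
      linarith

theorem sco_sum (c : ℕ) (f : ℕ → ℝ) (m : ℕ) : ∑ d ∈ Finset.range m, sco (c + 1) (d + 1) * f d =
    (if c < m then -2 * f c else 0) + (if c + 1 < m then f (c + 1) else 0) +
      (if 1 ≤ c ∧ c ≤ m then f (c - 1) else 0) := by
  induction m with
  | zero =>
    rw [if_neg (by omega), if_neg (by omega), if_neg (by omega)]
    simp
  | succ m ih =>
    rw [Finset.sum_range_succ, ih]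
    unfold sco
    rcases Nat.lt_trichotomy m c with h | h | h
    · by_cases h2 : m + 1 = c
      · subst h2
        rw [if_neg (show ¬ (m + 1 < m) by omega), if_neg (show ¬ (m + 1 + 1 < m) by omega),
          if_neg (show ¬ (1 ≤ m + 1 ∧ m + 1 ≤ m) by omega),
          if_neg (show ¬ (m + 1 < m + 1) by omega), if_neg (show ¬ (m + 1 + 1 < m + 1) by omega),
          if_pos (show 1 ≤ m + 1 ∧ m + 1 ≤ m + 1 by omega)]
        simp
      · rw [if_neg (by omega), if_neg (by omega), if_neg (by omega), if_neg (by omega),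
          if_neg (by omega), if_neg (by omega), if_neg (by omega), if_neg (by omega)]
        simp
    · subst h
      rcases Nat.eq_zero_or_pos m with h0 | h0
      · subst h0; simp
      · rw [if_neg (by omega), if_neg (by omega), if_pos (by omega), if_pos (by omega),
          if_pos (by omega), if_neg (by omega), if_pos (by omega)]
        ring
    · have e : (if 1 ≤ c ∧ c ≤ m then f (c - 1) else 0) =
          (if 1 ≤ c ∧ c ≤ m + 1 then f (c - 1) else 0) := by
        by_cases h0 : 1 ≤ c
        · rw [if_pos (by omega), if_pos (by omega)]
        · rw [if_neg (by omega), if_neg (by omega)]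
      rw [e]
      generalize (if 1 ≤ c ∧ c ≤ m + 1 then f (c - 1) else 0) = z
      by_cases h2 : m = c + 1
      · subst h2
        rw [if_pos (by omega), if_neg (by omega), if_neg (by omega), if_pos (by omega),
          if_pos (by omega), if_pos (by omega)]
        ring
      · rw [if_pos (by omega), if_pos (by omega), if_neg (by omega), if_neg (by omega),
          if_pos (by omega), if_pos (by omega)]
        ring

theorem tail_sum (n i : ℕ) (hi : i ≤ n) (a f : ℕ → ℝ) (h1 : i < n → a (i + 1) = 1)
    (h2 : ∀ d, i + 1 < d → d ≤ n → a d = 0) :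
    ∑ d ∈ Finset.range (n + 1), (if i < d then a d * f d else 0) =
      if i < n then f (i + 1) else 0 := by
  by_cases h : i < n
  · rw [if_pos h, Finset.sum_eq_single (i + 1)]
    · rw [if_pos (by omega), h1 h, one_mul]
    · intro b hb hne
      rw [Finset.mem_range] at hb
      split_ifs with hb2
      · rw [h2 b (by omega) (by omega), zero_mul]
      · rfl
    · intro hb; exact absurd (Finset.mem_range.2 (by omega)) hb
  · rw [if_neg h]
    apply Finset.sum_eq_zero
    intro b hb
    rw [Finset.mem_range] at hb
    rw [if_neg (by omega)]

def muD (n : ℕ) (L t : ℕ → ℝ) (c : ℕ) : ℝ :=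
  L c - t (Dim n + (n - c)) + (if c = 0 then 0 else t (Dim n + (n + 1 - c)))

def muA (n : ℕ) (L t : ℕ → ℝ) (c : ℕ) : ℝ :=
  L (c + 1) + t (Dim n + c) - (if c < n then t (Dim n + (c + 1)) else 0)

theorem desc_letter (n i : ℕ) (hi : i < n) : letterAt (descWord n) (i + 1) = n - i := by
  unfold letterAt descWord ascWord
  rw [Nat.add_sub_cancel, List.getD_eq_getElem _ _ (by simpa using hi), List.getElem_reverse]
  simp
  omega

theorem asc_letter (n i : ℕ) (hi : i < n) : letterAt (ascWord n) (i + 1) = i + 1 := by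
  unfold letterAt ascWord
  rw [Nat.add_sub_cancel, List.getD_eq_getElem _ _ (by simpa using hi)]
  simp

/-- the `λ`-part splits for a word `p ++ b` with `b` of length `n + 1`. -/
theorem strL_split {n : ℕ} {p b : List ℕ} (hp : p.length = Dim n) (L t : ℕ → ℝ) :
    StrL (n + 1) (p ++ b) L t ↔
    (∀ j, j < Dim n → t j ≤ (L (letterAt p (j + 1) - 1) - L (letterAt p (j + 1)) +
      ∑ d ∈ Finset.range (n + 1), sco (letterAt p (j + 1)) (letterAt b (d + 1)) * t (Dim n + d)) +
      ∑ k ∈ Finset.range (Dim n),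
      if j < k then sco (letterAt p (j + 1)) (letterAt p (k + 1)) * t k else 0) ∧
    ∀ i, i ≤ n → t (Dim n + i) ≤ L (letterAt b (i + 1) - 1) - L (letterAt b (i + 1)) +
      ∑ d ∈ Finset.range (n + 1),
        if i < d then sco (letterAt b (i + 1)) (letterAt b (d + 1)) * t (Dim n + d) else 0 := by
  have hlow : ∀ j, j < Dim n → letterAt (p ++ b) (j + 1) = letterAt p (j + 1) :=
    fun j hj => letter_pre _ _ _ (by omega)
  have hhigh : ∀ i, letterAt (p ++ b) (Dim n + i + 1) = letterAt b (i + 1) := by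
    intro i
    rw [letter_suf _ _ _ (by omega)]
    congr 1
    omega
  unfold StrL
  rw [Dim_succ]
  constructor
  · intro h
    constructor
    · intro j hj
      have := h j (by omega)
      rw [Finset.sum_range_add, hlow j hj] at this
      have e1 : ∑ k ∈ Finset.range (Dim n), (if j < k then sco (letterAt p (j + 1))
          (letterAt (p ++ b) (k + 1)) * t k else 0) = ∑ k ∈ Finset.range (Dim n),
          if j < k then sco (letterAt p (j + 1)) (letterAt p (k + 1)) * t k else 0 := by
        apply Finset.sum_congr rfl
        intro k hk
        rw [hlow k (Finset.mem_range.1 hk)]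
      have e2 : ∑ d ∈ Finset.range (n + 1), (if j < Dim n + d then sco (letterAt p (j + 1))
          (letterAt (p ++ b) (Dim n + d + 1)) * t (Dim n + d) else 0) = 
          ∑ d ∈ Finset.range (n + 1),
            sco (letterAt p (j + 1)) (letterAt b (d + 1)) * t (Dim n + d) := by
        apply Finset.sum_congr rfl
        intro k hk
        rw [hhigh, if_pos (by omega)]
      rw [e1, e2] at this
      linarith
    · intro i hi
      have := h (Dim n + i) (by omega)
      rw [Finset.sum_range_add, hhigh] at this
      have e1 : ∑ k ∈ Finset.range (Dim n), (if Dim n + i < k then sco (letterAt b (i + 1))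
          (letterAt (p ++ b) (k + 1)) * t k else 0) = 0 := by
        apply Finset.sum_eq_zero
        intro k hk
        rw [if_neg (by have := Finset.mem_range.1 hk; omega)]
      simp only [hhigh, Nat.add_lt_add_iff_left] at this
      rw [e1] at this
      linarith
  · rintro ⟨h1, h2⟩ j hj
    rw [Finset.sum_range_add]
    by_cases hjn : j < Dim n
    · have := h1 j hjn
      rw [hlow j hjn]
      have e1 : ∑ k ∈ Finset.range (Dim n), (if j < k then sco (letterAt p (j + 1))
          (letterAt (p ++ b) (k + 1)) * t k else 0) = ∑ k ∈ Finset.range (Dim n),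
          if j < k then sco (letterAt p (j + 1)) (letterAt p (k + 1)) * t k else 0 := by
        apply Finset.sum_congr rfl
        intro k hk
        rw [hlow k (Finset.mem_range.1 hk)]
      have e2 : ∑ d ∈ Finset.range (n + 1), (if j < Dim n + d then sco (letterAt p (j + 1))
          (letterAt (p ++ b) (Dim n + d + 1)) * t (Dim n + d) else 0) = 
          ∑ d ∈ Finset.range (n + 1),
            sco (letterAt p (j + 1)) (letterAt b (d + 1)) * t (Dim n + d) := by
        apply Finset.sum_congr rfl
        intro k hk
        rw [hhigh, if_pos (by omega)]
      rw [e1, e2]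
      linarith
    · obtain ⟨i, rfl⟩ : ∃ i, j = Dim n + i := ⟨j - Dim n, by omega⟩
      have := h2 i (by omega)
      have e1 : ∑ k ∈ Finset.range (Dim n), (if Dim n + i < k then sco (letterAt b (i + 1))
          (letterAt (p ++ b) (k + 1)) * t k else 0) = 0 := by
        apply Finset.sum_eq_zero
        intro k hk
        rw [if_neg (by have := Finset.mem_range.1 hk; omega)]
      simp only [hhigh, Nat.add_lt_add_iff_left]
      rw [e1]
      linarith

theorem strL_D {n : ℕ} {u : List ℕ} (hu : IsReduced n u) (L t : ℕ → ℝ) :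
    StrL (n + 1) (u ++ descWord (n + 1)) L t ↔ StrL n u (muD n L t) t ∧
      ∀ c, c ≤ n → L (c + 1) ≤ muD n L t c := by
  rw [strL_split hu.1]
  have key : ∀ j, j < Dim n → (L (letterAt u (j + 1) - 1) - L (letterAt u (j + 1)) +
      ∑ d ∈ Finset.range (n + 1),
        sco (letterAt u (j + 1)) (letterAt (descWord (n + 1)) (d + 1)) * t (Dim n + d)) =
      muD n L t (letterAt u (j + 1) - 1) - muD n L t (letterAt u (j + 1)) := by
    intro j hj
    obtain ⟨h1, h2⟩ := letter_rng hu ⟨j, hj⟩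
    simp only at h1 h2
    obtain ⟨c, hc⟩ : ∃ c, letterAt u (j + 1) = c + 1 := ⟨letterAt u (j + 1) - 1, by omega⟩
    rw [hc] at h1 h2 ⊢
    rw [← Finset.sum_range_reflect]
    have e : ∑ d ∈ Finset.range (n + 1), sco (c + 1)
        (letterAt (descWord (n + 1)) (n + 1 - 1 - d + 1)) * t (Dim n + (n + 1 - 1 - d)) =
        ∑ d ∈ Finset.range (n + 1), sco (c + 1) (d + 1) * (fun d => t (Dim n + (n - d))) d := by
      apply Finset.sum_congr rfl
      intro d hd
      rw [Finset.mem_range] at hd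
      rw [desc_letter _ _ (by omega), show n + 1 - (n + 1 - 1 - d) = d + 1 by omega]
      rfl
    rw [e, sco_sum, if_pos (by omega), if_pos (by omega)]
    unfold muD
    simp only [Nat.add_sub_cancel, if_neg (show ¬ c + 1 = 0 by omega)]
    rw [show n + 1 - (c + 1) = n - c by omega]
    by_cases h0 : c = 0
    · rw [if_neg (by omega), if_pos h0]; ring
    · rw [if_pos (by omega), if_neg h0, show n - (c - 1) = n + 1 - c by omega]; ring
  have key2 : ∀ i, i ≤ n → ∑ d ∈ Finset.range (n + 1), (if i < d then
      sco (letterAt (descWord (n + 1)) (i + 1)) (letterAt (descWord (n + 1)) (d + 1)) *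
        t (Dim n + d) else 0) = if i < n then t (Dim n + (i + 1)) else 0 := by
    intro i hi
    apply tail_sum n i hi (fun d => sco (letterAt (descWord (n + 1)) (i + 1))
      (letterAt (descWord (n + 1)) (d + 1))) (fun d => t (Dim n + d))
    · intro h
      rw [desc_letter _ _ (by omega), desc_letter _ _ (by omega)]
      unfold sco
      rw [if_neg (by omega), if_pos (by omega)]
    · intro d h1 h2
      rw [desc_letter _ _ (by omega), desc_letter _ _ (by omega)]
      unfold sco
      rw [if_neg (by omega), if_neg (by omega)]
  constructor
  · rintro ⟨h1, h2⟩
    refine ⟨?_, ?_⟩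
    · intro j hj
      rw [← key j hj]
      exact h1 j hj
    · intro c hc
      have := h2 (n - c) (by omega)
      rw [key2 _ (by omega), desc_letter _ _ (by omega), show n + 1 - (n - c) = c + 1 by omega] at this
      unfold muD
      rw [Nat.add_sub_cancel] at this
      by_cases h0 : c = 0
      · rw [if_neg (by omega)] at this
        rw [if_pos h0]; linarith
      · rw [if_pos (by omega), show n - c + 1 = n + 1 - c by omega] at this
        rw [if_neg h0]; linarith
  · rintro ⟨h1, h2⟩
    refine ⟨?_, ?_⟩
    · intro j hj
      rw [key j hj]
      exact h1 j hj
    · intro i hi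
      have := h2 (n - i) (by omega)
      rw [key2 _ (by omega), desc_letter _ _ (by omega), show n + 1 - i = n - i + 1 by omega,
        Nat.add_sub_cancel]
      unfold muD at this
      rw [show n - (n - i) = i by omega] at this
      by_cases h0 : i < n
      · rw [if_neg (by omega), show n + 1 - (n - i) = i + 1 by omega] at this
        rw [if_pos h0]; linarith
      · rw [if_pos (by omega)] at this
        rw [if_neg h0]; linarith

theorem strL_A {n : ℕ} {u : List ℕ} (hu : IsReduced n u) (L t : ℕ → ℝ) :
    StrL (n + 1) (u.map (· + 1) ++ ascWord (n + 1)) L t ↔ StrL n u (muA n L t) t ∧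
      ∀ c, c ≤ n → muA n L t c ≤ L c := by
  have hlen : u.length = Dim n := hu.1
  rw [strL_split (by rw [List.length_map]; exact hu.1)]
  have key : ∀ j, j < Dim n → (L (letterAt (u.map (· + 1)) (j + 1) - 1) -
      L (letterAt (u.map (· + 1)) (j + 1)) +
      ∑ d ∈ Finset.range (n + 1), sco (letterAt (u.map (· + 1)) (j + 1))
        (letterAt (ascWord (n + 1)) (d + 1)) * t (Dim n + d)) =
      muA n L t (letterAt u (j + 1) - 1) - muA n L t (letterAt u (j + 1)) := by
    intro j hj
    obtain ⟨h1, h2⟩ := letter_rng hu ⟨j, hj⟩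
    simp only at h1 h2
    rw [letter_shift _ _ (by omega)]
    obtain ⟨c, hc⟩ : ∃ c, letterAt u (j + 1) = c := ⟨_, rfl⟩
    rw [hc] at h1 h2 ⊢
    have e : ∑ d ∈ Finset.range (n + 1), sco (c + 1)
        (letterAt (ascWord (n + 1)) (d + 1)) * t (Dim n + d) =
        ∑ d ∈ Finset.range (n + 1), sco (c + 1) (d + 1) * (fun d => t (Dim n + d)) d := by
      apply Finset.sum_congr rfl
      intro d hd
      rw [Finset.mem_range] at hd
      rw [asc_letter _ _ (by omega)]
    rw [e, sco_sum, if_pos (by omega), if_pos (show 1 ≤ c ∧ c ≤ n + 1 by omega)]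
    unfold muA
    rw [Nat.sub_add_cancel h1, if_pos (show c - 1 < n by omega), Nat.add_sub_cancel]
    simp only [Nat.add_lt_add_iff_right]
    ring
  have key0 : ∀ j, j < Dim n → ∑ k ∈ Finset.range (Dim n),
      (if j < k then sco (letterAt (u.map (· + 1)) (j + 1)) (letterAt (u.map (· + 1)) (k + 1)) * t k
        else 0) = ∑ k ∈ Finset.range (Dim n),
      if j < k then sco (letterAt u (j + 1)) (letterAt u (k + 1)) * t k else 0 := by
    intro j hj
    apply Finset.sum_congr rfl
    intro k hk
    rw [Finset.mem_range] at hk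
    rw [letter_shift _ _ (by omega), letter_shift _ _ (by omega)]
    unfold sco
    simp only [Nat.add_right_cancel_iff]
  have key2 : ∀ i, i ≤ n → ∑ d ∈ Finset.range (n + 1), (if i < d then
      sco (letterAt (ascWord (n + 1)) (i + 1)) (letterAt (ascWord (n + 1)) (d + 1)) *
        t (Dim n + d) else 0) = if i < n then t (Dim n + (i + 1)) else 0 := by
    intro i hi
    apply tail_sum n i hi (fun d => sco (letterAt (ascWord (n + 1)) (i + 1))
      (letterAt (ascWord (n + 1)) (d + 1))) (fun d => t (Dim n + d))
    · intro h
      rw [asc_letter _ _ (by omega), asc_letter _ _ (by omega)]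
      unfold sco
      rw [if_neg (by omega), if_pos (by omega)]
    · intro d h1 h2
      rw [asc_letter _ _ (by omega), asc_letter _ _ (by omega)]
      unfold sco
      rw [if_neg (by omega), if_neg (by omega)]
  constructor
  · rintro ⟨h1, h2⟩
    refine ⟨?_, ?_⟩
    · intro j hj
      rw [← key j hj, ← key0 j hj]
      exact h1 j hj
    · intro c hc
      have := h2 c (by omega)
      rw [key2 _ (by omega), asc_letter _ _ (by omega), Nat.add_sub_cancel] at this
      unfold muA
      linarith
  · rintro ⟨h1, h2⟩
    refine ⟨?_, ?_⟩
    · intro j hj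
      rw [key j hj, key0 j hj]
      exact h1 j hj
    · intro i hi
      have := h2 i (by omega)
      rw [key2 _ (by omega), asc_letter _ _ (by omega), Nat.add_sub_cancel]
      unfold muA at this
      linarith

def StrP (n : ℕ) (w : List ℕ) (L t : ℕ → ℝ) : Prop := StrC n w t ∧ StrL n w L t

theorem strP_D {n : ℕ} {u : List ℕ} (hu : IsReduced n u)
    (hw : IsReduced (n + 1) (u ++ descWord (n + 1))) (L t : ℕ → ℝ) :
    StrP (n + 1) (u ++ descWord (n + 1)) L t ↔
      (∀ c, c ≤ n → L (c + 1) ≤ muD n L t c ∧ muD n L t c ≤ L c) ∧ StrP n u (muD n L t) t := by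
  unfold StrP
  rw [strC_D hu hw, strL_D hu]
  have : Chain n t ↔ ∀ c, c ≤ n → muD n L t c ≤ L c := by
    unfold Chain muD
    constructor
    · rintro ⟨h1, h2⟩ c hc
      by_cases h0 : c = 0
      · rw [if_pos h0, h0, Nat.sub_zero]; linarith
      · have := h1 (n - c) (by omega)
        rw [if_neg h0]
        rw [show n - c + 1 = n + 1 - c by omega] at this
        linarith
    · intro h
      constructor
      · intro i hi
        have := h (n - i) (by omega)
        rw [if_neg (by omega), show n - (n - i) = i by omega,
          show n + 1 - (n - i) = i + 1 by omega] at this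
        linarith
      · have := h 0 (by omega)
        rw [if_pos rfl, Nat.sub_zero] at this
        linarith
  rw [this]
  constructor
  · rintro ⟨⟨a, b⟩, c, d⟩
    exact ⟨fun e he => ⟨d e he, b e he⟩, a, c⟩
  · rintro ⟨a, b, c⟩
    exact ⟨⟨b, fun e he => (a e he).2⟩, c, fun e he => (a e he).1⟩

theorem strP_A {n : ℕ} {u : List ℕ} (hu : IsReduced n u)
    (hw : IsReduced (n + 1) (u.map (· + 1) ++ ascWord (n + 1))) (L t : ℕ → ℝ) :
    StrP (n + 1) (u.map (· + 1) ++ ascWord (n + 1)) L t ↔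
      (∀ c, c ≤ n → L (c + 1) ≤ muA n L t c ∧ muA n L t c ≤ L c) ∧ StrP n u (muA n L t) t := by
  unfold StrP
  rw [strC_A hu hw, strL_A hu]
  have : Chain n t ↔ ∀ c, c ≤ n → L (c + 1) ≤ muA n L t c := by
    unfold Chain muA
    constructor
    · rintro ⟨h1, h2⟩ c hc
      by_cases h0 : c < n
      · rw [if_pos h0]
        have := h1 c h0
        linarith
      · rw [if_neg h0, show c = n by omega]
        linarith
    · intro h
      constructor
      · intro i hi
        have := h i (by omega)
        rw [if_pos (by omega)] at this
        linarith
      · have := h n (by omega)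
        rw [if_neg (by omega)] at this
        linarith
  rw [this]
  constructor
  · rintro ⟨⟨a, b⟩, c, d⟩
    exact ⟨fun e he => ⟨b e he, d e he⟩, a, c⟩
  · rintro ⟨a, b, c⟩
    exact ⟨⟨b, fun e he => (a e he).1⟩, c, fun e he => (a e he).2⟩


/-! ### Two-move invariance -/

theorem wt_same {n : ℕ} {ν ν' : ℕ → ℕ → ℕ} (hs : ∀ a b, ν a b = ν b a)
    (hs' : ∀ a b, ν' a b = ν' b a) (h : SameOrd n ν ν') (k : ℕ) (l : List ℕ) :
    ∀ p r, 1 ≤ p → p ≤ n + 1 → 1 ≤ r → r ≤ n + 1 → p ≠ r → WT n ν k p r l → WT n ν' k p r l := by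
  induction l with
  | nil => intro p r _ _ _ _ _ h; exact h
  | cons q l ih =>
    intro p r p1 p2 r1 r2 hpr ⟨q1, q2, q3, q4, q5, q6⟩
    have key : ∀ a b, 1 ≤ a → a ≤ n + 1 → 1 ≤ b → b ≤ n + 1 → a ≠ r → b ≠ r →
        (Bef k r (ν r a) (ν r b) ↔ Bef k r (ν' r a) (ν' r b)) := by
      intro a b a1 a2 b1 b2 ar br
      unfold Bef
      split_ifs
      · exact h r b a r1 r2 b1 b2 a1 a2 br.symm ar.symm
      · exact h r a b r1 r2 a1 a2 b1 b2 ar.symm br.symm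
    refine ⟨q1, q2, q3, ?_, ?_, ih r q r1 r2 q1 q2 (Ne.symm q3) q6⟩
    · rw [hs'] ; rw [hs] at q4
      exact (key p q p1 p2 q1 q2 hpr q3).1 q4
    · intro x x1 x2 x3 b1 b2
      apply q5 x x1 x2 x3
      · rw [hs]; rw [hs'] at b1
        exact (key p x p1 p2 x1 x2 hpr x3).2 b1
      · exact (key x q x1 x2 q1 q2 x3 q3).2 b2

theorem wp_same {n : ℕ} {ν ν' : ℕ → ℕ → ℕ} (hs : ∀ a b, ν a b = ν b a)
    (hs' : ∀ a b, ν' a b = ν' b a) (h : SameOrd n ν ν') (k : ℕ) (l : List ℕ)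
    (hl : WP n ν k l) : WP n ν' k l := by
  match l, hl with
  | s :: l, ⟨h1, h2, h3, h4, h5, h6⟩ =>
    exact ⟨h1, h2, h3, h4, h5, wt_same hs hs' h k l k s h1 (by omega) h3 h4 (Ne.symm h5) h6⟩

theorem strC_move {n : ℕ} {w w' : List ℕ} (hw : IsReduced n w) (hs : TwoMoveStep w w') {j : ℕ}
    (hj : MoveData w w' j) (t : ℕ → ℝ) :
    StrC n w' t ↔ StrC n w (fun i => t (Equiv.swap j (j + 1) i)) := by
  have hw' := step_reduced hw hs
  have hso := step_sameOrd hw hs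
  have hso' := step_sameOrd hw' (step_symm hs)
  have hc : ∀ k l, WP n (nu w) k l → wsum (fun r s => t (nu w' r s - 1)) k l =
      wsum (fun r s => t (Equiv.swap j (j + 1) (nu w r s - 1))) k l := by
    intro k l hl
    apply wsum_congr_wp _ _ _ l hl
    intro r s h1 h2 h3
    rw [move_nu hw hw' hj h1 h2 h3, Nat.add_sub_cancel]
  unfold StrC
  constructor
  · intro h k l hl
    rw [← hc k l hl]
    exact h k l (wp_same (nu_symm w) (nu_symm w') hso k l hl)
  · intro h k l hl
    have := wp_same (nu_symm w') (nu_symm w) hso' k l hl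
    rw [hc k l this]
    exact h k l this

theorem sco_far {c d : ℕ} (h : c + 1 < d ∨ d + 1 < c) : sco c d = 0 := by
  unfold sco
  rw [if_neg (by omega), if_neg (by omega)]

theorem strL_move {n : ℕ} {w w' : List ℕ} (hw : IsReduced n w) {j : ℕ}
    (hj : MoveData w w' j) (L t : ℕ → ℝ) :
    StrL n w' L t ↔ StrL n w L (fun i => t (Equiv.swap j (j + 1) i)) := by
  have hlen : w.length = Dim n := hw.1
  have hj1 := hj.hj
  have hlt : ∀ i, i < Dim n → Equiv.swap j (j + 1) i < Dim n := by
    intro i hi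
    rw [Equiv.swap_apply_def]; split_ifs <;> omega
  have hfar : sco (letterAt w (j + 1)) (letterAt w (j + 2)) = 0 := sco_far hj.far
  have hfar' : sco (letterAt w (j + 2)) (letterAt w (j + 1)) = 0 := sco_far hj.far.symm
  have key : ∀ i, i < Dim n → (∑ k ∈ Finset.range (Dim n),
      if Equiv.swap j (j + 1) i < k then
        sco (letterAt w' (Equiv.swap j (j + 1) i + 1)) (letterAt w' (k + 1)) * t k else 0) =
      ∑ k ∈ Finset.range (Dim n),
      if i < k then sco (letterAt w (i + 1)) (letterAt w (k + 1)) *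
        t (Equiv.swap j (j + 1) k) else 0 := by
    intro i hi
    apply Finset.sum_bij' (fun k _ => Equiv.swap j (j + 1) k) (fun k _ => Equiv.swap j (j + 1) k)
    · intro a ha; simpa using hlt a (by simpa using ha)
    · intro a ha; simpa using hlt a (by simpa using ha)
    · intro a _; simp
    · intro a _; simp
    · intro k _
      rw [hj.letter, hj.letter, Equiv.swap_apply_self, Equiv.swap_apply_self]
      by_cases h1 : i = j ∧ Equiv.swap j (j + 1) k = j + 1
      · rw [h1.1, h1.2, hfar]; simp
      by_cases h2 : i = j + 1 ∧ Equiv.swap j (j + 1) k = j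
      · rw [h2.1, h2.2, hfar']; simp
      have : (Equiv.swap j (j + 1) i < k) ↔ i < Equiv.swap j (j + 1) k := by
        rw [Equiv.swap_apply_def, Equiv.swap_apply_def] at *
        split_ifs at * <;> omega
      simp only [this]
  unfold StrL
  constructor
  · intro h i hi
    have := h _ (hlt i hi)
    rw [key i hi, hj.letter, Equiv.swap_apply_self] at this
    exact this
  · intro h i hi
    have h2 := h _ (hlt i hi)
    have h3 := key _ (hlt i hi)
    simp only [Equiv.swap_apply_self] at h2 h3
    rw [h3, hj.letter]
    exact h2

theorem strP_move {n : ℕ} {w w' : List ℕ} (hw : IsReduced n w) (hs : TwoMoveStep w w') {j : ℕ}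
    (hj : MoveData w w' j) (L t : ℕ → ℝ) :
    StrP n w' L t ↔ StrP n w L (fun i => t (Equiv.swap j (j + 1) i)) := by
  unfold StrP
  rw [strC_move hw hs hj, strL_move hw hj]

/-! ### Integral affine families -/

def IA {m : ℕ} (f : (Fin m → ℝ) → ℝ) : Prop :=
  ∃ (c : Fin m → ℤ) (d : ℤ), ∀ x, f x = (∑ j, (c j : ℝ) * x j) + (d : ℝ)

theorem IA.add {m : ℕ} {f g : (Fin m → ℝ) → ℝ} (hf : IA f) (hg : IA g) :
    IA (fun x => f x + g x) := by
  obtain ⟨c, d, h⟩ := hf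
  obtain ⟨c', d', h'⟩ := hg
  refine ⟨fun j => c j + c' j, d + d', fun x => ?_⟩
  simp only [h, h']
  push_cast
  simp only [add_mul, Finset.sum_add_distrib]
  ring

theorem IA.neg {m : ℕ} {f : (Fin m → ℝ) → ℝ} (hf : IA f) : IA (fun x => -f x) := by
  obtain ⟨c, d, h⟩ := hf
  refine ⟨fun j => -c j, -d, fun x => ?_⟩
  simp only [h]
  push_cast
  simp only [neg_mul, Finset.sum_neg_distrib]
  ring

theorem IA.sub {m : ℕ} {f g : (Fin m → ℝ) → ℝ} (hf : IA f) (hg : IA g) :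
    IA (fun x => f x - g x) := by
  simp only [sub_eq_add_neg]
  exact hf.add hg.neg

theorem IA.const {m : ℕ} (d : ℤ) : IA (fun _ : Fin m → ℝ => (d : ℝ)) :=
  ⟨fun _ => 0, d, fun x => by simp⟩

theorem IA.zero {m : ℕ} : IA (fun _ : Fin m → ℝ => (0 : ℝ)) := by
  simpa using IA.const (m := m) 0

theorem IA.coord {m : ℕ} (i : Fin m) : IA (fun x : Fin m → ℝ => x i) :=
  ⟨fun j => if j = i then 1 else 0, 0, fun x => by simp⟩

theorem IA.sum {m : ℕ} {α : Type} (s : Finset α) (f : α → (Fin m → ℝ) → ℝ)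
    (h : ∀ a ∈ s, IA (f a)) : IA (fun x => ∑ a ∈ s, f a x) := by
  induction s using Finset.induction_on with
  | empty => simpa using IA.zero
  | insert a s ha ih =>
    simp only [Finset.sum_insert ha]
    exact (h a (by simp)).add (ih (fun b hb => h b (by simp [hb])))

def Pres (F : (ℕ → ℝ) → (ℕ → ℝ) → ℕ → ℝ) : Prop :=
  ∀ (m : ℕ) (L t : ℕ → (Fin m → ℝ) → ℝ), (∀ c, IA (L c)) → (∀ i, IA (t i)) →
    ∀ i, IA (fun x => F (fun c => L c x) (fun a => t a x) i)

def Loc (n : ℕ) (F : (ℕ → ℝ) → (ℕ → ℝ) → ℕ → ℝ) : Prop :=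
  ∀ L L' t t' : ℕ → ℝ, (∀ c, c ≤ n → L c = L' c) → (∀ i, i < Dim n → t i = t' i) →
    ∀ i, i < Dim n → F L t i = F L' t' i

def GCs : ℕ → (ℕ → ℝ) → (ℕ → ℝ) → Prop
  | 0, _, _ => True
  | n + 1, L, x => (∀ c, c ≤ n → L (c + 1) ≤ x (Dim n + c) ∧ x (Dim n + c) ≤ L c) ∧
      GCs n (fun c => x (Dim n + c)) x

theorem gcs_congr (n : ℕ) : ∀ (L x y : ℕ → ℝ), (∀ i, i < Dim n → x i = y i) →
    GCs n L x → GCs n L y := by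
  induction n with
  | zero => intro L x y _ _; trivial
  | succ n ih =>
    intro L x y h ⟨h1, h2⟩
    have hd := Dim_succ n
    refine ⟨fun c hc => ?_, ?_⟩
    · rw [← h _ (by omega)]; exact h1 c hc
    · have h3 := ih _ x y (fun i hi => h i (by omega)) h2
      cases n with
      | zero => trivial
      | succ k =>
        refine ⟨fun c hc => ?_, h3.2⟩
        have := h3.1 c hc
        simp only at this ⊢
        rw [← h (Dim (k + 1) + (c + 1)) (by omega), ← h (Dim (k + 1) + c) (by omega)]
        exact this

structure Iso (n : ℕ) (w : List ℕ) (F G : (ℕ → ℝ) → (ℕ → ℝ) → ℕ → ℝ) : Prop where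
  pF : Pres F
  pG : Pres G
  lF : Loc n F
  lG : Loc n G
  gf : ∀ L t i, i < Dim n → G L (F L t) i = t i
  fg : ∀ L x i, i < Dim n → F L (G L x) i = x i
  iff : ∀ L t, StrP n w L t ↔ GCs n L (F L t)

def HasIso (n : ℕ) (w : List ℕ) : Prop := ∃ F G, Iso n w F G

theorem hasIso_step {n : ℕ} {w w' : List ℕ} (hw : IsReduced n w) (hs : TwoMoveStep w w')
    (h : HasIso n w) : HasIso n w' := by
  obtain ⟨F, G, h⟩ := h
  obtain ⟨j, hj⟩ := move_data hs
  have hlen : w.length = Dim n := hw.1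
  have hj1 := hj.hj
  have hlt : ∀ i, i < Dim n → Equiv.swap j (j + 1) i < Dim n := by
    intro i hi
    rw [Equiv.swap_apply_def]; split_ifs <;> omega
  refine ⟨fun L t => F L (fun i => t (Equiv.swap j (j + 1) i)),
    fun L x i => G L x (Equiv.swap j (j + 1) i), ?_, ?_, ?_, ?_, ?_, ?_, ?_⟩
  · intro m L t hL ht i
    exact h.pF m L (fun i => t (Equiv.swap j (j + 1) i)) hL (fun i => ht _) i
  · intro m L t hL ht i
    exact h.pG m L t hL ht _
  · intro L L' t t' hL ht i hi
    exact h.lF _ _ _ _ hL (fun i hi => ht _ (hlt i hi)) i hi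
  · intro L L' t t' hL ht i hi
    exact h.lG _ _ _ _ hL ht _ (hlt i hi)
  · intro L t i hi
    rw [h.gf _ _ _ (hlt i hi), Equiv.swap_apply_self]
  · intro L x i hi
    simp only [Equiv.swap_apply_self]
    exact h.fg L x i hi
  · intro L t
    rw [strP_move hw hs hj, h.iff]

theorem hasIso_equiv {n : ℕ} {w w' : List ℕ} (hw : IsReduced n w) (hs : TwoMoveEquiv w w')
    (h : HasIso n w) : HasIso n w' := by
  induction hs with
  | refl => exact h
  | tail h1 h2 ih => exact hasIso_step (equiv_reduced hw h1) h2 ih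

theorem hasIso_ext {n : ℕ} {u w : List ℕ} (mu rec : (ℕ → ℝ) → (ℕ → ℝ) → ℕ → ℝ)
    (hmu : Pres mu) (hrec : Pres rec)
    (lmu : ∀ L L' t t' : ℕ → ℝ, (∀ c, c ≤ n + 1 → L c = L' c) →
      (∀ i, i < Dim (n + 1) → t i = t' i) → ∀ c, c ≤ n → mu L t c = mu L' t' c)
    (lrec : ∀ L L' t t' : ℕ → ℝ, (∀ c, c ≤ n + 1 → L c = L' c) →
      (∀ c, c ≤ n → t c = t' c) → ∀ c, c ≤ n → rec L t c = rec L' t' c)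
    (hrm : ∀ L t c, c ≤ n → rec L (mu L t) c = t (Dim n + c))
    (hmr : ∀ L x t c, (∀ c, c ≤ n → t (Dim n + c) = rec L x c) → c ≤ n → mu L t c = x c)
    (hiff : ∀ L t, StrP (n + 1) w L t ↔
      (∀ c, c ≤ n → L (c + 1) ≤ mu L t c ∧ mu L t c ≤ L c) ∧ StrP n u (mu L t) t)
    (h : HasIso n u) : HasIso (n + 1) w := by
  obtain ⟨F, G, h⟩ := h
  have hd := Dim_succ n
  let F' : (ℕ → ℝ) → (ℕ → ℝ) → ℕ → ℝ := fun L t i =>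
    if i < Dim n then F (mu L t) t i else mu L t (i - Dim n)
  let G' : (ℕ → ℝ) → (ℕ → ℝ) → ℕ → ℝ := fun L x i =>
    if i < Dim n then G (fun c => x (Dim n + c)) x i else
      rec L (fun c => x (Dim n + c)) (i - Dim n)
  have F1 : ∀ L t i, i < Dim n → F' L t i = F (mu L t) t i := fun L t i hi => if_pos hi
  have F2 : ∀ L t c, F' L t (Dim n + c) = mu L t c := by
    intro L t c
    show (if Dim n + c < Dim n then _ else _) = _
    rw [if_neg (by omega), Nat.add_sub_cancel_left]
  have G1 : ∀ L x i, i < Dim n → G' L x i = G (fun c => x (Dim n + c)) x i :=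
    fun L t i hi => if_pos hi
  have G2 : ∀ L x c, G' L x (Dim n + c) = rec L (fun c => x (Dim n + c)) c := by
    intro L t c
    show (if Dim n + c < Dim n then _ else _) = _
    rw [if_neg (by omega), Nat.add_sub_cancel_left]
  have split : ∀ i, i < Dim (n + 1) → i < Dim n ∨ ∃ c, c ≤ n ∧ i = Dim n + c := by
    intro i hi
    by_cases h : i < Dim n
    · exact Or.inl h
    · exact Or.inr ⟨i - Dim n, by omega, by omega⟩
  refine ⟨F', G', ?_, ?_, ?_, ?_, ?_, ?_, ?_⟩
  · intro m L t hL ht i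
    by_cases hi : i < Dim n
    · simp only [F1 _ _ i hi]
      exact h.pF m (fun c x => mu (fun c => L c x) (fun a => t a x) c) t (hmu m L t hL ht) ht i
    · obtain ⟨c, rfl⟩ : ∃ c, i = Dim n + c := ⟨i - Dim n, by omega⟩
      simp only [F2]
      exact hmu m L t hL ht c
  · intro m L t hL ht i
    by_cases hi : i < Dim n
    · simp only [G1 _ _ i hi]
      exact h.pG m (fun c => t (Dim n + c)) t (fun c => ht _) ht i
    · obtain ⟨c, rfl⟩ : ∃ c, i = Dim n + c := ⟨i - Dim n, by omega⟩
      simp only [G2]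
      exact hrec m L (fun c => t (Dim n + c)) hL (fun c => ht _) c
  · intro L L' t t' hL ht i hi
    rcases split i hi with hi | ⟨c, hc, rfl⟩
    · rw [F1 _ _ _ hi, F1 _ _ _ hi]
      exact h.lF _ _ _ _ (fun c hc => lmu _ _ _ _ hL ht c hc) (fun i hi => ht i (by omega)) i hi
    · rw [F2, F2]
      exact lmu _ _ _ _ hL ht c hc
  · intro L L' t t' hL ht i hi
    rcases split i hi with hi | ⟨c, hc, rfl⟩
    · rw [G1 _ _ _ hi, G1 _ _ _ hi]
      exact h.lG _ _ _ _ (fun c hc => ht _ (by omega)) (fun i hi => ht i (by omega)) i hi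
    · rw [G2, G2]
      exact lrec _ _ _ _ hL (fun c hc => ht _ (by omega)) c hc
  · intro L t i hi
    rcases split i hi with hi | ⟨c, hc, rfl⟩
    · rw [G1 _ _ _ hi]
      simp only [F2]
      rw [h.lG _ (mu L t) _ (F (mu L t) t) (fun _ _ => rfl) (fun i hi => F1 L t i hi) i hi]
      exact h.gf _ _ _ hi
    · rw [G2]
      simp only [F2]
      exact hrm L t c hc
  · intro L x i hi
    have hm : ∀ c, c ≤ n → mu L (G' L x) c = x (Dim n + c) := fun c hc =>
      hmr L (fun c => x (Dim n + c)) (G' L x) c (fun c _ => G2 L x c) hc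
    rcases split i hi with hi | ⟨c, hc, rfl⟩
    · rw [F1 _ _ _ hi]
      rw [h.lF _ (fun c => x (Dim n + c)) _ (G (fun c => x (Dim n + c)) x) hm
        (fun i hi => G1 L x i hi) i hi]
      exact h.fg _ _ _ hi
    · rw [F2]
      exact hm c hc
  · intro L t
    rw [hiff, h.iff]
    have e : (fun c => F' L t (Dim n + c)) = mu L t := funext (fun c => F2 L t c)
    show _ ↔ (∀ c, c ≤ n → L (c + 1) ≤ F' L t (Dim n + c) ∧ F' L t (Dim n + c) ≤ L c) ∧
      GCs n (fun c => F' L t (Dim n + c)) (F' L t)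
    rw [e]
    simp only [F2]
    apply and_congr_right
    intro _
    exact ⟨gcs_congr n _ _ _ (fun i hi => (F1 L t i hi).symm),
      gcs_congr n _ _ _ (fun i hi => F1 L t i hi)⟩

def recD (n : ℕ) (L x : ℕ → ℝ) (i : ℕ) : ℝ := ∑ d ∈ Finset.range (n - i + 1), (L d - x d)

def recA (n : ℕ) (L x : ℕ → ℝ) (i : ℕ) : ℝ := ∑ d ∈ Finset.Ico i (n + 1), (x d - L (d + 1))

theorem hasIso_D {n : ℕ} {u : List ℕ} (hu : IsReduced n u)
    (hw : IsReduced (n + 1) (u ++ descWord (n + 1))) (h : HasIso n u) :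
    HasIso (n + 1) (u ++ descWord (n + 1)) := by
  have hd := Dim_succ n
  apply hasIso_ext (muD n) (recD n) ?_ ?_ ?_ ?_ ?_ ?_ (strP_D hu hw) h
  · intro m L t hL ht i
    unfold muD
    by_cases hi : i = 0
    · simp only [if_pos hi]; exact ((hL _).sub (ht _)).add IA.zero
    · simp only [if_neg hi]; exact ((hL _).sub (ht _)).add (ht _)
  · intro m L t hL ht i
    unfold recD
    exact IA.sum _ (fun d x => L d x - t d x) (fun d _ => (hL d).sub (ht d))
  · intro L L' t t' hL ht c hc
    unfold muD
    rw [hL c (by omega), ht _ (by omega)]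
    by_cases hi : c = 0
    · simp only [if_pos hi]
    · simp only [if_neg hi]; rw [ht _ (by omega)]
  · intro L L' t t' hL ht c hc
    unfold recD
    apply Finset.sum_congr rfl
    intro d hd
    rw [Finset.mem_range] at hd
    rw [hL d (by omega), ht d (by omega)]
  · intro L t c hc
    have key : ∀ k, k ≤ n → ∑ d ∈ Finset.range (k + 1), (L d - muD n L t d) =
        t (Dim n + (n - k)) := by
      intro k
      induction k with
      | zero => intro _; simp [muD]
      | succ k ih =>
        intro hk
        rw [Finset.sum_range_succ, ih (by omega)]
        unfold muD
        rw [if_neg (by omega), show n + 1 - (k + 1) = n - k by omega]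
        ring
    unfold recD
    rw [key (n - c) (by omega), show n - (n - c) = c by omega]
  · intro L x t c ht hc
    unfold muD
    rw [ht _ (by omega)]
    by_cases hi : c = 0
    · subst hi
      unfold recD
      rw [if_pos rfl, show n - (n - 0) = 0 by omega]
      simp
    · rw [if_neg hi, show n + 1 - c = n - (c - 1) by omega, ht _ (by omega)]
      unfold recD
      rw [show n - (n - c) + 1 = (c - 1) + 1 + 1 by omega,
        show n - (n - (c - 1)) + 1 = (c - 1) + 1 by omega, Finset.sum_range_succ _ (c - 1 + 1),
        show c - 1 + 1 = c by omega]
      ring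

theorem hasIso_A {n : ℕ} {u : List ℕ} (hu : IsReduced n u)
    (hw : IsReduced (n + 1) (u.map (· + 1) ++ ascWord (n + 1))) (h : HasIso n u) :
    HasIso (n + 1) (u.map (· + 1) ++ ascWord (n + 1)) := by
  have hd := Dim_succ n
  apply hasIso_ext (muA n) (recA n) ?_ ?_ ?_ ?_ ?_ ?_ (strP_A hu hw) h
  · intro m L t hL ht i
    unfold muA
    by_cases hi : i < n
    · simp only [if_pos hi]; exact ((hL _).add (ht _)).sub (ht _)
    · simp only [if_neg hi]; exact ((hL _).add (ht _)).sub IA.zero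
  · intro m L t hL ht i
    unfold recA
    exact IA.sum _ (fun d x => t d x - L (d + 1) x) (fun d _ => (ht d).sub (hL _))
  · intro L L' t t' hL ht c hc
    unfold muA
    rw [hL (c + 1) (by omega), ht (Dim n + c) (by omega)]
    by_cases hi : c < n
    · simp only [if_pos hi]; rw [ht (Dim n + (c + 1)) (by omega)]
    · simp only [if_neg hi]
  · intro L L' t t' hL ht c hc
    unfold recA
    apply Finset.sum_congr rfl
    intro d hd
    rw [Finset.mem_Ico] at hd
    rw [hL (d + 1) (by omega), ht d (by omega)]
  · intro L t c hc
    unfold recA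
    induction hk : n - c generalizing c with
    | zero =>
      obtain rfl : c = n := by omega
      rw [Finset.sum_Ico_succ_top (by omega), Finset.Ico_self]
      unfold muA
      rw [if_neg (by omega)]
      simp
    | succ k ih =>
      rw [Finset.sum_eq_sum_Ico_succ_bot (by omega), ih (c + 1) (by omega) (by omega)]
      unfold muA
      rw [if_pos (by omega)]
      ring
  · intro L x t c ht hc
    unfold muA
    rw [ht _ (by omega)]
    unfold recA at *
    rw [Finset.sum_eq_sum_Ico_succ_bot (by omega)]
    by_cases hi : c < n
    · rw [if_pos hi, ht _ (by omega)]
      ring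
    · obtain rfl : c = n := by omega
      rw [if_neg hi]
      simp

theorem nice_hasIso (n : ℕ) : ∀ w, IsReduced n w → Nice n w → HasIso n w := by
  induction n with
  | zero =>
    intro w hw _
    refine ⟨fun _ t => t, fun _ x => x, ?_, ?_, ?_, ?_, ?_, ?_, ?_⟩
    · intro m L t hL ht i; exact ht i
    · intro m L t hL ht i; exact ht i
    · intro L L' t t' _ h i hi; exact h i hi
    · intro L L' t t' _ h i hi; exact h i hi
    · intro L t i hi; rfl
    · intro L t i hi; rfl
    · intro L t
      refine ⟨fun _ => trivial, fun _ => ⟨?_, ?_⟩⟩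
      · intro k l hl
        match l, hl with
        | s :: l, ⟨h1, h2, _⟩ => omega
      · intro j hj; simp [Dim] at hj
  | succ n ih =>
    intro w hw ⟨u, hu, hn, h⟩
    rcases h with h | h
    · have h2 := equiv_reduced hw h
      exact hasIso_equiv h2 (equiv_symm h) (hasIso_D hu h2 (ih u hu hn))
    · have h2 := equiv_reduced hw h
      exact hasIso_equiv h2 (equiv_symm h) (hasIso_A hu h2 (ih u hu hn))


/-! ### The Gelfand–Cetlin polytope -/

def RR (n : ℕ) (L x : ℕ → ℝ) (m c : ℕ) : ℝ := if m = n then L c else x (Dim m + c)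

theorem RR_lt {n : ℕ} (L x : ℕ → ℝ) {m : ℕ} (c : ℕ) (h : m < n) : RR n L x m c = x (Dim m + c) :=
  if_neg (by omega)

theorem RR_top (n : ℕ) (L x : ℕ → ℝ) (c : ℕ) : RR n L x n c = L c := if_pos rfl

theorem RR_down {n : ℕ} (L x : ℕ → ℝ) {m : ℕ} (c : ℕ) (h : m ≤ n) :
    RR (n + 1) L x m c = RR n (fun c => x (Dim n + c)) x m c := by
  rw [RR_lt _ _ _ (by omega)]
  unfold RR
  split_ifs with h
  · subst h; rfl
  · rfl

theorem gcs_iff (n : ℕ) : ∀ L x : ℕ → ℝ, GCs n L x ↔ ∀ m c, m < n → c ≤ m →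
    RR n L x m c ≤ RR n L x (m + 1) c ∧ RR n L x (m + 1) (c + 1) ≤ RR n L x m c := by
  induction n with
  | zero => intro L x; exact ⟨fun _ m c h => by omega, fun _ => trivial⟩
  | succ n ih =>
    intro L x
    show (_ ∧ _) ↔ _
    rw [ih]
    constructor
    · rintro ⟨h1, h2⟩ m c hm hc
      rcases Nat.lt_or_ge m n with h | h
      · rw [RR_down _ _ _ (by omega), RR_down _ _ _ (by omega), RR_down _ _ _ (by omega)]
        exact h2 m c h hc
      · obtain rfl : m = n := by omega
        rw [RR_top, RR_top, RR_lt _ _ _ hm]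
        exact (h1 c hc).symm
    · intro h
      refine ⟨fun c hc => ?_, fun m c hm hc => ?_⟩
      · have := h n c (by omega) hc
        rw [RR_top, RR_top, RR_lt _ _ _ (by omega)] at this
        exact this.symm
      · have := h m c (by omega) hc
        rw [RR_down _ _ _ (by omega), RR_down _ _ _ (by omega), RR_down _ _ _ (by omega)] at this
        exact this

def topL (n : ℕ) (lam : ℕ → ℤ) (c : ℕ) : ℝ := ∑ t ∈ Finset.Icc (c + 1) n, (lam t : ℝ)

theorem gcX_eq (n : ℕ) (lam : ℕ → ℤ) (x : Fin (Dim n) → ℝ) (m c : ℕ) :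
    gcX n lam x (m + 1) (c + 1) = RR n (topL n lam) (entry n x) m c := by
  have e : (m + 1) * (m + 1 - 1) / 2 + (c + 1 - 1) = Dim m + c := by
    rw [Nat.add_sub_cancel, Nat.add_sub_cancel, mul_comm]
  unfold gcX RR
  simp only [Nat.add_right_cancel_iff]
  by_cases hm : m = n
  · rw [if_pos hm, if_pos hm]
    unfold topL
    split_ifs with h
    · rfl
    · rw [Finset.Icc_eq_empty (by omega)]; simp
  · rw [if_neg hm, if_neg hm]
    unfold entry
    simp only [e]

theorem mem_GC (n : ℕ) (lam : ℕ → ℤ) (x : Fin (Dim n) → ℝ) : x ∈ GCPolytope n lam ↔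
    ∀ m c, m < n → c ≤ m →
      RR n (topL n lam) (entry n x) m c ≤ RR n (topL n lam) (entry n x) (m + 1) c ∧
      RR n (topL n lam) (entry n x) (m + 1) (c + 1) ≤ RR n (topL n lam) (entry n x) m c := by
  constructor
  · intro h m c hm hc
    have := h (m + 1) (c + 1) (by omega) (by omega) (by omega) (by omega)
    simpa only [gcX_eq] using this
  · intro h k j h1 h2 h3 h4
    obtain ⟨m, rfl⟩ : ∃ m, k = m + 1 := ⟨k - 1, by omega⟩
    obtain ⟨c, rfl⟩ : ∃ m, j = m + 1 := ⟨j - 1, by omega⟩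
    simp only [gcX_eq]
    exact h m c (by omega) (by omega)

theorem topL_anti {n : ℕ} {lam : ℕ → ℤ} (h : RegularDominant n lam) (c : ℕ) (hc : c < n) :
    topL n lam (c + 1) < topL n lam c := by
  have e : topL n lam c = lam (c + 1) + topL n lam (c + 1) := by
    unfold topL
    rw [← Finset.add_sum_Ioc_eq_sum_Icc (by omega)]
    congr 1
    apply Finset.sum_congr _ (fun _ _ => rfl)
    ext y; simp only [Finset.mem_Ioc, Finset.mem_Icc]; omega
  have : (0 : ℝ) < lam (c + 1) := by exact_mod_cast h (c + 1) (by omega) (by omega)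
  linarith

theorem gc_build (θ : ℕ → ℕ → ℝ) (h0 : ∀ m c, 0 ≤ θ m c) (h1 : ∀ m c, θ m c ≤ 1)
    (h2 : ∀ m c, 0 < θ m c ∨ θ m (c + 1) < 1) (n : ℕ) : ∀ L : ℕ → ℝ,
    (∀ c, c < n → L (c + 1) < L c) → ∃ x : ℕ → ℝ, ∀ m c, m < n → c ≤ m →
      RR n L x (m + 1) (c + 1) < RR n L x (m + 1) c ∧
      RR n L x m c = θ m c * RR n L x (m + 1) c + (1 - θ m c) * RR n L x (m + 1) (c + 1) := by
  induction n with
  | zero => intro L _; exact ⟨fun _ => 0, fun m c hm => by omega⟩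
  | succ n ih =>
    intro L hL
    obtain ⟨y, hy⟩ := ih (fun c => θ n c * L c + (1 - θ n c) * L (c + 1)) (by
      intro c hc
      have a1 := hL c (by omega)
      have a2 := hL (c + 1) (by omega)
      have b1 := h0 n c
      have b2 := h1 n (c + 1)
      have b3 : 0 ≤ θ n c * (L c - L (c + 1)) := mul_nonneg b1 (by linarith)
      have b4 : 0 ≤ (1 - θ n (c + 1)) * (L (c + 1) - L (c + 2)) :=
        mul_nonneg (by linarith) (by linarith)
      have : 0 < θ n c * (L c - L (c + 1)) + (1 - θ n (c + 1)) * (L (c + 1) - L (c + 2)) := by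
        rcases h2 n c with h | h
        · have : 0 < θ n c * (L c - L (c + 1)) := mul_pos h (by linarith)
          linarith
        · have : 0 < (1 - θ n (c + 1)) * (L (c + 1) - L (c + 2)) :=
            mul_pos (by linarith) (by linarith)
          linarith
      show θ n (c + 1) * L (c + 1) + (1 - θ n (c + 1)) * L (c + 2) <
        θ n c * L c + (1 - θ n c) * L (c + 1)
      nlinarith)
    have hmono : Monotone Dim := monotone_nat_of_le_succ (fun k => by have := Dim_succ k; omega)
    refine ⟨fun i => if i < Dim n then y i else
      θ n (i - Dim n) * L (i - Dim n) + (1 - θ n (i - Dim n)) * L (i - Dim n + 1), ?_⟩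
    set X : ℕ → ℝ := fun i => if i < Dim n then y i else
      θ n (i - Dim n) * L (i - Dim n) + (1 - θ n (i - Dim n)) * L (i - Dim n + 1) with hX
    have X1 : ∀ i, i < Dim n → X i = y i := fun i hi => if_pos hi
    have X2 : ∀ c, X (Dim n + c) = θ n c * L c + (1 - θ n c) * L (c + 1) := by
      intro c
      rw [hX]
      show (if Dim n + c < Dim n then _ else _) = _
      rw [if_neg (by omega), Nat.add_sub_cancel_left]
    have key : ∀ m c, m ≤ n → c ≤ m → RR (n + 1) L X m c =
        RR n (fun c => θ n c * L c + (1 - θ n c) * L (c + 1)) y m c := by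
      intro m c hm hc
      rw [RR_lt _ _ _ (by omega)]
      unfold RR
      split_ifs with h
      · rw [h, X2]
      · have a1 : Dim (m + 1) ≤ Dim n := hmono (by omega)
        have a2 := Dim_succ m
        exact X1 _ (by omega)
    intro m c hm hc
    rcases Nat.lt_or_ge m n with h | h
    · rw [key _ _ (by omega) (by omega), key _ _ (by omega) (by omega),
        key _ _ (by omega) (by omega)]
      exact hy m c h hc
    · obtain rfl : m = n := by omega
      rw [RR_top, RR_top, RR_lt _ _ _ hm]
      exact ⟨hL c (by omega), X2 c⟩

abbrev GCI (n : ℕ) : Type := (Σ m : Fin n, Fin ((m : ℕ) + 1)) × Bool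

def gcEll (n : ℕ) (L : ℕ → ℝ) (a : GCI n) (x : Fin (Dim n) → ℝ) : ℝ :=
  if a.2 then RR n L (entry n x) (a.1.1 + 1) a.1.2 - RR n L (entry n x) a.1.1 a.1.2
  else RR n L (entry n x) a.1.1 a.1.2 - RR n L (entry n x) (a.1.1 + 1) (a.1.2 + 1)

theorem gc_polyH (n : ℕ) (lam : ℕ → ℤ) : GCPolytope n lam = polyH (gcEll n (topL n lam)) := by
  ext x
  rw [mem_GC]
  constructor
  · rintro h ⟨⟨m, c⟩, b⟩
    have := h m c m.2 (by omega)
    unfold gcEll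
    cases b
    · simp only [Bool.false_eq_true, if_false]; linarith
    · simp only [if_true]; linarith
  · intro h m c hm hc
    have a1 := h ⟨⟨⟨m, hm⟩, ⟨c, by simpa using Nat.lt_succ_of_le hc⟩⟩, true⟩
    have a2 := h ⟨⟨⟨m, hm⟩, ⟨c, by simpa using Nat.lt_succ_of_le hc⟩⟩, false⟩
    unfold gcEll at a1 a2
    simp only [Bool.false_eq_true, if_false, if_true] at a1 a2
    constructor <;> linarith

theorem gcI_card (n : ℕ) : Nat.card (GCI n) = n * (n + 1) := by
  rw [Nat.card_eq_fintype_card, Fintype.card_prod, Fintype.card_sigma, Fintype.card_bool]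
  simp only [Fintype.card_fin]
  rw [Fin.sum_univ_eq_sum_range (fun m => m + 1) n]
  induction n with
  | zero => rfl
  | succ n ih => rw [Finset.sum_range_succ, add_mul, ih]; ring

theorem RR_aff (n : ℕ) (L : ℕ → ℝ) (m c : ℕ) : AffOn (fun x => RR n L (entry n x) m c) := by
  intro x y a b hab
  unfold RR entry
  split_ifs with h
  · rw [← add_mul, hab, one_mul]
  · simp
  · simp

theorem AffOn.sub {m : ℕ} {f g : (Fin m → ℝ) → ℝ} (hf : AffOn f) (hg : AffOn g) :
    AffOn (fun x => f x - g x) := by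
  intro x y a b hab
  simp only [hf x y a b hab, hg x y a b hab]
  ring

theorem gc_point {n : ℕ} {lam : ℕ → ℤ} (h : RegularDominant n lam) (θ : ℕ → ℕ → ℝ)
    (h0 : ∀ m c, 0 ≤ θ m c) (h1 : ∀ m c, θ m c ≤ 1)
    (h2 : ∀ m c, 0 < θ m c ∨ θ m (c + 1) < 1) : ∃ x : Fin (Dim n) → ℝ, ∀ a : GCI n, ∃ p, 0 < p ∧
      gcEll n (topL n lam) a x = (if a.2 then 1 - θ a.1.1 a.1.2 else θ a.1.1 a.1.2) * p := by
  obtain ⟨X, hX⟩ := gc_build θ h0 h1 h2 n (topL n lam) (topL_anti h)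
  have hmono : Monotone Dim := monotone_nat_of_le_succ (fun k => by have := Dim_succ k; omega)
  refine ⟨fun i => X i, ?_⟩
  have e : ∀ m c, m ≤ n → c ≤ m →
      RR n (topL n lam) (entry n (fun i => X i)) m c = RR n (topL n lam) X m c := by
    intro m c hm hc
    unfold RR
    split_ifs with h
    · rfl
    · have a1 : Dim (m + 1) ≤ Dim n := hmono (by omega)
      have a2 := Dim_succ m
      unfold entry
      rw [dif_pos (show Dim m + c < Dim n by omega)]
  rintro ⟨⟨⟨m, hm⟩, ⟨c, hc⟩⟩, b⟩
  simp only at hc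
  obtain ⟨q1, q2⟩ := hX m c hm (by omega)
  refine ⟨RR n (topL n lam) X (m + 1) c - RR n (topL n lam) X (m + 1) (c + 1), by linarith, ?_⟩
  unfold gcEll
  simp only
  rw [e m c (by omega) (by omega), e (m + 1) c (by omega) (by omega),
    e (m + 1) (c + 1) (by omega) (by omega), q2]
  cases b
  · simp only [Bool.false_eq_true, if_false]; ring
  · simp only [if_true]; ring

theorem numFacets_GC {n : ℕ} (hn : 1 ≤ n) {lam : ℕ → ℤ} (h : RegularDominant n lam) :
    numFacets (GCPolytope n lam) = n * (n + 1) := by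
  rw [gc_polyH, ← gcI_card n]
  have : Nonempty (GCI n) := ⟨⟨⟨⟨0, by omega⟩, ⟨0, by simp⟩⟩, true⟩⟩
  apply numFacets_polyH
  · intro a
    unfold gcEll
    cases a.2
    · simp only [Bool.false_eq_true, if_false]; exact (RR_aff _ _ _ _).sub (RR_aff _ _ _ _)
    · simp only [if_true]; exact (RR_aff _ _ _ _).sub (RR_aff _ _ _ _)
  · obtain ⟨x, hx⟩ := gc_point h (fun _ _ => 1 / 2) (fun _ _ => by norm_num)
      (fun _ _ => by norm_num) (fun _ _ => by norm_num)
    refine ⟨x, fun a => ?_⟩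
    obtain ⟨p, hp, e⟩ := hx a
    rw [e]
    apply mul_pos _ hp
    split_ifs <;> norm_num
  · rintro ⟨⟨⟨m, hm⟩, ⟨c, hc⟩⟩, b⟩
    obtain ⟨x, hx⟩ := gc_point h
      (fun m' c' => if m' = m ∧ c' = c then (if b then 1 else 0) else 1 / 2)
      (fun _ _ => by split_ifs <;> norm_num)
      (fun _ _ => by split_ifs <;> norm_num)
      (fun m' c' => by
        by_cases h1 : m' = m ∧ c' = c
        · right; rw [if_neg (by omega)]; norm_num
        · left; rw [if_neg h1]; norm_num)
    refine ⟨x, ?_, ?_⟩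
    · obtain ⟨p, hp, e⟩ := hx ⟨⟨⟨m, hm⟩, ⟨c, hc⟩⟩, b⟩
      rw [e]
      cases b <;> simp
    · rintro ⟨⟨⟨m', hm'⟩, ⟨c', hc'⟩⟩, b'⟩ hne
      obtain ⟨p, hp, e⟩ := hx ⟨⟨⟨m', hm'⟩, ⟨c', hc'⟩⟩, b'⟩
      rw [e]
      apply mul_pos _ hp
      simp only
      by_cases h1 : m' = m ∧ c' = c
      · obtain ⟨rfl, rfl⟩ := h1
        cases b <;> cases b' <;> simp at hne ⊢
      · rw [if_neg h1]
        split_ifs <;> norm_num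

/-! ### Bridging -/

theorem mem_poly {n : ℕ} {w : List ℕ} (hw : IsReduced n w) (lam : ℕ → ℤ) (t : Fin (Dim n) → ℝ) :
    t ∈ stringPolytope n w lam ↔ StrP n w (topL n lam) (entry n t) := by
  unfold stringPolytope StrP
  rw [Set.mem_inter_iff, mem_stringCone hw]
  apply and_congr Iff.rfl
  show (∀ j, LamIneq n w lam j t) ↔ _
  have key : ∀ j : Fin (Dim n), LamIneq n w lam j t ↔
      entry n t j ≤ topL n lam (letterAt w ((j : ℕ) + 1) - 1) - topL n lam (letterAt w ((j : ℕ) + 1)) +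
      ∑ k ∈ Finset.range (Dim n), if (j : ℕ) < k then
        sco (letterAt w ((j : ℕ) + 1)) (letterAt w (k + 1)) * entry n t k else 0 := by
    intro j
    obtain ⟨c1, c2⟩ := letter_rng hw j
    rw [lamIneq_iff]
    unfold slackR colS
    generalize letterAt w ((j : ℕ) + 1) = c at *
    have e1 : topL n lam (c - 1) = lam c + topL n lam c := by
      unfold topL
      rw [Nat.sub_add_cancel c1, ← Finset.add_sum_Ioc_eq_sum_Icc c2]
      congr 1
      apply Finset.sum_congr _ (fun _ _ => rfl)
      ext y; simp only [Finset.mem_Ioc, Finset.mem_Icc]; omega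
    have ee : ∀ k : Fin (Dim n), entry n t k = t k := by
      intro k; unfold entry; rw [dif_pos k.2]
    rw [e1, ← Fin.sum_univ_eq_sum_range (fun k => if (j : ℕ) < k then
        sco c (letterAt w (k + 1)) * entry n t k else 0), ee]
    have e2 : ∀ k : Fin (Dim n), (if (j : ℕ) < (k : ℕ) then
        sco c (letterAt w ((k : ℕ) + 1)) * entry n t k else 0) =
        (if (j : ℕ) + 1 ≤ (k : ℕ) then sco c (letterAt w ((k : ℕ) + 1)) else 0) * t k := by
      intro k
      rw [ee, ite_mul, zero_mul]
      rfl
    simp only [e2]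
    constructor <;> intro h <;> linarith
  constructor
  · intro h j hj
    exact (key ⟨j, hj⟩).1 (h ⟨j, hj⟩)
  · intro h j
    exact (key j).2 (h j j.2)

theorem mem_GC' (n : ℕ) (lam : ℕ → ℤ) (x : Fin (Dim n) → ℝ) :
    x ∈ GCPolytope n lam ↔ GCs n (topL n lam) (entry n x) := by
  rw [mem_GC, gcs_iff]

theorem aff_comp_id {m : ℕ} (M M' : Matrix (Fin m) (Fin m) ℤ) (v v' : Fin m → ℤ)
    (h : ∀ (x : Fin m → ℝ) i, (∑ j, (M' i j : ℝ) * ((∑ k, (M j k : ℝ) * x k) + v j)) + v' i = x i) :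
    M' * M = 1 := by
  ext i k
  have h0 := h 0 i
  have h1 := h (Pi.single k 1) i
  simp only [Pi.zero_apply, mul_zero, Finset.sum_const_zero, zero_add] at h0
  simp only [Pi.single_apply, mul_ite, mul_one, mul_zero, Finset.sum_ite_eq', Finset.mem_univ,
    if_true, mul_add, Finset.sum_add_distrib] at h1
  have h2 : ∑ j, (M' i j : ℝ) * (M j k : ℝ) = if i = k then 1 else 0 := by linarith
  rw [Matrix.mul_apply, Matrix.one_apply]
  have h3 : ((∑ j, M' i j * M j k : ℤ) : ℝ) = ((if i = k then 1 else 0 : ℤ) : ℝ) := by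
    push_cast
    rw [h2]
  exact_mod_cast h3

theorem unimod_of_iso {n : ℕ} {w : List ℕ} (hw : IsReduced n w) (lam : ℕ → ℤ) (h : HasIso n w) :
    UnimodEquiv (stringPolytope n w lam) (GCPolytope n lam) := by
  obtain ⟨F, G, h⟩ := h
  have hL : ∀ c, IA (fun _ : Fin (Dim n) → ℝ => topL n lam c) := by
    intro c
    have := IA.const (m := Dim n) (∑ t ∈ Finset.Icc (c + 1) n, lam t)
    unfold topL
    push_cast at this
    exact this
  have hx : ∀ i, IA (fun x : Fin (Dim n) → ℝ => entry n x i) := by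
    intro i
    unfold entry
    by_cases hi : i < Dim n
    · simp only [dif_pos hi]; exact IA.coord _
    · simp only [dif_neg hi]; exact IA.zero
  have h1 := h.pF (Dim n) (fun c _ => topL n lam c) (fun i x => entry n x i) hL hx
  have h2 := h.pG (Dim n) (fun c _ => topL n lam c) (fun i x => entry n x i) hL hx
  choose M v hM using h1
  choose M' v' hM' using h2
  have eta : ∀ x : Fin (Dim n) → ℝ, (fun a => entry n x a) = entry n x := fun x => rfl
  have etaL : (fun c => topL n lam c) = topL n lam := rfl
  simp only [eta, etaL] at hM hM'
  let f : (Fin (Dim n) → ℝ) → (Fin (Dim n) → ℝ) := fun x i =>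
    (∑ j, (M i j : ℝ) * x j) + (v i : ℝ)
  let g : (Fin (Dim n) → ℝ) → (Fin (Dim n) → ℝ) := fun x i =>
    (∑ j, (M' i j : ℝ) * x j) + (v' i : ℝ)
  have ent : ∀ (x : Fin (Dim n) → ℝ) i (hi : i < Dim n), entry n x i = x ⟨i, hi⟩ := by
    intro x i hi; unfold entry; rw [dif_pos hi]
  have ef : ∀ x i, i < Dim n → entry n (f x) i = F (topL n lam) (entry n x) i := by
    intro x i hi
    rw [hM, ent _ _ hi]
  have eg : ∀ x i, i < Dim n → entry n (g x) i = G (topL n lam) (entry n x) i := by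
    intro x i hi
    rw [hM', ent _ _ hi]
  have gf : ∀ x, g (f x) = x := by
    intro x
    funext i
    have := eg (f x) i i.2
    rw [h.lG _ _ _ _ (fun _ _ => rfl) (ef x) i i.2, h.gf _ _ _ i.2, ent _ _ i.2, ent _ _ i.2] at this
    exact this
  have fg : ∀ x, f (g x) = x := by
    intro x
    funext i
    have := ef (g x) i i.2
    rw [h.lF _ _ _ _ (fun _ _ => rfl) (eg x) i i.2, h.fg _ _ _ i.2, ent _ _ i.2, ent _ _ i.2] at this
    exact this
  have hiff : ∀ x, x ∈ stringPolytope n w lam ↔ f x ∈ GCPolytope n lam := by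
    intro x
    rw [mem_poly hw, mem_GC', h.iff]
    exact ⟨gcs_congr n _ _ _ (fun i hi => (ef x i hi).symm), gcs_congr n _ _ _ (ef x)⟩
  refine ⟨Matrix.of (fun i j : Fin (Dim n) => M i j), fun i => v i, ?_, ?_⟩
  · apply Matrix.isUnit_det_of_left_inverse (B := Matrix.of (fun i j : Fin (Dim n) => M' i j))
    apply aff_comp_id _ _ (fun i => v i) (fun i => v' i)
    intro x i
    exact congrFun (gf x) i
  · show _ = f '' _
    ext x
    constructor
    · intro hx
      refine ⟨g x, ?_, fg x⟩
      rw [hiff, fg]; exact hx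
    · rintro ⟨y, hy, rfl⟩
      exact (hiff y).1 hy

theorem numFacets_unimod {m : ℕ} {P Q : Set (Fin m → ℝ)} (h : UnimodEquiv P Q) :
    numFacets Q = numFacets P := by
  obtain ⟨M, v, hM, rfl⟩ := h
  let MR : Matrix (Fin m) (Fin m) ℝ := M.map (Int.castRingHom ℝ)
  let MI : Matrix (Fin m) (Fin m) ℝ := M⁻¹.map (Int.castRingHom ℝ)
  have e1 : MR * MI = 1 := by
    rw [← Matrix.map_mul, Matrix.mul_nonsing_inv _ hM]
    exact Matrix.map_one _ (by simp) (by simp)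
  have e2 : MI * MR = 1 := by
    rw [← Matrix.map_mul, Matrix.nonsing_inv_mul _ hM]
    exact Matrix.map_one _ (by simp) (by simp)
  let vR : Fin m → ℝ := fun i => v i
  let f : (Fin m → ℝ) ≃ (Fin m → ℝ) :=
    { toFun := fun x => Matrix.mulVec MR x + vR
      invFun := fun y => Matrix.mulVec MI (y - vR)
      left_inv := by intro x; simp [Matrix.mulVec_mulVec, e2]
      right_inv := by intro x; simp [Matrix.mulVec_mulVec, e1] }
  have hf : (fun (x : Fin m → ℝ) i => (∑ j, (M i j : ℝ) * x j) + (v i : ℝ)) = f := by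
    funext x i
    rfl
  rw [hf]
  apply numFacets_image
  intro x y a b hab
  show Matrix.mulVec MR (a • x + b • y) + vR = a • (Matrix.mulVec MR x + vR) +
    b • (Matrix.mulVec MR y + vR)
  rw [Matrix.mulVec_add, Matrix.mulVec_smul, Matrix.mulVec_smul]
  have : vR = a • vR + b • vR := by rw [← add_smul, hab, one_smul]
  rw [smul_add, smul_add]
  nth_rewrite 1 [this]
  abel


theorem two_dim (n : ℕ) : 2 * Dim n = n * (n + 1) := by
  unfold Dim
  exact Nat.mul_div_cancel' (Nat.even_mul_succ_self n).two_dvd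

theorem main_cycle (n : ℕ) (hn : 1 ≤ n) (i : List ℕ) (hi : IsReduced n i)
    (lam : ℕ → ℤ) (hlam : RegularDominant n lam) :
    (UnimodEquiv (stringPolytope n i lam) (GCPolytope n lam) →
      numFacets (stringPolytope n i lam) = n * (n + 1)) ∧
    (numFacets (stringPolytope n i lam) = n * (n + 1) →
      ((interior (stringCone n i)).Nonempty ∧ numFacets (stringCone n i) = Dim n)) ∧
    (((interior (stringCone n i)).Nonempty ∧ numFacets (stringCone n i) = Dim n) →
      SimplicialWord n i) ∧
    (SimplicialWord n i → UnimodEquiv (stringPolytope n i lam) (GCPolytope n lam)) := by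
  refine ⟨fun h => ?_, fun h => ⟨cone_interior hi, ?_⟩, fun h => ?_, fun h => ?_⟩
  · rw [← numFacets_unimod h, numFacets_GC hn hlam]
  · rw [numFacets_poly hn hi lam hlam] at h
    rw [numFacets_cone hn hi]
    have := two_dim n
    omega
  · have h2 := h.2
    rw [numFacets_cone hn hi] at h2
    have hA := arr_nu hi
    exact nice_simplicial n i (ss_nice n i hi (good_ss hA (good_of_card hA h2) n 1 (by omega) (by omega)))
  · exact unimod_of_iso hi lam (nice_hasIso n i hi (simplicial_nice n i hi h))

/-- Main Theorem A.
For `i ∈ Σ_{n+1}` and a regular dominant integral weight `λ`, the following are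
equivalent: (1) `Δ_i(λ)` is unimodularly equivalent to the Gelfand–Cetlin polytope
`GC(λ)`; (2) `Δ_i(λ)` has exactly `n(n+1)` facets; (3) the string cone `C_i` is
simplicial (full-dimensional with exactly `N` facets); (4) there exists
`(σ_1,…,σ_n) ∈ {A,D}^n` with `ind_{σ_k}(C_{σ_{k+1}} ∘ ⋯ ∘ C_{σ_n}(i)) = 0` for
all `k = n, …, 1`. -/
theorem statement18 (n : ℕ) (hn : 1 ≤ n) (i : List ℕ) (hi : IsReduced n i)
    (lam : ℕ → ℤ) (hlam : RegularDominant n lam) :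
    (UnimodEquiv (stringPolytope n i lam) (GCPolytope n lam) ↔
      numFacets (stringPolytope n i lam) = n * (n + 1)) ∧
    (UnimodEquiv (stringPolytope n i lam) (GCPolytope n lam) ↔
      ((interior (stringCone n i)).Nonempty ∧ numFacets (stringCone n i) = Dim n)) ∧
    (UnimodEquiv (stringPolytope n i lam) (GCPolytope n lam) ↔ SimplicialWord n i) := by
  obtain ⟨h1, h2, h3, h4⟩ := main_cycle n hn i hi lam hlam
  exact ⟨⟨h1, fun h => h4 (h3 (h2 h))⟩, ⟨fun h => h2 (h1 h), fun h => h4 (h3 h)⟩,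
    ⟨fun h => h3 (h2 (h1 h)), h4⟩⟩

end StringPolytope
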